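/- Consider the planar parameter-dependent system x' = f(x,y;λ), y' = g(x,y;λ) with λ ∈ [0,1], where f and g are continuously differentiable with respect to (x,y) and continuous in (x,y,λ). Assume: (i) f(0,0;λ) = g(0,0;λ) = 0 and the origin is the only equilibrium of the system for every λ ∈ [0,1]; (ii) the Jacobian matrix J(λ) of the vector field (f,g) at the origin is invertible for every λ ∈ [0,1]; (iii) every complex eigenvalue of J(0) has positive real part and every complex eigenvalue of J(1) has negative real part; (iv) the system has no nonconstant periodic solutions for λ = 0 and for λ = 1. Then the system has a branch of cycles connecting the origin and infinity; that is, for every bounded open set G ⊂ ℝ² containing (0,0) there exist λ ∈ [0,1] and a nonconstant periodic solution of the system whose orbit is contained in the closure of G and intersects the boundary of G. -/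

import Mathlib

open Set

/-- The Jacobian matrix of a planar vector field `V : ℝ × ℝ → ℝ × ℝ` at a point `p`,
given by the partial derivatives of the two components. -/
noncomputable def jacobianAt (V : ℝ × ℝ → ℝ × ℝ) (p : ℝ × ℝ) : Matrix (Fin 2) (Fin 2) ℝ :=
  !![fderiv ℝ (fun q => (V q).1) p (1, 0), fderiv ℝ (fun q => (V q).1) p (0, 1);
     fderiv ℝ (fun q => (V q).2) p (1, 0), fderiv ℝ (fun q => (V q).2) p (0, 1)]

/-- `μ : ℂ` is a (complex) eigenvalue of the real 2×2 matrix `M`. -/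
def IsEigenvalue (M : Matrix (Fin 2) (Fin 2) ℝ) (μ : ℂ) : Prop :=
  μ ∈ spectrum ℂ (M.map (Complex.ofReal))

section
open Set Filter Topology

theorem lyap_core {g : ℝ → ℝ} {q : ℝ}
    (hg : Continuous g)
    (h : ∀ t, g t = q → ∃ g' > 0, HasDerivAt g g' t) {a : ℝ} (ha : q ≤ g a) :
    ∀ t > a, q < g t := by
  -- near a zero
  have right : ∀ t, g t = q → ∀ᶠ s in 𝓝[>] t, q < g s := by
    intro t ht
    obtain ⟨g', hg', hd⟩ := h t ht
    have h1 := (hasDerivAt_iff_tendsto_slope.1 hd)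
    have h2 : ∀ᶠ s in 𝓝[≠] t, 0 < slope g t s := h1.eventually (lt_mem_nhds hg')
    have h3 : ∀ᶠ s in 𝓝[>] t, 0 < slope g t s :=
      h2.filter_mono (nhdsWithin_mono t (fun s hs => ne_of_gt hs))
    filter_upwards [h3, self_mem_nhdsWithin] with s hs hts
    have hts' : t < s := hts
    rw [slope_def_field] at hs
    have := (div_pos_iff_of_pos_right (sub_pos.2 hts')).1 hs
    linarith
  have left : ∀ t, g t = q → ∀ᶠ s in 𝓝[<] t, g s < q := by
    intro t ht
    obtain ⟨g', hg', hd⟩ := h t ht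
    have h1 := (hasDerivAt_iff_tendsto_slope.1 hd)
    have h2 : ∀ᶠ s in 𝓝[≠] t, 0 < slope g t s := h1.eventually (lt_mem_nhds hg')
    have h3 : ∀ᶠ s in 𝓝[<] t, 0 < slope g t s :=
      h2.filter_mono (nhdsWithin_mono t (fun s hs => ne_of_lt hs))
    filter_upwards [h3, self_mem_nhdsWithin] with s hs hts
    have hts' : s < t := hts
    rw [slope_comm, slope_def_field] at hs
    have := (div_pos_iff_of_pos_right (sub_pos.2 hts')).1 hs
    linarith
  -- g ≥ q on [a, b]
  have key : ∀ b, a ≤ b → q ≤ g b := by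
    intro b hab
    have : Icc a b ⊆ {t | q ≤ g t} := by
      apply IsClosed.Icc_subset_of_forall_mem_nhdsWithin
      · exact (isClosed_le continuous_const hg).inter isClosed_Icc
      · exact ha
      · rintro x ⟨hx, hx1⟩
        rcases eq_or_lt_of_le (show q ≤ g x from hx) with h1 | h1
        · filter_upwards [right x h1.symm] with s hs using hs.le
        · have : ∀ᶠ s in 𝓝 x, q < g s := hg.continuousAt.eventually (lt_mem_nhds h1)
          filter_upwards [nhdsWithin_le_nhds this] with s hs using hs.le
    exact this ⟨hab, le_rfl⟩
  intro t ht
  rcases eq_or_lt_of_le (key t ht.le) with h1 | h1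
  · exfalso
    have h2 := left t h1.symm
    have h3 : ∀ᶠ s in 𝓝[<] t, s ∈ Ioo a t := Ioo_mem_nhdsLT ht
    obtain ⟨s, hs1, hs2⟩ := (h2.and h3).exists
    exact absurd (key s hs2.1.le) (not_le.2 hs1)
  · exact h1

theorem zero_persist {X : Type*} [TopologicalSpace X] {F : X → ℝ → ℝ}
    (hF : Continuous fun p : X × ℝ => F p.1 p.2) {x₀ : X} {t₀ c : ℝ}
    (h0 : F x₀ t₀ = 0) (hd : HasDerivAt (F x₀) c t₀) (hc : 0 < c) {ε : ℝ} (hε : 0 < ε) :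
    ∀ᶠ x in 𝓝 x₀, ∃ t ∈ Ioo (t₀ - ε) (t₀ + ε), F x t = 0 := by
  have h1 := (hasDerivAt_iff_tendsto_slope.1 hd)
  have h2 : ∀ᶠ s in 𝓝[≠] t₀, 0 < slope (F x₀) t₀ s := h1.eventually (lt_mem_nhds hc)
  have h3 : ∀ᶠ s in 𝓝[>] t₀, 0 < slope (F x₀) t₀ s :=
    h2.filter_mono (nhdsWithin_mono t₀ (fun s hs => ne_of_gt hs))
  have h4 : ∀ᶠ s in 𝓝[<] t₀, 0 < slope (F x₀) t₀ s :=
    h2.filter_mono (nhdsWithin_mono t₀ (fun s hs => ne_of_lt hs))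
  obtain ⟨b, hb, hb2⟩ := (h3.and (Ioo_mem_nhdsGT (show t₀ < t₀ + ε by linarith))).exists
  obtain ⟨a, ha, ha2⟩ := (h4.and (Ioo_mem_nhdsLT (show t₀ - ε < t₀ by linarith))).exists
  have hFb : 0 < F x₀ b := by
    rw [slope_def_field] at hb
    have := (div_pos_iff_of_pos_right (sub_pos.2 hb2.1)).1 hb
    linarith
  have hFa : F x₀ a < 0 := by
    rw [slope_comm, slope_def_field] at ha
    have := (div_pos_iff_of_pos_right (sub_pos.2 ha2.2)).1 ha
    linarith
  have e1 : ∀ᶠ x in 𝓝 x₀, 0 < F x b :=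
    (hF.comp (Continuous.prodMk continuous_id continuous_const)).continuousAt.eventually
      (lt_mem_nhds hFb)
  have e2 : ∀ᶠ x in 𝓝 x₀, F x a < 0 :=
    (hF.comp (Continuous.prodMk continuous_id continuous_const)).continuousAt.eventually
      (gt_mem_nhds hFa)
  filter_upwards [e1, e2] with x hx1 hx2
  have hab : a ≤ b := (ha2.2.trans hb2.1).le
  have hc : ContinuousOn (F x) (Icc a b) :=
    (hF.comp (Continuous.prodMk continuous_const continuous_id)).continuousOn
  obtain ⟨t, ht, ht0⟩ := intermediate_value_Icc hab hc ⟨hx2.le, hx1.le⟩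
  exact ⟨t, ⟨lt_of_lt_of_le ha2.1 ht.1, lt_of_le_of_lt ht.2 hb2.2⟩, ht0⟩

theorem exp_const {X : Type*} [TopologicalSpace X] {S : Set X} (hS : IsPreconnected S)
    {D : X → ℂ} (hD : ContinuousOn D S) {c : ℂ} (h : ∀ x ∈ S, Complex.exp (D x) = c)
    {x y : X} (hx : x ∈ S) (hy : y ∈ S) : D x = D y := by
  -- integer valued
  have hint : ∀ z ∈ S, ∃ n : ℤ, D z = D x + n * (2 * Real.pi * Complex.I) := by
    intro z hz
    exact Complex.exp_eq_exp_iff_exists_int.1 ((h z hz).trans (h x hx).symm)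
  let f : X → ℝ := fun z => ((D z - D x).im) / (2 * Real.pi)
  have hf : ContinuousOn f S := by
    refine ContinuousOn.div_const ?_ _
    exact Complex.continuous_im.comp_continuousOn (hD.sub continuousOn_const)
  have hfint : ∀ z ∈ S, ∀ n : ℤ, D z = D x + n * (2 * Real.pi * Complex.I) → f z = n := by
    intro z hz n hn
    have : D z - D x = ((n * (2 * Real.pi) : ℝ) : ℂ) * Complex.I := by
      rw [hn]; push_cast; ring
    simp only [f, this]
    simp
  have hmaps : MapsTo f S (range ((↑) : ℤ → ℝ)) := by
    intro z hz
    obtain ⟨n, hn⟩ := hint z hz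
    exact ⟨n, (hfint z hz n hn).symm⟩
  have hdisc : IsDiscrete (range ((↑) : ℤ → ℝ)) := by
    have := Int.isClosedEmbedding_coe_real.isEmbedding.isInducing
    exact Int.isClosedEmbedding_coe_real.isEmbedding.isDiscrete_range
  have := hS.constant_of_mapsTo hdisc hf hmaps hy hx
  obtain ⟨n, hn⟩ := hint y hy
  have h1 := hfint y hy n hn
  have h2 : f x = 0 := by simp [f]
  rw [h1, h2] at this
  have : n = 0 := by exact_mod_cast this
  rw [hn, this]; simp

theorem log_lift {E : Type*} [AddCommGroup E] [Module ℝ E] [TopologicalSpace E]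
    [IsTopologicalAddGroup E] [ContinuousSMul ℝ E] [LocallyConvexSpace ℝ E]
    {F : E → ℂ} (hF : Continuous F) (h0 : ∀ x, F x ≠ 0) :
    ∃ L : E → ℂ, Continuous L ∧ ∀ x, Complex.exp (L x) = F x := by
  have : LocallyPathConnectedSpace E := inferInstance
  obtain ⟨L, ⟨hL1, hL2⟩, -⟩ := Complex.isCoveringMapOn_exp.existsUnique_continuousMap_lifts
    (⟨F, hF⟩ : C(E, ℂ)) (a₀ := 0) (e₀ := Complex.log (F 0)) (by simp [Complex.exp_log (h0 0)])
    (fun x => by simpa using h0 x)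
  exact ⟨L, L.continuous, fun x => congrFun hL2 x⟩
end

section
open Set Filter Topology Metric

theorem lip_ball {f : ℂ → ℂ} (hf : ContDiff ℝ 1 f) (z : ℂ) (R : ℝ) :
    ∃ K : NNReal, LipschitzOnWith K f (closedBall z R) := by
  have hc : Continuous (fun x => fderiv ℝ f x) := hf.continuous_fderiv (by simp)
  obtain ⟨M, hM⟩ := (isCompact_closedBall z R).exists_bound_of_continuousOn hc.continuousOn
  refine ⟨M.toNNReal, (convex_closedBall z R).lipschitzOnWith_of_nnnorm_fderiv_le
    (fun x _ => (hf.differentiable (by simp)) x) (fun x hx => ?_)⟩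
  have := hM x hx
  rw [← NNReal.coe_le_coe]
  simpa using Or.inl this

theorem sol_unique_Ioo {f : ℂ → ℂ} (hf : ContDiff ℝ 1 f) {n : ℝ} {x y : ℝ → ℂ}
    (hx : ∀ t ∈ Ioo (-n) n, HasDerivAt x (f (x t)) t)
    (hy : ∀ t ∈ Ioo (-n) n, HasDerivAt y (f (y t)) t) (h0 : x 0 = y 0) :
    EqOn x y (Ioo (-n) n) := by
  intro t ht
  obtain ⟨m, hm1, hm2⟩ := exists_between (show |t| < n from abs_lt.2 ht)
  have hsub : Icc (-m) m ⊆ Ioo (-n) n := fun s hs => ⟨by linarith [hs.1], by linarith [hs.2]⟩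
  have cx : ContinuousOn x (Icc (-m) m) := fun s hs => (hx s (hsub hs)).continuousAt.continuousWithinAt
  have cy : ContinuousOn y (Icc (-m) m) := fun s hs => (hy s (hsub hs)).continuousAt.continuousWithinAt
  obtain ⟨A, hA⟩ := isCompact_Icc.exists_bound_of_continuousOn cx
  obtain ⟨B, hB⟩ := isCompact_Icc.exists_bound_of_continuousOn cy
  obtain ⟨K, hK⟩ := lip_ball hf 0 (max A B)
  have h0m : (0:ℝ) < m := lt_of_le_of_lt (abs_nonneg t) hm1
  refine ODE_solution_unique_of_mem_Ioo (v := fun _ => f) (s := fun _ => closedBall 0 (max A B))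
    (a := -m) (b := m) (t₀ := 0) (fun _ _ => hK) ⟨by linarith, h0m⟩ ?_ ?_ h0 (abs_lt.1 hm1)
  · intro s hs
    refine ⟨hx s (hsub (Ioo_subset_Icc_self hs)), ?_⟩
    simp only [mem_closedBall, dist_zero_right]
    exact (hA s (Ioo_subset_Icc_self hs)).trans (le_max_left _ _)
  · intro s hs
    refine ⟨hy s (hsub (Ioo_subset_Icc_self hs)), ?_⟩
    simp only [mem_closedBall, dist_zero_right]
    exact (hB s (Ioo_subset_Icc_self hs)).trans (le_max_right _ _)

theorem sol_unique {f : ℂ → ℂ} (hf : ContDiff ℝ 1 f) {x y : ℝ → ℂ}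
    (hx : ∀ t, HasDerivAt x (f (x t)) t)
    (hy : ∀ t, HasDerivAt y (f (y t)) t) (h0 : x 0 = y 0) (t : ℝ) : x t = y t := by
  refine sol_unique_Ioo hf (n := |t| + 1) (fun t _ => hx t) (fun t _ => hy t) h0 ?_
  exact abs_lt.1 (by linarith)

theorem sol_exists {f : ℂ → ℂ} (hf : ContDiff ℝ 1 f) {C : ℝ} (hC : ∀ z, ‖f z‖ ≤ C) (z : ℂ) :
    ∃ x : ℝ → ℂ, x 0 = z ∧ ∀ t, HasDerivAt x (f (x t)) t := by
  have hC0 : 0 ≤ C := (norm_nonneg _).trans (hC 0)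
  have key : ∀ n : ℕ, ∃ x : ℝ → ℂ, x 0 = z ∧ ∀ t ∈ Ioo (-(n+1:ℝ)) (n+1), HasDerivAt x (f (x t)) t := by
    intro n
    have hn : (0:ℝ) ≤ n + 1 := by positivity
    obtain ⟨K, hK⟩ := lip_ball hf z (C * (n+1))
    have hpl : IsPicardLindelof (fun _ : ℝ => f) (tmin := -(n+1:ℝ)) (tmax := n+1)
        ⟨0, by constructor <;> linarith⟩ z ⟨C * (n+1), by positivity⟩ 0 ⟨C, hC0⟩ K := by
      apply IsPicardLindelof.of_time_independent
      · intro x _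
        exact hC x
      · exact hK
      · simp
        exact le_rfl
    obtain ⟨α, h0, hα⟩ := hpl.exists_eq_forall_mem_Icc_hasDerivWithinAt₀
    refine ⟨α, h0, fun t ht => ?_⟩
    exact (hα t (Ioo_subset_Icc_self ht)).hasDerivAt (Icc_mem_nhds ht.1 ht.2)
  choose α h0 hα using key
  have hcomp : ∀ m n : ℕ, m ≤ n → EqOn (α m) (α n) (Ioo (-(m+1:ℝ)) (m+1)) := by
    intro m n hmn
    refine sol_unique_Ioo hf (hα m) (fun t ht => hα n t ?_) ((h0 m).trans (h0 n).symm)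
    have : (m:ℝ) ≤ n := by exact_mod_cast hmn
    exact ⟨by linarith [ht.1], by linarith [ht.2]⟩
  have hfl : ∀ t : ℝ, ∀ n : ℕ, |t| < n + 1 → α ⌊|t|⌋₊ t = α n t := by
    intro t n hn
    have h1 : ⌊|t|⌋₊ ≤ n := by
      have := (Nat.floor_lt (abs_nonneg t)).2 (show |t| < ((n+1:ℕ):ℝ) by push_cast; exact hn)
      omega
    exact hcomp _ n h1 (abs_lt.1 (Nat.lt_floor_add_one |t|))
  refine ⟨fun t => α ⌊|t|⌋₊ t, by simp [h0], fun t => ?_⟩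
  obtain ⟨n, hn⟩ := exists_nat_gt |t|
  have hn' : |t| < n + 1 := by linarith
  have := hα n t (abs_lt.1 hn')
  rw [← hfl t n hn'] at this
  refine this.congr_of_eventuallyEq ?_
  have : ∀ᶠ s : ℝ in 𝓝 t, |s| < (n:ℝ) + 1 := continuous_abs.continuousAt.eventually (gt_mem_nhds hn')
  filter_upwards [this] with s hs
  exact hfl s n hs

theorem sol_speed {f : ℂ → ℂ} {C : ℝ} (hC : ∀ z, ‖f z‖ ≤ C) {x : ℝ → ℂ}
    (hx : ∀ t, HasDerivAt x (f (x t)) t) (s t : ℝ) : dist (x t) (x s) ≤ C * |t - s| := by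
  have := Convex.norm_image_sub_le_of_norm_hasDerivWithin_le (f := x) (s := univ) (C := C)
    (x := s) (y := t) (fun t _ => (hx t).hasDerivWithinAt) (fun t _ => hC _) convex_univ
    (mem_univ _) (mem_univ _)
  rw [dist_eq_norm]
  simpa using this

theorem gron {f : ℂ → ℂ} (hf : ContDiff ℝ 1 f) {C : ℝ} (hC : ∀ z, ‖f z‖ ≤ C) {T : ℝ} (hT : 0 ≤ T)
    (z₀ : ℂ) {η : ℝ} (hη : 0 < η) : ∃ δ > 0, ∀ h : ℂ → ℂ, (∀ z, ‖h z‖ ≤ C) →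
      (∀ z ∈ closedBall z₀ (1 + C * T), dist (h z) (f z) ≤ δ) →
      ∀ x y : ℝ → ℂ, (∀ t, HasDerivAt x (f (x t)) t) → (∀ t, HasDerivAt y (h (y t)) t) →
      x 0 = z₀ → dist (y 0) z₀ ≤ δ → dist (y T) (x T) ≤ η := by
  obtain ⟨K, hK⟩ := lip_ball hf z₀ (1 + C * T)
  have hC0 : 0 ≤ C := (norm_nonneg _).trans (hC 0)
  have hK' : LipschitzOnWith (K+1) f (closedBall z₀ (1 + C * T)) := hK.weaken (by simp)
  set E := Real.exp (((K+1 : NNReal):ℝ) * T) with hE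
  have hE0 : 0 < E := Real.exp_pos _
  refine ⟨min 1 (η / (2 * E)), by positivity, ?_⟩
  intro h hh hd x y hx hy h0 hy0
  set δ := min 1 (η / (2 * E)) with hδ
  have hδ0 : 0 < δ := by positivity
  have hδ1 : δ ≤ 1 := min_le_left _ _
  have hδ2 : δ * (2 * E) ≤ η := by
    have := min_le_right 1 (η / (2 * E))
    calc δ * (2 * E) ≤ η / (2 * E) * (2 * E) := by gcongr
      _ = η := by field_simp
  have hxm : ∀ t ∈ Ico 0 T, x t ∈ closedBall z₀ (1 + C * T) := by
    intro t ht
    have := sol_speed hC hx 0 t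
    rw [h0, sub_zero, abs_of_nonneg ht.1] at this
    rw [mem_closedBall]
    nlinarith [ht.2, mul_le_mul_of_nonneg_left ht.2.le hC0]
  have hym : ∀ t ∈ Ico 0 T, y t ∈ closedBall z₀ (1 + C * T) := by
    intro t ht
    have := sol_speed hh hy 0 t
    rw [sub_zero, abs_of_nonneg ht.1] at this
    rw [mem_closedBall]
    have h3 := dist_triangle (y t) (y 0) z₀
    nlinarith [ht.2, mul_le_mul_of_nonneg_left ht.2.le hC0]
  have := dist_le_of_approx_trajectories_ODE_of_mem (v := fun _ => f) (K := K+1)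
    (s := fun _ => closedBall z₀ (1 + C * T)) (f := y) (g := x) (a := 0) (b := T)
    (f' := fun t => h (y t)) (g' := fun t => f (x t)) (εf := δ) (εg := 0) (δ := δ)
    (fun _ _ => hK') (fun t _ => (hy t).continuousAt.continuousWithinAt)
    (fun t _ => (hy t).hasDerivWithinAt) (fun t ht => hd _ (hym t ht)) hym
    (fun t _ => (hx t).continuousAt.continuousWithinAt)
    (fun t _ => (hx t).hasDerivWithinAt) (fun t ht => by simp) hxm (by rw [h0]; exact hy0) T
    ⟨hT, le_rfl⟩
  refine this.trans ?_
  have hK1 : (1:ℝ) ≤ ((K+1 : NNReal):ℝ) := by push_cast; simp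
  rw [gronwallBound_of_K_ne_0 (by positivity)]
  simp only [add_zero, sub_zero]
  rw [← hE]
  have hE1 : 1 ≤ E := Real.one_le_exp (by positivity)
  have : δ / ((K+1 : NNReal):ℝ) ≤ δ := div_le_self hδ0.le hK1
  nlinarith [mul_le_mul_of_nonneg_right this (show 0 ≤ E - 1 by linarith)]

theorem flow_exists {W : ℝ → ℂ → ℂ} (hW : Continuous fun p : ℝ × ℂ => W p.1 p.2)
    (hs : ∀ l, ContDiff ℝ 1 (W l)) {C : ℝ} (hC : ∀ l z, ‖W l z‖ ≤ C) :
    ∃ φ : ℝ → ℝ → ℂ → ℂ, Continuous (fun p : ℝ × ℝ × ℂ => φ p.1 p.2.1 p.2.2) ∧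
      (∀ l z, φ l 0 z = z) ∧ (∀ l s t z, φ l (s + t) z = φ l s (φ l t z)) ∧
      (∀ l z t, HasDerivAt (fun t => φ l t z) (W l (φ l t z)) t) ∧
      (∀ l (x : ℝ → ℂ), (∀ t, HasDerivAt x (W l (x t)) t) → ∀ t, x t = φ l t (x 0)) := by
  have hC0 : 0 ≤ C := (norm_nonneg _).trans (hC 0 0)
  choose φ h0 hd using fun l z => sol_exists (hs l) (hC l) z
  have huni : ∀ l (x : ℝ → ℂ), (∀ t, HasDerivAt x (W l (x t)) t) → ∀ t, x t = φ l (x 0) t :=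
    fun l x hx t => sol_unique (hs l) hx (hd l _) (h0 l _).symm t
  refine ⟨fun l t z => φ l z t, ?_, h0, ?_, hd, huni⟩
  · have hunif : ∀ (l₀ : ℝ) (z₀ : ℂ) (R δ : ℝ), 0 < δ → ∀ᶠ l in 𝓝 l₀,
        ∀ z ∈ closedBall z₀ R, dist (W l z) (W l₀ z) ≤ δ := by
      intro l₀ z₀ R δ hδ
      have := (isCompact_closedBall z₀ R).eventually_forall_of_forall_eventually (x₀ := l₀)
        (P := fun l z => dist (W l z) (W l₀ z) < δ) ?_
      · filter_upwards [this] with l hl z hz using (hl z hz).le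
      · intro z _
        have hc : Continuous fun p : ℝ × ℂ => dist (W p.1 p.2) (W l₀ p.2) := by
          apply hW.dist
          exact hW.comp (continuous_const.prodMk continuous_snd)
        have : ∀ᶠ p in 𝓝 (l₀, z), dist (W p.1 p.2) (W l₀ p.2) < δ :=
          hc.continuousAt.eventually (gt_mem_nhds (by simpa using hδ))
        exact this
    have hfix : ∀ (l₀ t₀ : ℝ) (z₀ : ℂ) (η : ℝ), 0 < η →
        ∀ᶠ p : ℝ × ℂ in 𝓝 (l₀, z₀), dist (φ p.1 p.2 t₀) (φ l₀ z₀ t₀) ≤ η := by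
      intro l₀ t₀ z₀ η hη
      rcases le_total 0 t₀ with ht | ht
      · obtain ⟨δ, hδ, H⟩ := gron (hs l₀) (hC l₀) ht z₀ hη
        rw [nhds_prod_eq]
        filter_upwards [(hunif l₀ z₀ (1 + C * t₀) δ hδ).prod_mk (closedBall_mem_nhds z₀ hδ)] with p hp
        exact H (W p.1) (hC p.1) hp.1 _ _ (hd l₀ z₀) (hd p.1 p.2) (h0 _ _) (by rw [h0]; exact hp.2)
      · obtain ⟨δ, hδ, H⟩ := gron (f := fun z => - W l₀ z) (hs l₀).neg
          (C := C) (fun z => by simpa using hC l₀ z) (T := -t₀) (by linarith) z₀ hη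
        rw [nhds_prod_eq]
        filter_upwards [(hunif l₀ z₀ (1 + C * (-t₀)) δ hδ).prod_mk (closedBall_mem_nhds z₀ hδ)] with p hp
        have rev : ∀ l z t, HasDerivAt (fun t => φ l z (-t)) (-W l (φ l z (-t))) t := by
          intro l z t
          have := (hd l z (-t)).scomp t (hasDerivAt_neg t)
          simpa [Function.comp_def] using this
        have := H (fun z => - W p.1 z) (fun z => by simpa using hC p.1 z)
          (fun z hz => by simpa using hp.1 z hz) _ _ (rev l₀ z₀) (rev p.1 p.2)
          (by simp [h0]) (by simp only [neg_zero, h0]; exact hp.2)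
        simpa using this
    rw [continuous_iff_continuousAt]
    rintro ⟨l₀, t₀, z₀⟩
    rw [ContinuousAt, Metric.tendsto_nhds]
    intro η hη
    have e1 : ∀ᶠ p : ℝ × ℝ × ℂ in 𝓝 (l₀, t₀, z₀), dist (φ p.1 p.2.2 t₀) (φ l₀ z₀ t₀) ≤ η / 3 := by
      have hcc : Continuous fun p : ℝ × ℝ × ℂ => (p.1, p.2.2) := by fun_prop
      exact (hcc.tendsto (l₀, t₀, z₀)).eventually (hfix l₀ t₀ z₀ (η/3) (by positivity))
    have e2 : ∀ᶠ p : ℝ × ℝ × ℂ in 𝓝 (l₀, t₀, z₀), C * |p.2.1 - t₀| < η / 3 := by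
      have hcc : Continuous fun p : ℝ × ℝ × ℂ => C * |p.2.1 - t₀| := by fun_prop
      exact hcc.continuousAt.eventually (gt_mem_nhds (by simpa using by positivity))
    filter_upwards [e1, e2] with p h1 h2
    have h3 := sol_speed (hC p.1) (hd p.1 p.2.2) t₀ p.2.1
    have := dist_triangle (φ p.1 p.2.2 p.2.1) (φ p.1 p.2.2 t₀) (φ l₀ z₀ t₀)
    show dist (φ p.1 p.2.2 p.2.1) (φ l₀ z₀ t₀) < η
    linarith
  · intro l s t z
    have := huni l (fun s => φ l z (s + t)) (fun s => (hd l z (s+t)).comp_add_const s t) s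
    simpa using this
end

section
open Set Filter Topology Metric

theorem arc_log {x v : ℝ → ℂ} {t₀ t₁ : ℝ} (h : t₀ ≤ t₁) (hx : ∀ t, HasDerivAt x (v t) t)
    (hv : Continuous v) : ∃ Θ : ℂ → ℂ, ∀ w, (∀ t ∈ Icc t₀ t₁, x t ≠ w) →
      ContinuousAt Θ w ∧ Complex.exp (Θ w) = (x t₁ - w) / (x t₀ - w) := by
  have hxc : Continuous x := continuous_iff_continuousAt.2 fun t => (hx t).continuousAt
  refine ⟨fun w => ∫ t in t₀..t₁, v t / (x t - w), fun w hw => ⟨?_, ?_⟩⟩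
  · -- continuity
    obtain ⟨d, hd, hdist⟩ : ∃ d > 0, ∀ t ∈ Icc t₀ t₁, d ≤ ‖x t - w‖ := by
      have hc : ContinuousOn (fun t => ‖x t - w‖) (Icc t₀ t₁) := by fun_prop
      obtain ⟨m, hm, hmin⟩ := isCompact_Icc.exists_isMinOn (nonempty_Icc.2 h) hc
      exact ⟨‖x m - w‖, norm_pos_iff.2 (sub_ne_zero.2 (hw m hm)), fun t ht => hmin ht⟩
    obtain ⟨M, hM⟩ := isCompact_Icc.exists_bound_of_continuousOn (s := Icc t₀ t₁) hv.continuousOn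
    have hball : ∀ᶠ w' in 𝓝 w, ∀ t ∈ Icc t₀ t₁, d / 2 ≤ ‖x t - w'‖ := by
      filter_upwards [closedBall_mem_nhds w (half_pos hd)] with w' hw' t ht
      have h1 := hdist t ht
      have h2 : ‖w' - w‖ ≤ d / 2 := by simpa [dist_eq_norm] using hw'
      have h3 : ‖x t - w‖ ≤ ‖x t - w'‖ + ‖w' - w‖ := by
        have := norm_add_le (x t - w') (w' - w)
        simpa using this
      linarith
    have hI : uIoc t₀ t₁ ⊆ Icc t₀ t₁ := by
      rw [uIoc_of_le h]; exact Ioc_subset_Icc_self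
    apply intervalIntegral.continuousAt_of_dominated_interval (bound := fun _ => M / (d/2))
    · filter_upwards [hball] with w' hw'
      apply ContinuousOn.aestronglyMeasurable _ measurableSet_uIoc
      apply ContinuousOn.mono _ hI
      apply ContinuousOn.div hv.continuousOn (by fun_prop)
      intro t ht h0
      have := hw' t ht
      rw [h0] at this
      simp at this
      linarith
    · filter_upwards [hball] with w' hw'
      refine Eventually.of_forall fun t ht => ?_
      rw [norm_div]
      have h1 := hM t (hI ht)
      have h0 := (norm_nonneg _).trans h1
      exact div_le_div₀ h0 h1 (by positivity) (hw' t (hI ht))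
    · simp
    · refine Eventually.of_forall fun t ht => ?_
      apply ContinuousAt.div continuousAt_const (by fun_prop)
      exact sub_ne_zero.2 (hw t (hI ht))
  · set p : ℝ → ℝ := fun t => projIcc t₀ t₁ h t with hp
    have hpc : Continuous p := continuous_subtype_val.comp continuous_projIcc
    have hpm : ∀ t, p t ∈ Icc t₀ t₁ := fun t => (projIcc t₀ t₁ h t).2
    have hpe : ∀ t ∈ Icc t₀ t₁, p t = t := fun t ht => by simp [hp, projIcc_of_mem h ht]
    set g : ℝ → ℂ := fun t => v (p t) / (x (p t) - w) with hg
    have hgc : Continuous g := by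
      apply Continuous.div (hv.comp hpc) ((hxc.comp hpc).sub continuous_const)
      intro t
      exact sub_ne_zero.2 (hw _ (hpm t))
    have hint : ∫ t in t₀..t₁, v t / (x t - w) = ∫ t in t₀..t₁, g t := by
      apply intervalIntegral.integral_congr
      intro t ht
      rw [uIcc_of_le h] at ht
      have hgt : g t = v t / (x t - w) := by simp only [hg, hpe t ht]
      exact hgt.symm
    have hder : ∀ t, HasDerivAt (fun u => ∫ s in t₀..u, g s) (g t) t := fun t =>
      intervalIntegral.integral_hasDerivAt_right (hgc.intervalIntegrable _ _)
        (hgc.stronglyMeasurableAtFilter _ _) hgc.continuousAt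
    set H : ℝ → ℂ := fun t => Complex.exp (-(∫ s in t₀..t, g s)) * (x t - w) with hH
    have hHd : ∀ t ∈ Icc t₀ t₁, HasDerivAt H 0 t := by
      intro t ht
      have := ((hder t).neg.cexp).mul ((hx t).sub_const w)
      refine (show HasDerivAt H _ t from this).congr_deriv ?_
      have hne : x t - w ≠ 0 := sub_ne_zero.2 (hw t ht)
      have hgt : g t = v t / (x t - w) := by simp only [hg, hpe t ht]
      rw [hgt]
      field_simp
      simp
    have hconst := constant_of_has_deriv_right_zero (f := H) (a := t₀) (b := t₁)
      (fun t ht => (hHd t ht).continuousAt.continuousWithinAt)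
      (fun t ht => (hHd t (Ico_subset_Icc_self ht)).hasDerivWithinAt) t₁ ⟨h, le_rfl⟩
    simp only [hH, intervalIntegral.integral_same, neg_zero, Complex.exp_zero, one_mul] at hconst
    show Complex.exp (∫ t in t₀..t₁, v t / (x t - w)) = _
    rw [hint, eq_div_iff (sub_ne_zero.2 (hw t₀ ⟨le_rfl, h⟩)), ← hconst, ← mul_assoc, ← Complex.exp_add]
    simp

structure IsFlow (φ : ℝ → ℂ → ℂ) (V : ℂ → ℂ) : Prop where
  cont : Continuous fun p : ℝ × ℂ => φ p.1 p.2
  zero : ∀ z, φ 0 z = z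
  add : ∀ s t z, φ (s + t) z = φ s (φ t z)
  deriv : ∀ z t, HasDerivAt (fun t => φ t z) (V (φ t z)) t
  vcont : Continuous V

theorem IsFlow.ct {φ V} (hφ : IsFlow φ V) (z : ℂ) : Continuous fun t => φ t z :=
  hφ.cont.comp (continuous_id.prodMk continuous_const)

theorem IsFlow.cancel {φ V} (hφ : IsFlow φ V) (t : ℝ) (z : ℂ) : φ (-t) (φ t z) = z := by
  rw [← hφ.add, neg_add_cancel, hφ.zero]

theorem IsFlow.per {φ V} (hφ : IsFlow φ V) {s t : ℝ} {z : ℂ} (h : φ s z = φ t z) (u : ℝ) :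
    φ (u + (t - s)) z = φ u z := by
  have : u + (t - s) = (u - s) + t := by ring
  rw [this, hφ.add, ← h, ← hφ.add, sub_add_cancel]

theorem IsFlow.per_int {φ V} (hφ : IsFlow φ V) {P : ℝ} {z : ℂ} (h : φ P z = z) (n : ℤ) (u : ℝ) :
    φ (u + n * P) z = φ u z := by
  have hp : Function.Periodic (fun t => φ t z) P := by
    intro t
    show φ (t + P) z = φ t z
    rw [hφ.add, h]
  exact hp.int_mul n u

theorem local_cross {φ V} (hφ : IsFlow φ V) {a b : ℝ}
    (hV : ∀ s ∈ Icc a b, 0 < (V (s:ℂ)).im) :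
    ∃ τ > 0, ∀ s ∈ Icc a b, ∀ e, 0 < e → e < τ → 0 < (φ e s).im ∧ (φ (-e) s).im < 0 := by
  have := (isCompact_Icc (a := a) (b := b)).eventually_forall_of_forall_eventually (x₀ := (0:ℝ))
    (P := fun t s => 0 < (V (φ t (s:ℂ))).im) ?_
  · obtain ⟨τ, hτ, H⟩ := Metric.eventually_nhds_iff.1 this
    refine ⟨τ, hτ, fun s hs e he heτ => ?_⟩
    have hmono : StrictMonoOn (fun t => (φ t (s:ℂ)).im) (Ioo (-τ) τ) := by
      have hd : ∀ t, HasDerivAt (fun t => (φ t (s:ℂ)).im) (V (φ t (s:ℂ))).im t := fun t => by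
        have := (Complex.imCLM.hasFDerivAt.comp_hasDerivAt t (hφ.deriv s t))
        simpa [Function.comp_def] using this
      apply strictMonoOn_of_deriv_pos (convex_Ioo _ _)
      · exact fun t _ => (hd t).continuousAt.continuousWithinAt
      · intro t ht
        rw [interior_Ioo] at ht
        rw [(hd t).deriv]
        apply H _ s hs
        simpa using abs_lt.2 ht
    have h0 : (φ 0 (s:ℂ)).im = 0 := by rw [hφ.zero]; simp
    constructor
    · have := hmono (a := 0) (b := e) ⟨by linarith, hτ⟩ ⟨by linarith, heτ⟩ he
      simp only [h0] at this
      exact this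
    · have := hmono (a := -e) (b := 0) ⟨by linarith, by linarith⟩ ⟨by linarith, hτ⟩ (by linarith)
      simp only [h0] at this
      exact this
  · intro s hs
    have hc : Continuous fun p : ℝ × ℝ => (V (φ p.1 (p.2:ℂ))).im := by
      apply Complex.continuous_im.comp
      apply hφ.vcont.comp
      exact hφ.cont.comp (continuous_fst.prodMk (Complex.continuous_ofReal.comp continuous_snd))
    have : 0 < (V (φ (0:ℝ) (s:ℂ))).im := by rw [hφ.zero]; exact hV s hs
    exact hc.continuousAt.eventually (lt_mem_nhds this)
end

section
open Set Filter Topology Metric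

theorem seg_slit {s₀ s₁ : ℝ} {w : ℂ} (h01 : s₀ < s₁)
    (hw : ∀ s ∈ Icc s₀ s₁, w ≠ (s:ℂ)) : ((s₁ - w) / (s₀ - w) : ℂ) ∈ Complex.slitPlane := by
  rw [Complex.mem_slitPlane_iff_not_le_zero]
  intro hle
  rw [Complex.le_def] at hle
  obtain ⟨hre, him⟩ := hle
  set r : ℂ := (s₁ - w) / (s₀ - w) with hr
  have hne : (s₀ - w : ℂ) ≠ 0 := fun h => hw s₀ ⟨le_rfl, h01.le⟩ (by linear_combination -h)
  have hrr : r = ((r.re : ℝ):ℂ) := by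
    apply Complex.ext <;> simp
    simpa using him
  set k := r.re with hk
  have hk0 : k ≤ 0 := by simpa using hre
  have hmul : (s₁ - w : ℂ) = k * (s₀ - w) := by
    rw [← hrr, hr]; field_simp
  have h1k : (0:ℝ) < 1 - k := by linarith
  have hwv : w = (((s₁ - k * s₀) / (1 - k) : ℝ) : ℂ) := by
    have : (1 - k : ℂ) ≠ 0 := by exact_mod_cast h1k.ne'
    push_cast
    rw [eq_div_iff this]
    linear_combination -hmul
  refine hw _ ⟨?_, ?_⟩ hwv
  · rw [le_div_iff₀ h1k]; nlinarith
  · rw [div_le_iff₀ h1k]; nlinarith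

theorem lemmaM {φ V} (hφ : IsFlow φ V) {a b : ℝ}
    (hV : ∀ s ∈ Icc a b, 0 < (V (s:ℂ)).im) {z : ℂ} {t₀ t₁ s₀ s₁ : ℝ} (ht : t₀ < t₁)
    (hs₀ : s₀ ∈ Icc a b) (hs₁ : s₁ ∈ Icc a b) (h01 : s₀ < s₁)
    (hx₀ : φ t₀ z = s₀) (hx₁ : φ t₁ z = s₁)
    (hno : ∀ t ∈ Ioo t₀ t₁, ∀ s ∈ Icc a b, φ t z ≠ (s:ℂ)) :
    ∀ c > t₁, ∀ s ∈ Icc a b, φ c z = (s:ℂ) → s₁ < s := by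
  intro c₀ hc₀ σ₀ hσ₀ hxc₀
  by_contra hlt
  push Not at hlt
  obtain ⟨τ, hτ, hcross⟩ := local_cross hφ hV
  have hxc := hφ.ct z
  -- no two crossings within τ
  have nocl : ∀ t t' s s', s ∈ Icc a b → φ t z = (s:ℂ) → φ t' z = ((s':ℝ):ℂ) → t < t' → τ ≤ t' - t := by
    intro t t' s s' hs h1 h2 htt
    by_contra hcon
    push Not at hcon
    have := (hcross s hs (t' - t) (by linarith) hcon).1
    rw [← h1, ← hφ.add, sub_add_cancel, h2] at this
    simp at this
  -- first crossing
  set B : Set ℝ := {t | t ∈ Icc (t₁ + τ) c₀ ∧ φ t z ∈ (fun s : ℝ => (s:ℂ)) '' Icc a s₁} with hB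
  have hBc : IsCompact B := by
    have hcl : IsClosed ((fun t => φ t z) ⁻¹' ((fun s : ℝ => (s:ℂ)) '' Icc a s₁)) := by
      apply IsClosed.preimage hxc
      exact (isCompact_Icc.image Complex.continuous_ofReal).isClosed
    exact isCompact_Icc.inter_right hcl
  have hBn : B.Nonempty := ⟨c₀, ⟨by linarith [nocl t₁ c₀ s₁ σ₀ hs₁ hx₁ hxc₀ hc₀], le_rfl⟩,
    σ₀, ⟨hσ₀.1, hlt⟩, hxc₀.symm⟩
  obtain ⟨c, hcB, hcmin⟩ := hBc.exists_isLeast hBn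
  obtain ⟨⟨hct, hcc₀⟩, σ, hσ, hxσ⟩ := hcB
  have hxσ : φ c z = (σ:ℂ) := hxσ.symm
  have hc1 : t₁ < c := by linarith
  have hfirst : ∀ t, t₁ < t → t < c → ∀ s ∈ Icc a s₁, φ t z ≠ (s:ℂ) := by
    intro t h1 h2 s hs hxt
    have h3 := nocl t₁ t s₁ s hs₁ hx₁ hxt h1
    have : c ≤ t := hcmin ⟨⟨by linarith, by linarith⟩, s, hs, hxt.symm⟩
    linarith
  -- no period shifting t₀ below c
  have noper : ∀ P > 0, t₀ + P < c → φ (t₀ + P) z = φ t₀ z → False := by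
    intro P hP h1 h2
    rw [hx₀] at h2
    rcases lt_trichotomy (t₀ + P) t₁ with h | h | h
    · exact hno _ ⟨by linarith, h⟩ s₀ hs₀ h2
    · rw [h, hx₁] at h2
      have : s₁ = s₀ := by exact_mod_cast h2
      linarith
    · exact hfirst _ h h1 s₀ ⟨hs₀.1, h01.le⟩ h2
  have hσ1 : σ < s₁ := by
    rcases hσ.2.lt_or_eq with h | h
    · exact h
    · exfalso
      rw [h, ← hx₁] at hxσ
      exact noper (c - t₁) (by linarith) (by linarith) (hφ.per hxσ.symm t₀)
  have hσab : σ ∈ Icc a b := ⟨hσ.1, hσ.2.trans hs₁.2⟩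
  -- the sets
  set Sp : Set ℂ := (fun p : ℝ × ℝ => φ p.1 (p.2:ℂ)) '' (Ioo 0 τ ×ˢ Ioc s₀ s₁) with hSp
  set Sm : Set ℂ := (fun p : ℝ × ℝ => φ (-p.1) (p.2:ℂ)) '' (Ioo 0 τ ×ˢ Ico a s₁) with hSm
  set T : Set ℂ := (fun t => φ t z) '' Ioo t₁ c with hT
  have pSp : IsPreconnected Sp := by
    apply IsPreconnected.image (isPreconnected_Ioo.prod isPreconnected_Ioc)
    apply Continuous.continuousOn
    exact hφ.cont.comp (continuous_fst.prodMk (Complex.continuous_ofReal.comp continuous_snd))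
  have pSm : IsPreconnected Sm := by
    apply IsPreconnected.image (isPreconnected_Ioo.prod isPreconnected_Ico)
    apply Continuous.continuousOn
    exact hφ.cont.comp (continuous_fst.neg.prodMk (Complex.continuous_ofReal.comp continuous_snd))
  have pT : IsPreconnected T := isPreconnected_Ioo.image _ hxc.continuousOn
  obtain ⟨e, he0, he⟩ : ∃ e, 0 < e ∧ e < min τ (c - t₁) :=
    exists_between (lt_min hτ (by linarith))
  have heτ : e < τ := he.trans_le (min_le_left _ _)
  have hec : e < c - t₁ := he.trans_le (min_le_right _ _)
  have pU : IsPreconnected (Sp ∪ T ∪ Sm) := by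
    have h1 : φ (t₁ + e) z ∈ Sp := ⟨(e, s₁), ⟨⟨he0, heτ⟩, h01, le_rfl⟩, by
      simp only; rw [← hx₁, ← hφ.add, add_comm]⟩
    have h2 : φ (t₁ + e) z ∈ T := ⟨t₁ + e, ⟨by linarith, by linarith⟩, rfl⟩
    have h3 : φ (c - e) z ∈ T := ⟨c - e, ⟨by linarith, by linarith⟩, rfl⟩
    have h4 : φ (c - e) z ∈ Sm := ⟨(e, σ), ⟨⟨he0, heτ⟩, hσ.1, hσ1⟩, by
      simp only; rw [← hxσ, ← hφ.add]; congr 1; ring⟩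
    exact (pSp.union _ h1 h2 pT).union _ (Or.inr h3) h4 pSm
  -- disjointness from the arc and segment
  have dU : ∀ w ∈ Sp ∪ T ∪ Sm, (∀ t ∈ Icc t₀ t₁, φ t z ≠ w) ∧ ∀ s ∈ Icc s₀ s₁, w ≠ (s:ℂ) := by
    rintro w ((⟨⟨ε, s⟩, ⟨⟨h1, h2⟩, h3, h4⟩, rfl⟩ | ⟨t, ⟨h1, h2⟩, rfl⟩) | ⟨⟨ε, s⟩, ⟨⟨h1, h2⟩, h3, h4⟩, rfl⟩)
    · simp only at h1 h2 h3 h4 ⊢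
      have hsab : s ∈ Icc a b := ⟨by linarith [hs₀.1], h4.trans hs₁.2⟩
      constructor
      · intro t' ht' heq
        have h5 : φ (t' - ε) z = s := by
          have := hφ.cancel ε s
          rw [← heq, ← hφ.add] at this
          rw [← this]; congr 1; ring
        rcases lt_trichotomy (t' - ε) t₀ with h | h | h
        · linarith [nocl _ _ _ _ hsab h5 hx₀ h, ht'.1]
        · rw [h, hx₀] at h5
          have : s₀ = s := by exact_mod_cast h5
          linarith
        · exact hno _ ⟨h, by linarith [ht'.2]⟩ s hsab h5
      · intro s' hs' heq
        have := (hcross s hsab ε h1 h2).1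
        rw [heq] at this
        simp at this
    · constructor
      · intro t' ht' heq
        exact noper (t - t') (by linarith [ht'.2]) (by linarith [ht'.1]) (hφ.per heq t₀)
      · intro s' hs'
        exact hfirst t h1 h2 s' ⟨hs₀.1.trans hs'.1, hs'.2⟩
    · simp only at h1 h2 h3 h4 ⊢
      have hsab : s ∈ Icc a b := ⟨h3, h4.le.trans hs₁.2⟩
      constructor
      · intro t' ht' heq
        have h5 : φ (t' + ε) z = s := by
          have := hφ.cancel (-ε) s
          rw [← heq, ← hφ.add] at this
          rw [← this]; congr 1; ring
        rcases lt_trichotomy (t' + ε) t₁ with h | h | h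
        · exact hno _ ⟨by linarith [ht'.1], h⟩ s hsab h5
        · rw [h, hx₁] at h5
          have : s₁ = s := by exact_mod_cast h5
          linarith
        · linarith [nocl _ _ _ _ hs₁ hx₁ h5 h, ht'.2]
      · intro s' hs' heq
        have := (hcross s hsab ε h1 h2).2
        rw [heq] at this
        simp at this
  obtain ⟨Θ, hΘ⟩ := arc_log ht.le (fun t => hφ.deriv z t) (hφ.vcont.comp hxc)
  set D : ℂ → ℂ := fun w => Θ w - Complex.log ((s₁ - w) / (s₀ - w)) with hD
  have hDc : ContinuousOn D (Sp ∪ T ∪ Sm) := by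
    intro w hw
    obtain ⟨h1, h2⟩ := dU w hw
    apply ContinuousAt.continuousWithinAt
    apply (hΘ w h1).1.sub
    refine ContinuousAt.clog (f := fun w : ℂ => ((s₁:ℂ) - w) / (s₀ - w)) ?_ (seg_slit h01 h2)
    apply ContinuousAt.div (by fun_prop) (by fun_prop)
    intro h
    exact h2 s₀ ⟨le_rfl, h01.le⟩ (by linear_combination -h)
  have hDe : ∀ w ∈ Sp ∪ T ∪ Sm, Complex.exp (D w) = 1 := by
    intro w hw
    obtain ⟨h1, h2⟩ := dU w hw
    have hne := Complex.slitPlane_ne_zero (seg_slit h01 h2)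
    rw [hD]
    simp only
    rw [Complex.exp_sub, (hΘ w h1).2, Complex.exp_log hne, hx₀, hx₁, div_self hne]
  have hDconst : ∀ w ∈ Sp ∪ T ∪ Sm, ∀ w' ∈ Sp ∪ T ∪ Sm, D w = D w' :=
    fun w hw w' hw' => exp_const pU hDc hDe hw hw'
  obtain ⟨m, hm0, hm1⟩ := exists_between h01
  have hmab : m ∈ Icc a b := ⟨by linarith [hs₀.1], by linarith [hs₁.2]⟩
  have hmarc : ∀ t ∈ Icc t₀ t₁, φ t z ≠ (m:ℂ) := by
    intro t ht' hh
    rcases ht'.1.eq_or_lt with h | h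
    · rw [← h, hx₀] at hh
      have : s₀ = m := by exact_mod_cast hh
      linarith
    rcases ht'.2.eq_or_lt with h' | h'
    · rw [h', hx₁] at hh
      have : s₁ = m := by exact_mod_cast hh
      linarith
    · exact hno t ⟨h, h'⟩ m hmab hh
  set K := D (φ e m) with hK
  have hKm : φ e (m:ℂ) ∈ Sp ∪ T ∪ Sm := Or.inl (Or.inl ⟨(e, m), ⟨⟨he0, heτ⟩, hm0, hm1.le⟩, rfl⟩)
  -- limits
  have hne0 : ((s₀:ℂ) - m) ≠ 0 := by
    have : s₀ - m ≠ 0 := by linarith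
    exact_mod_cast this
  have hratio : ((s₁:ℂ) - m) / (s₀ - m) = (((s₁ - m) / (s₀ - m) : ℝ) : ℂ) := by push_cast; rfl
  have hrneg : (s₁ - m) / (s₀ - m) < 0 := div_neg_of_pos_of_neg (by linarith) (by linarith)
  have hrc : ContinuousAt (fun w : ℂ => ((s₁:ℂ) - w) / (s₀ - w)) (m:ℂ) :=
    ContinuousAt.div (by fun_prop) (by fun_prop) hne0
  have him : ∀ w : ℂ, (((s₁:ℂ) - w) / (s₀ - w)).im = (s₁ - s₀) * w.im / Complex.normSq (s₀ - w) := by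
    intro w
    rw [Complex.div_im]
    simp
    ring
  have hposs : ∀ w : ℂ, w.im ≠ 0 → 0 < Complex.normSq (s₀ - w) := by
    intro w hw
    apply Complex.normSq_pos.2
    intro h
    have := congrArg Complex.im h
    simp at this
    exact hw this
  have hlim : Tendsto (fun ε => φ ε (m:ℂ)) (𝓝[>] 0) (𝓝 (m:ℂ)) := by
    have := (hφ.ct m).tendsto 0
    rw [hφ.zero] at this
    exact this.mono_left nhdsWithin_le_nhds
  have hlim' : Tendsto (fun ε => φ (-ε) (m:ℂ)) (𝓝[>] 0) (𝓝 (m:ℂ)) := by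
    have := ((hφ.ct m).comp continuous_neg).tendsto 0
    simp only [Function.comp_def, neg_zero, hφ.zero] at this
    exact this.mono_left nhdsWithin_le_nhds
  have hev : ∀ᶠ ε in 𝓝[>] (0:ℝ), 0 < ε ∧ ε < τ := by
    have := Ioo_mem_nhdsGT hτ
    filter_upwards [this] with ε h using h
  have l1 : Tendsto (fun ε => D (φ ε (m:ℂ))) (𝓝[>] 0) (𝓝 (Θ m - (Real.log ‖((s₁:ℂ) - m) / (s₀ - m)‖ + Real.pi * Complex.I))) := by
    apply Tendsto.sub ((hΘ m hmarc).1.tendsto.comp hlim)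
    apply (Complex.tendsto_log_nhdsWithin_im_nonneg_of_re_neg_of_im_zero ?_ ?_).comp
    · apply tendsto_nhdsWithin_of_tendsto_nhds_of_eventually_within _ (hrc.tendsto.comp hlim)
      filter_upwards [hev] with ε hε
      have := (hcross m hmab ε hε.1 hε.2).1
      simp only [Function.comp]
      rw [him]
      have h2 := hposs _ this.ne'
      have : 0 < s₁ - s₀ := by linarith
      positivity
    · rw [hratio, Complex.ofReal_re]; exact hrneg
    · rw [hratio]; simp only [Complex.ofReal_im]
  have l2 : Tendsto (fun ε => D (φ (-ε) (m:ℂ))) (𝓝[>] 0) (𝓝 (Θ m - (Real.log ‖((s₁:ℂ) - m) / (s₀ - m)‖ - Real.pi * Complex.I))) := by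
    apply Tendsto.sub ((hΘ m hmarc).1.tendsto.comp hlim')
    apply (Complex.tendsto_log_nhdsWithin_im_neg_of_re_neg_of_im_zero ?_ ?_).comp
    · apply tendsto_nhdsWithin_of_tendsto_nhds_of_eventually_within _ (hrc.tendsto.comp hlim')
      filter_upwards [hev] with ε hε
      have := (hcross m hmab ε hε.1 hε.2).2
      simp only [Function.comp]
      rw [him]
      have h2 := hposs _ this.ne
      have : 0 < s₁ - s₀ := by linarith
      apply div_neg_of_neg_of_pos _ h2
      nlinarith
    · rw [hratio, Complex.ofReal_re]; exact hrneg
    · rw [hratio]; simp only [Complex.ofReal_im]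
  have k1 : Tendsto (fun ε => D (φ ε (m:ℂ))) (𝓝[>] 0) (𝓝 K) := by
    apply tendsto_const_nhds.congr'
    filter_upwards [hev] with ε hε
    exact hDconst _ hKm _ (Or.inl (Or.inl ⟨(ε, m), ⟨hε, hm0, hm1.le⟩, rfl⟩))
  have k2 : Tendsto (fun ε => D (φ (-ε) (m:ℂ))) (𝓝[>] 0) (𝓝 K) := by
    apply tendsto_const_nhds.congr'
    filter_upwards [hev] with ε hε
    exact hDconst _ hKm _ (Or.inr ⟨(ε, m), ⟨hε, hmab.1, hm1⟩, rfl⟩)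
  have e1 := tendsto_nhds_unique k1 l1
  have e2 := tendsto_nhds_unique k2 l2
  rw [e1] at e2
  have : (Real.pi : ℂ) * Complex.I = 0 := by linear_combination (-1/2) * e2
  simp [Real.pi_ne_zero] at this
end

section
open Set Filter Topology Metric

open ComplexConjugate in
theorem IsFlow.revconj {φ V} (hφ : IsFlow φ V) :
    IsFlow (fun t w => conj (φ (-t) (conj w))) (fun w => -conj (V (conj w))) where
  cont := by
    have := hφ.cont
    exact Complex.continuous_conj.comp (this.comp (continuous_fst.neg.prodMk
      (Complex.continuous_conj.comp continuous_snd)))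
  zero z := by simp [hφ.zero]
  add s t z := by
    have : -(s + t) = -s + -t := by ring
    simp only [this, hφ.add, Complex.conj_conj]
  deriv z t := by
    have h1 := (hφ.deriv (conj z) (-t)).scomp t (hasDerivAt_neg t)
    have h2 := Complex.conjCLE.toContinuousLinearMap.hasFDerivAt.comp_hasDerivAt t h1
    refine (show HasDerivAt (fun t => conj (φ (-t) (conj z))) _ t from h2).congr_deriv ?_
    simp
  vcont := (Complex.continuous_conj.comp (hφ.vcont.comp Complex.continuous_conj)).neg

open ComplexConjugate in
theorem IsFlow.mirror {φ V} (hφ : IsFlow φ V) :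
    IsFlow (fun t w => -conj (φ t (-conj w))) (fun w => -conj (V (-conj w))) where
  cont := by
    have := hφ.cont
    exact (Complex.continuous_conj.comp (this.comp (continuous_fst.prodMk
      (Complex.continuous_conj.comp continuous_snd).neg))).neg
  zero z := by simp [hφ.zero]
  add s t z := by simp [hφ.add]
  deriv z t := by
    have h1 := (hφ.deriv (-conj z) t)
    have h2 := (Complex.conjCLE.toContinuousLinearMap.hasFDerivAt.comp_hasDerivAt t h1).neg
    refine (show HasDerivAt (fun t => -conj (φ t (-conj z))) _ t from h2).congr_deriv ?_
    simp
  vcont := (Complex.continuous_conj.comp (hφ.vcont.comp Complex.continuous_conj.neg)).neg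

theorem IsFlow.affine {φ V} (hφ : IsFlow φ V) (p : ℂ) {u : ℂ} (hu : u ≠ 0) :
    IsFlow (fun t w => (φ t (p + w * u) - p) / u) (fun w => V (p + w * u) / u) where
  cont := by
    have := hφ.cont
    have h2 : Continuous fun q : ℝ × ℂ => φ q.1 (p + q.2 * u) :=
      this.comp (continuous_fst.prodMk (continuous_const.add (continuous_snd.mul continuous_const)))
    fun_prop
  zero z := by simp [hφ.zero, hu]
  add s t z := by
    simp only [hφ.add]
    congr 3
    field_simp
    ring
  deriv z t := by
    have := ((hφ.deriv (p + z * u) t).sub_const p).div_const u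
    refine this.congr_deriv ?_
    congr 2
    field_simp
    ring
  vcont := by
    have := hφ.vcont
    fun_prop

theorem Mstar0 {φ V} (hφ : IsFlow φ V) {a b : ℝ}
    (hV : ∀ s ∈ Icc a b, 0 < (V (s:ℂ)).im) {z : ℂ} {p q r sp sq sr : ℝ} (hpq : p < q) (hqr : q < r)
    (hsp : sp ∈ Icc a b) (hsq : sq ∈ Icc a b) (hsr : sr ∈ Icc a b)
    (hp : φ p z = sp) (hq : φ q z = sq) (hr : φ r z = sr) (hlt : sp < sq) : sq ≤ sr := by
  obtain ⟨τ, hτ, hcross⟩ := local_cross hφ hV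
  have hxc := hφ.ct z
  have nocl : ∀ t t' s s', s ∈ Icc a b → φ t z = (s:ℂ) → φ t' z = ((s':ℝ):ℂ) → t < t' → τ ≤ t' - t := by
    intro t t' s s' hs h1 h2 htt
    by_contra hcon
    push Not at hcon
    have := (hcross s hs (t' - t) (by linarith) hcon).1
    rw [← h1, ← hφ.add, sub_add_cancel, h2] at this
    simp at this
  -- last crossing before q
  set B : Set ℝ := {t | t ∈ Icc p (q - τ) ∧ φ t z ∈ (fun s : ℝ => (s:ℂ)) '' Icc a b} with hB
  have hBc : IsCompact B := by
    have hcl : IsClosed ((fun t => φ t z) ⁻¹' ((fun s : ℝ => (s:ℂ)) '' Icc a b)) := by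
      apply IsClosed.preimage hxc
      exact (isCompact_Icc.image Complex.continuous_ofReal).isClosed
    exact isCompact_Icc.inter_right hcl
  have hBn : B.Nonempty := ⟨p, ⟨le_rfl, by linarith [nocl _ _ _ _ hsp hp hq hpq]⟩, sp, hsp, hp.symm⟩
  obtain ⟨p', ⟨⟨hp1, hp2⟩, s', hs', hp'⟩, hmax⟩ := hBc.exists_isGreatest hBn
  have hp' : φ p' z = (s':ℂ) := hp'.symm
  have hp'q : p' < q := by linarith
  have hno : ∀ t ∈ Ioo p' q, ∀ s ∈ Icc a b, φ t z ≠ (s:ℂ) := by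
    intro t ht s hs hx
    have h1 := nocl _ _ _ _ hs hx hq ht.2
    have : t ≤ p' := hmax ⟨⟨by linarith [ht.1], by linarith⟩, s, hs, hx.symm⟩
    linarith [ht.1]
  rcases lt_trichotomy s' sq with h | h | h
  · exact (lemmaM hφ hV hp'q hs' hsq h hp' hq hno r hqr sr hsr hr).le
  · exfalso
    have hP : φ (q - p') z = z := by
      have := hφ.per (s := p') (t := q) (z := z) (by rw [hp', hq, h]) 0
      simpa [hφ.zero] using this
    have hP0 : 0 < q - p' := by linarith
    obtain ⟨n, hn, -⟩ := existsUnique_add_zsmul_mem_Ico hP0 p p'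
    have h1 : φ (p + n * (q - p')) z = sp := by rw [hφ.per_int hP, hp]
    simp only [zsmul_eq_mul] at hn
    rcases hn.1.eq_or_lt with h2 | h2
    · rw [← h2, hp'] at h1
      have : s' = sp := by exact_mod_cast h1
      linarith
    · exact hno _ ⟨h2, by linarith [hn.2]⟩ sp hsp h1
  · exfalso
    rcases hp1.eq_or_lt with h2 | h2
    · rw [← h2, hp] at hp'
      have : sp = s' := by exact_mod_cast hp'
      linarith
    have := lemmaM hφ.revconj (a := a) (b := b) (fun s hs => by simpa using hV s hs)
      (z := (starRingEnd ℂ) z) (t₀ := -q) (t₁ := -p') (s₀ := sq) (s₁ := s') (by linarith) hsq hs' h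
      (by simp [hq]) (by simp [hp']) (fun t ht s hs heq => by
        refine hno (-t) ⟨by linarith [ht.2], by linarith [ht.1]⟩ s hs ?_
        have := congrArg (starRingEnd ℂ) heq
        simpa using this) (-p) (by linarith) sp hsp (by simp [hp])
    linarith

theorem Mstar {φ V} (hφ : IsFlow φ V) {a b : ℝ} {c u : ℂ} (hu : u ≠ 0)
    (hV : ∀ s ∈ Icc a b, 0 < (V (c + s * u) / u).im) {z : ℂ} {p q r sp sq sr : ℝ} (hpq : p < q)
    (hqr : q < r)
    (hsp : sp ∈ Icc a b) (hsq : sq ∈ Icc a b) (hsr : sr ∈ Icc a b)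
    (hp : φ p z = c + sp * u) (hq : φ q z = c + sq * u) (hr : φ r z = c + sr * u) (hlt : sp < sq) :
    sq ≤ sr := by
  exact Mstar0 (hφ.affine c hu) hV (z := (z - c) / u) hpq hqr hsp hsq hsr (by simp [hp, hu])
    (by simp [hq, hu]) (by simp [hr, hu]) hlt

theorem Mstar' {φ V} (hφ : IsFlow φ V) {a b : ℝ} {c u : ℂ} (hu : u ≠ 0)
    (hV : ∀ s ∈ Icc a b, 0 < (V (c + s * u) / u).im) {z : ℂ} {p q r sp sq sr : ℝ} (hpq : p < q)
    (hqr : q < r)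
    (hsp : sp ∈ Icc a b) (hsq : sq ∈ Icc a b) (hsr : sr ∈ Icc a b)
    (hp : φ p z = c + sp * u) (hq : φ q z = c + sq * u) (hr : φ r z = c + sr * u) (hlt : sq < sp) :
    sr ≤ sq := by
  have := Mstar0 (hφ.affine c hu).mirror (a := -b) (b := -a) (fun s hs => by
      have := hV (-s) ⟨by linarith [hs.2], by linarith [hs.1]⟩
      simpa [-map_div₀] using this) (z := -(starRingEnd ℂ) ((z - c) / u)) hpq hqr (sp := -sp) (sq := -sq) (sr := -sr)
    ⟨by linarith [hsp.2], by linarith [hsp.1]⟩ ⟨by linarith [hsq.2], by linarith [hsq.1]⟩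
    ⟨by linarith [hsr.2], by linarith [hsr.1]⟩
    (by simp [-map_div₀, hp, hu])
    (by simp [-map_div₀, hq, hu]) (by simp [-map_div₀, hr, hu]) (by linarith)
  linarith

theorem KL {φ V} (hφ : IsFlow φ V) {a b : ℝ} {c u : ℂ} (hu : u ≠ 0)
    (hV : ∀ s ∈ Icc a b, 0 < (V (c + s * u) / u).im) {z : ℂ} {P p q sp sq : ℝ} (hP : 0 < P)
    (hper : φ P z = z) (hsp : sp ∈ Icc a b) (hsq : sq ∈ Icc a b)
    (hp : φ p z = c + sp * u) (hq : φ q z = c + sq * u) : sp = sq := by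
  have key : ∀ {p q sp sq : ℝ}, sp ∈ Icc a b → sq ∈ Icc a b → φ p z = c + sp * u →
      φ q z = c + sq * u → ¬ sp < sq := by
    intro p q sp sq hsp hsq hp hq hlt
    obtain ⟨n, hn⟩ := exists_nat_gt ((p - q) / P)
    obtain ⟨m, hm⟩ := exists_nat_gt ((q + n * P - p) / P)
    have hn' : p < q + n * P := by
      rw [div_lt_iff₀ hP] at hn; linarith
    have hm' : q + n * P < p + m * P := by
      rw [div_lt_iff₀ hP] at hm; linarith
    have h1 : φ (q + n * P) z = c + sq * u := by
      have := hφ.per_int hper n q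
      push_cast at this
      rw [this, hq]
    have h2 : φ (p + m * P) z = c + sp * u := by
      have := hφ.per_int hper m p
      push_cast at this
      rw [this, hp]
    linarith [Mstar hφ hu hV hn' hm' hsp hsq hsp hp h1 h2 hlt]
  rcases lt_trichotomy sp sq with h | h | h
  · exact absurd h (key hsp hsq hp hq)
  · exact h
  · exact absurd h (key hsq hsp hq hp)
end

section
open Set Filter Topology Metric

theorem cross_persist {X : Type*} [TopologicalSpace X] {W : ℝ → ℂ → ℂ} {φ : ℝ → ℝ → ℂ → ℂ}
    (hφc : Continuous fun p : ℝ × ℝ × ℂ => φ p.1 p.2.1 p.2.2)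
    (hfl : ∀ l, IsFlow (φ l) (W l)) {L : X → ℝ} {Z C U : X → ℂ} (hL : Continuous L)
    (hZ : Continuous Z) (hC : Continuous C) (hU : Continuous U) (hU0 : ∀ x, U x ≠ 0)
    {x₀ : X} {t₀ s₀ : ℝ} (h : φ (L x₀) t₀ (Z x₀) = C x₀ + s₀ * U x₀)
    (hpos : 0 < (W (L x₀) (C x₀ + s₀ * U x₀) / U x₀).im) {η : ℝ} (hη : 0 < η) :
    ∀ᶠ x in 𝓝 x₀, ∃ t s : ℝ, |t - t₀| < η ∧ |s - s₀| < η ∧ φ (L x) t (Z x) = C x + s * U x := by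
  have hH : Continuous fun p : X × ℝ => (φ (L p.1) p.2 (Z p.1) - C p.1) / U p.1 := by
    apply Continuous.div _ (hU.comp continuous_fst) (fun p => hU0 _)
    apply Continuous.sub _ (hC.comp continuous_fst)
    exact hφc.comp ((hL.comp continuous_fst).prodMk (continuous_snd.prodMk (hZ.comp continuous_fst)))
  have hval : (φ (L x₀) t₀ (Z x₀) - C x₀) / U x₀ = s₀ := by
    rw [h]; field_simp [hU0 x₀]; ring
  have hre : ∀ᶠ p : X × ℝ in 𝓝 (x₀, t₀), |((φ (L p.1) p.2 (Z p.1) - C p.1) / U p.1).re - s₀| < η := by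
    have hc : Continuous fun p : X × ℝ => |((φ (L p.1) p.2 (Z p.1) - C p.1) / U p.1).re - s₀| :=
      ((Complex.continuous_re.comp hH).sub continuous_const).abs
    apply hc.continuousAt.eventually (gt_mem_nhds _)
    simp only [hval]
    simpa using hη
  rw [nhds_prod_eq] at hre
  obtain ⟨p1, hp1, p2, hp2, H⟩ := eventually_prod_iff.1 hre
  obtain ⟨η', hη', H2⟩ := Metric.eventually_nhds_iff.1 hp2
  have hd : HasDerivAt (fun t => ((φ (L x₀) t (Z x₀) - C x₀) / U x₀).im)
      (W (L x₀) (C x₀ + s₀ * U x₀) / U x₀).im t₀ := by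
    have h1 := (((hfl (L x₀)).deriv (Z x₀) t₀).sub_const (C x₀)).div_const (U x₀)
    have := Complex.imCLM.hasFDerivAt.comp_hasDerivAt t₀ h1
    rw [h] at this
    simpa [Function.comp_def] using this
  have := zero_persist (F := fun x t => ((φ (L x) t (Z x) - C x) / U x).im)
    (Complex.continuous_im.comp hH) (x₀ := x₀) (t₀ := t₀) (by simp [hval]) hd hpos
    (ε := min η η') (lt_min hη hη')
  filter_upwards [this, hp1] with x ⟨t, ht, hFt⟩ hx
  have habs : |t - t₀| < min η η' := by
    rw [abs_lt]; constructor <;> linarith [ht.1, ht.2]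
  refine ⟨t, ((φ (L x) t (Z x) - C x) / U x).re, habs.trans_le (min_le_left _ _),
    H hx (H2 (by rw [Real.dist_eq]; exact habs.trans_le (min_le_right _ _))), ?_⟩
  have : (((φ (L x) t (Z x) - C x) / U x).re : ℂ) = (φ (L x) t (Z x) - C x) / U x := by
    apply Complex.ext
    · simp
    · simp only [Complex.ofReal_im]; exact hFt.symm
  rw [this]
  field_simp [hU0 x]
  ring

theorem closed_cycles {W : ℝ → ℂ → ℂ} {φ : ℝ → ℝ → ℂ → ℂ}
    (hφc : Continuous fun p : ℝ × ℝ × ℂ => φ p.1 p.2.1 p.2.2)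
    (hW : Continuous fun p : ℝ × ℂ => W p.1 p.2)
    (hfl : ∀ l, IsFlow (φ l) (W l)) {K : Set ℂ} (hK : IsCompact K) {I : Set ℝ}
    (hI : IsClosed I) (hne : ∀ l ∈ I, ∀ z ∈ K, W l z ≠ 0) :
    IsClosed {p : ℝ × ℂ | p.1 ∈ I ∧ (∃ T > 0, φ p.1 T p.2 = p.2) ∧ ∀ t, φ p.1 t p.2 ∈ K} := by
  apply isClosed_of_closure_subset
  rintro ⟨l, z⟩ hcl
  rw [mem_closure_iff_frequently] at hcl
  have hcl2 : ∀ S : Set (ℝ × ℂ), IsClosed S →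
      {p : ℝ × ℂ | p.1 ∈ I ∧ (∃ T > 0, φ p.1 T p.2 = p.2) ∧ ∀ t, φ p.1 t p.2 ∈ K} ⊆ S → (l, z) ∈ S := by
    intro S hS hsub
    exact closure_minimal hsub hS (mem_closure_iff_frequently.2 hcl)
  have hlI : l ∈ I := hcl2 {p | p.1 ∈ I} (hI.preimage continuous_fst) (fun p hp => hp.1)
  have horb : ∀ t, φ l t z ∈ K := fun t =>
    hcl2 {p | φ p.1 t p.2 ∈ K} (hK.isClosed.preimage
      (hφc.comp (continuous_fst.prodMk (continuous_const.prodMk continuous_snd)))) (fun p hp => hp.2.2 t)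
  refine ⟨hlI, ?_, horb⟩
  -- cluster point
  obtain ⟨q, hqK, hq⟩ := hK.exists_mapClusterPt (u := fun k : ℕ => φ l k z) (f := atTop)
    (by
      rw [Filter.le_principal_iff, Filter.mem_map]
      exact Filter.Eventually.of_forall fun k : ℕ => horb k)
  have hWq := hne l hlI q hqK
  set u : ℂ := -Complex.I * W l q with hu
  have hu0 : u ≠ 0 := by simp [hu, hWq]
  have hWu : 0 < (W l (q + (0:ℝ) * u) / u).im := by
    have : W l (q + (0:ℝ) * u) / u = Complex.I := by
      simp only [Complex.ofReal_zero, zero_mul, add_zero, hu]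
      field_simp
      simp
    rw [this]; simp
  obtain ⟨δ, hδ, Hδ⟩ : ∃ δ > 0, ∀ᶠ l' in 𝓝 l, ∀ s ∈ Icc (-δ) δ, 0 < (W l' (q + (s:ℝ) * u) / u).im := by
    have hc : Continuous fun p : ℝ × ℝ => (W p.1 (q + (p.2:ℝ) * u) / u).im := by
      apply Complex.continuous_im.comp
      apply Continuous.div_const
      exact hW.comp (continuous_fst.prodMk (by fun_prop))
    have : ∀ᶠ p : ℝ × ℝ in 𝓝 (l, (0:ℝ)), 0 < (W p.1 (q + (p.2:ℝ) * u) / u).im :=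
      hc.continuousAt.eventually (lt_mem_nhds hWu)
    rw [nhds_prod_eq] at this
    obtain ⟨p1, hp1, p2, hp2, H⟩ := eventually_prod_iff.1 this
    obtain ⟨δ', hδ', H2⟩ := Metric.eventually_nhds_iff.1 hp2
    refine ⟨δ' / 2, by positivity, ?_⟩
    filter_upwards [hp1] with l' hl' s hs
    refine H hl' (H2 ?_)
    rw [Real.dist_eq, sub_zero]
    exact lt_of_le_of_lt (abs_le.2 hs) (by linarith)
  have Hl := Hδ.self_of_nhds
  -- crossings near q
  have hnear := cross_persist (X := ℂ) hφc hfl (L := fun _ => l) (Z := fun w => w) (C := fun _ => q)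
    (U := fun _ => u) continuous_const continuous_id continuous_const continuous_const (fun _ => hu0)
    (x₀ := q) (t₀ := 0) (s₀ := 0) (by simp [(hfl l).zero]) hWu (η := min (δ/2) (1/2)) (by positivity)
  have hfreq : ∃ᶠ k : ℕ in atTop, ∃ t s : ℝ, |t - 0| < min (δ/2) (1/2) ∧ |s - 0| < min (δ/2) (1/2) ∧
      φ l t (φ l k z) = q + s * u := by
    have := hq.frequently hnear
    exact this
  have hfreq' : ∀ n : ℕ, ∃ k ≥ n, ∃ t s : ℝ, |t| < 1/2 ∧ |s| ≤ δ/2 ∧ φ l (t + k) z = q + s * u := by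
    intro n
    obtain ⟨k, hk, t, s, ht, hs, he⟩ := (frequently_atTop.1 hfreq) n
    rw [sub_zero] at ht hs
    exact ⟨k, hk, t, s, ht.trans_le (min_le_right _ _), (hs.trans_le (min_le_left _ _)).le,
      by rw [(hfl l).add]; exact he⟩
  obtain ⟨k1, -, a1, s1, ha1, hs1, hx1⟩ := hfreq' 0
  obtain ⟨k2, hk2, a2, s2, ha2, hs2, hx2⟩ := hfreq' (k1 + 2)
  have hk : (k1:ℝ) + 2 ≤ k2 := by exact_mod_cast hk2
  have ht12 : a1 + k1 < a2 + k2 := by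
    have := abs_lt.1 ha1; have := abs_lt.1 ha2; linarith
  by_cases hs : s1 = s2
  · refine ⟨(a2 + k2) - (a1 + k1), by linarith, ?_⟩
    have := (hfl l).per (s := a1 + k1) (t := a2 + k2) (z := z) (by rw [hx1, hx2, hs]) 0
    simpa [(hfl l).zero] using this
  · exfalso
    have hgap : 0 < |s1 - s2| := abs_pos.2 (sub_ne_zero.2 hs)
    set η := min (|s1 - s2| / 2) (δ / 2) with hη
    have hη0 : 0 < η := by positivity
    have hper : ∀ a s : ℝ, |s| ≤ δ / 2 → φ l a z = q + s * u → ∀ᶠ p : ℝ × ℂ in 𝓝 (l, z), ∃ t s' : ℝ,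
        |t - a| < η ∧ |s' - s| < η ∧ φ p.1 t p.2 = q + s' * u := by
      intro a s hsδ hx
      exact cross_persist (X := ℝ × ℂ) hφc hfl (L := fun p => p.1) (Z := fun p => p.2)
        (C := fun _ => q) (U := fun _ => u) continuous_fst continuous_snd continuous_const
        continuous_const (fun _ => hu0) (x₀ := (l, z)) hx
        (Hl s (abs_le.1 (hsδ.trans (by linarith)))) hη0
    have hl' : ∀ᶠ p : ℝ × ℂ in 𝓝 (l, z), ∀ s ∈ Icc (-δ) δ, 0 < (W p.1 (q + (s:ℝ) * u) / u).im :=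
      (continuous_fst.tendsto (l, z)).eventually Hδ
    obtain ⟨⟨l', z'⟩, ⟨-, ⟨T, hT, hTz⟩, -⟩, hl', ⟨t1, σ1, -, hσ1, hy1⟩, ⟨t2, σ2, -, hσ2, hy2⟩⟩ :=
      (hcl.and_eventually (hl'.and ((hper _ _ hs1 hx1).and (hper _ _ hs2 hx2)))).exists
    have hb : ∀ s σ : ℝ, |s| ≤ δ / 2 → |σ - s| < η → σ ∈ Icc (-δ) δ := by
      intro s σ h1 h2
      have h3 := h2.trans_le (min_le_right _ _)
      have := abs_le.1 h1; have := abs_lt.1 h3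
      constructor <;> linarith
    have heq := KL (hfl l') hu0 hl' hT hTz (hb _ _ hs1 hσ1) (hb _ _ hs2 hσ2) hy1 hy2
    have h1 := hσ1.trans_le (min_le_left _ _)
    have h2 := hσ2.trans_le (min_le_left _ _)
    rw [← heq] at h2
    have : |s1 - s2| ≤ |σ1 - s1| + |σ1 - s2| := by
      have := abs_sub_le s1 σ1 s2
      rwa [abs_sub_comm s1 σ1] at this
    linarith
end

section
open Set Filter Topology Metric

theorem normSq_deriv {x : ℝ → ℂ} {v : ℂ} {t : ℝ} (h : HasDerivAt x v t) :
    HasDerivAt (fun t => Complex.normSq (x t)) (2 * ((starRingEnd ℂ) (x t) * v).re) t := by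
  have h1 := Complex.reCLM.hasFDerivAt.comp_hasDerivAt t h
  have h2 := Complex.imCLM.hasFDerivAt.comp_hasDerivAt t h
  have := (h1.mul h1).add (h2.mul h2)
  refine (show HasDerivAt (fun t => Complex.normSq (x t)) _ t from this).congr_deriv ?_
  simp
  ring

section loc
variable {φ : ℝ → ℂ → ℂ} {w : ℂ → ℂ} {ε θ : ℝ}

theorem loc_deriv (hφ : IsFlow φ w) (hloc : ∀ z, ‖z‖ < ε → w z = z * Complex.exp (θ * Complex.I))
    {z : ℂ} {t : ℝ} (h : ‖φ t z‖ < ε) :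
    HasDerivAt (fun t => Complex.normSq (φ t z)) (2 * Complex.normSq (φ t z) * Real.cos θ) t := by
  refine (normSq_deriv (hφ.deriv z t)).congr_deriv ?_
  rw [hloc _ h, ← mul_assoc, mul_comm ((starRingEnd ℂ) _), Complex.mul_conj, mul_assoc,
    Complex.re_ofReal_mul, Complex.exp_ofReal_mul_I_re]

theorem loc_grow (hφ : IsFlow φ w) (hloc : ∀ z, ‖z‖ < ε → w z = z * Complex.exp (θ * Complex.I))
    (hc : 0 < Real.cos θ) {ρ : ℝ} (h0 : 0 < ρ) (h1 : ρ < ε) {z : ℂ} {a : ℝ} (ha : ρ ≤ ‖φ a z‖) :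
    ∀ t > a, ρ < ‖φ t z‖ := by
  have key := lyap_core (g := fun t => Complex.normSq (φ t z)) (q := ρ^2)
    (Complex.continuous_normSq.comp (hφ.ct z)) (fun t ht => ?_) (a := a) ?_
  · intro t ht
    have := key t ht
    rw [Complex.normSq_eq_norm_sq] at this
    exact lt_of_pow_lt_pow_left₀ 2 (norm_nonneg _) this
  · have hn : ‖φ t z‖ = ρ := by
      rw [Complex.normSq_eq_norm_sq] at ht
      exact (pow_left_inj₀ (norm_nonneg _) h0.le (by norm_num)).1 ht
    refine ⟨_, ?_, loc_deriv hφ hloc (by rw [hn]; exact h1)⟩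
    rw [ht]; positivity
  · rw [Complex.normSq_eq_norm_sq]; gcongr

theorem loc_shrink (hφ : IsFlow φ w) (hloc : ∀ z, ‖z‖ < ε → w z = z * Complex.exp (θ * Complex.I))
    (hc : Real.cos θ < 0) {ρ : ℝ} (h0 : 0 < ρ) (h1 : ρ < ε) {z : ℂ} {a : ℝ} (ha : ‖φ a z‖ ≤ ρ) :
    ∀ t > a, ‖φ t z‖ < ρ := by
  intro t ht
  by_contra hcon
  push Not at hcon
  have key := lyap_core (g := fun t => Complex.normSq (φ (-t) z)) (q := ρ^2)
    (Complex.continuous_normSq.comp ((hφ.ct z).comp continuous_neg)) (fun t ht => ?_) (a := -t) ?_ (-a)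
    (by linarith)
  · simp only [neg_neg] at key
    rw [Complex.normSq_eq_norm_sq] at key
    have := lt_of_pow_lt_pow_left₀ 2 (norm_nonneg _) key
    linarith
  · have hn : ‖φ (-t) z‖ = ρ := by
      rw [Complex.normSq_eq_norm_sq] at ht
      exact (pow_left_inj₀ (norm_nonneg _) h0.le (by norm_num)).1 ht
    have hd := (loc_deriv hφ hloc (z := z) (t := -t) (by rw [hn]; exact h1)).scomp t (hasDerivAt_neg t)
    refine ⟨_, ?_, hd⟩
    rw [ht]
    simp
    have : 0 < ρ ^ 2 := by positivity
    nlinarith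
  · simp only [neg_neg]
    rw [Complex.normSq_eq_norm_sq]; gcongr

theorem loc_circ (hloc : ∀ z, ‖z‖ < ε → w z = z * Complex.exp (θ * Complex.I))
    (huni : ∀ x : ℝ → ℂ, (∀ t, HasDerivAt x (w (x t)) t) → ∀ t, x t = φ t (x 0))
    (hc : Real.cos θ = 0) {z : ℂ} (hz : ‖z‖ < ε) (t : ℝ) :
    φ t z = z * Complex.exp (t * Complex.exp (θ * Complex.I)) ∧ ‖φ t z‖ = ‖z‖ := by
  have hn : ∀ t : ℝ, ‖z * Complex.exp (t * Complex.exp (θ * Complex.I))‖ = ‖z‖ := by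
    intro t
    rw [norm_mul, Complex.norm_exp, Complex.re_ofReal_mul, Complex.exp_ofReal_mul_I_re, hc]
    simp
  have := huni (fun t => z * Complex.exp (t * Complex.exp (θ * Complex.I))) (fun t => ?_) t
  · simp only [Complex.ofReal_zero, zero_mul, Complex.exp_zero, mul_one] at this
    rw [← this]
    exact ⟨rfl, hn t⟩
  · rw [hloc _ (by rw [hn]; exact hz)]
    have h1 : HasDerivAt (fun t : ℝ => (t:ℂ) * Complex.exp (θ * Complex.I))
        (1 * Complex.exp (θ * Complex.I)) t := (Complex.ofRealCLM.hasDerivAt (x := t)).mul_const _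
    refine (h1.cexp.const_mul z).congr_deriv ?_
    ring

theorem loc_per (hφ : IsFlow φ w) (hloc : ∀ z, ‖z‖ < ε → w z = z * Complex.exp (θ * Complex.I))
    (huni : ∀ x : ℝ → ℂ, (∀ t, HasDerivAt x (w (x t)) t) → ∀ t, x t = φ t (x 0))
    {z : ℂ} (hz0 : z ≠ 0) (hz : ‖z‖ < ε) {T : ℝ} (hT : 0 < T) (hper : φ T z = z) :
    Real.cos θ = 0 ∧ ∀ t, ‖φ t z‖ = ‖z‖ := by
  have hc : Real.cos θ = 0 := by
    rcases lt_trichotomy (Real.cos θ) 0 with h | h | h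
    · have := loc_shrink hφ hloc h (norm_pos_iff.2 hz0) hz (z := z) (a := 0) (by rw [hφ.zero]) T hT
      rw [hper] at this
      exact absurd this (lt_irrefl _)
    · exact h
    · have := loc_grow hφ hloc h (norm_pos_iff.2 hz0) hz (z := z) (a := 0) (by rw [hφ.zero]) T hT
      rw [hper] at this
      exact absurd this (lt_irrefl _)
  exact ⟨hc, fun t => (loc_circ hloc huni hc hz t).2⟩

theorem loc_away (hφ : IsFlow φ w) (hloc : ∀ z, ‖z‖ < ε → w z = z * Complex.exp (θ * Complex.I))
    (huni : ∀ x : ℝ → ℂ, (∀ t, HasDerivAt x (w (x t)) t) → ∀ t, x t = φ t (x 0))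
    (hε : 0 < ε) {z : ℂ} {r : ℝ} (hr0 : 0 < r) (hr : r < ε) (hz : r ≤ ‖z‖) {T : ℝ} (hT : 0 < T)
    (hper : φ T z = z) (t : ℝ) : r ≤ ‖φ t z‖ := by
  by_contra hcon
  push Not at hcon
  have h00 : ∀ t, φ t 0 = 0 := by
    intro t
    have := huni (fun _ => 0) (fun t => by
      rw [hloc 0 (by simpa using hε)]
      simpa using hasDerivAt_const t (0:ℂ)) t
    exact this.symm
  have hne : φ t z ≠ 0 := by
    intro h
    have := hφ.cancel t z
    rw [h, h00] at this
    rw [← this] at hz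
    simp at hz
    linarith
  have hp : φ T (φ t z) = φ t z := by
    rw [← hφ.add, add_comm, hφ.add, hper]
  have := (loc_per hφ hloc huni hne (hcon.trans hr) hT hp).2 (-t)
  rw [hφ.cancel] at this
  linarith

end loc
end

section
open Set Filter Topology Metric

theorem phi_exists {A Rp Rm : Set (ℝ × ℝ)} (hA : IsClosed A) (hRp : IsOpen Rp) (hRm : IsOpen Rm)
    (hO : IsOpen (A ∪ Rp ∪ Rm)) (hd : Disjoint Rp Rm) :
    ∃ f : ℝ × ℝ → ℝ, (∀ p ∈ A, f p = 0) ∧ (∀ p ∉ A ∪ Rp ∪ Rm, f p = 1) ∧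
      (∀ p ∈ Rp, f p ∈ Icc (0:ℝ) 1) ∧ (∀ p ∈ Rm, f p ∈ Icc (-1:ℝ) 0) ∧
      Continuous fun p => Complex.exp (f p * Real.pi * Complex.I) := by
  classical
  obtain ⟨h, h0, h1, h2⟩ := exists_continuous_zero_one_of_isClosed hA hO.isClosed_compl
    (by rw [Set.disjoint_compl_right_iff_subset]; intro x hx; left; left; exact hx)
  refine ⟨fun p => if p ∈ Rm then - h p else h p, ?_, ?_, ?_, ?_, ?_⟩
  · intro p hp
    have : h p = 0 := h0 hp
    simp [this]
  · intro p hp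
    have h3 : p ∉ Rm := fun h => hp (Or.inr h)
    have : h p = 1 := h1 hp
    simp [h3, this]
  · intro p hp
    have h3 : p ∉ Rm := fun h => Set.disjoint_left.1 hd hp h
    simp only [h3, if_false]
    exact h2 p
  · intro p hp
    simp only [hp, if_true]
    have := h2 p
    exact ⟨by linarith [this.2], by linarith [this.1]⟩
  · have : (fun p : ℝ × ℝ => Complex.exp (((if p ∈ Rm then - h p else h p : ℝ) : ℂ) * Real.pi * Complex.I))
        = fun p => if p ∈ Rm then Complex.exp (((-h p : ℝ):ℂ) * Real.pi * Complex.I)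
          else Complex.exp (((h p : ℝ):ℂ) * Real.pi * Complex.I) := by
      funext p
      split_ifs <;> rfl
    rw [this]
    apply Continuous.if
    · intro p hp
      have hp' : p ∈ frontier Rm := hp
      rw [hRm.frontier_eq] at hp'
      have hnp : p ∉ Rp := by
        intro hpp
        obtain ⟨q, hq1, hq2⟩ := mem_closure_iff.1 hp'.1 Rp hRp hpp
        exact Set.disjoint_left.1 hd hq1 hq2
      by_cases hpA : p ∈ A
      · have : h p = 0 := h0 hpA
        simp [this]
      · have : h p = 1 := h1 (by
          rintro ((h | h) | h)
          · exact hpA h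
          · exact hnp h
          · exact hp'.2 h)
        simp only [this]
        push_cast
        rw [one_mul, Complex.exp_pi_mul_I, neg_one_mul, neg_mul, Complex.exp_neg, Complex.exp_pi_mul_I]
        norm_num
    · fun_prop
    · fun_prop

theorem bottom_contra {φ : ℝ → ℂ → ℂ} {w : ℂ → ℂ} {ε θ : ℝ} (hφ : IsFlow φ w)
    (hloc : ∀ z, ‖z‖ < ε → w z = z * Complex.exp (θ * Complex.I)) (hc : Real.cos θ ≠ 0)
    (hs : 1 / 2 < |Real.sin θ|) {r s t : ℝ} (hr : 0 < r) (hrε : r < ε) (ht : 0 < t) (hs0 : s ≠ 0)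
    (hsr : |s| < r) (hss : s * Real.sin (2 * θ) ≤ 0)
    (h : φ t r = r + s * (-Complex.I * Complex.exp (θ * Complex.I))) : False := by
  have hn : ‖φ t r‖ ^ 2 = r ^ 2 + 2 * r * s * Real.sin θ + s ^ 2 := by
    rw [h, ← Complex.normSq_eq_norm_sq, Complex.normSq_apply]
    simp [Complex.exp_ofReal_mul_I_re, Complex.exp_ofReal_mul_I_im]
    have := Real.sin_sq_add_cos_sq θ
    linear_combination s ^ 2 * this
  rw [Real.sin_two_mul] at hss
  have hnr : ‖(r:ℂ)‖ = r := by simp [abs_of_pos hr]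
  have habs : |s| * |s| = s ^ 2 := by rw [abs_mul_abs_self]; ring
  have hspos : 0 < |s| := abs_pos.2 hs0
  rcases lt_or_gt_of_ne hc with hneg | hpos
  · have h1 := loc_shrink hφ hloc hneg hr hrε (z := r) (a := 0) (by rw [hφ.zero, hnr]) t ht
    have h2 : 0 ≤ s * Real.sin θ := by
      by_contra hcon
      push Not at hcon
      nlinarith [mul_pos_of_neg_of_neg hcon hneg]
    have h3 : ‖φ t r‖ ^ 2 < r ^ 2 := by gcongr
    nlinarith [mul_nonneg hr.le h2, sq_nonneg s]
  · have h1 := loc_grow hφ hloc hpos hr hrε (z := r) (a := 0) (by rw [hφ.zero, hnr]) t ht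
    have h2 : s * Real.sin θ ≤ 0 := by
      by_contra hcon
      push Not at hcon
      nlinarith [mul_pos hcon hpos]
    have h3 : r ^ 2 < ‖φ t r‖ ^ 2 := by gcongr
    have h4 : s * Real.sin θ = - (|s| * |Real.sin θ|) := by
      rw [← abs_mul, abs_of_nonpos h2]; ring
    have h5 : |s| * (1/2) < |s| * |Real.sin θ| := by gcongr
    have h6 : |s| * |s| < r * |s| := by gcongr
    nlinarith [mul_lt_mul_of_pos_left h5 hr]
end

section
open Set Filter Topology Metric

theorem rot_contra {f : ℝ × ℝ → ℝ} {r0 R : ℝ} {N : ℤ} (hN : N ≠ 0)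
    (hf : Continuous fun p => Complex.exp (f p * Real.pi * Complex.I))
    (h1 : ∀ p : ℝ × ℝ, p.1 = 0 → f p = 1) (h2 : ∀ p : ℝ × ℝ, p.1 = 1 → f p = 1)
    (h3 : ∀ p : ℝ × ℝ, p.2 = R → f p = 1)
    (hb : ∀ l ∈ Icc (0:ℝ) 1, Real.sin (f (l, r0) * Real.pi + 2 * (l * Real.pi * N)) = 0 →
      0 ≤ Real.cos (f (l, r0) * Real.pi + 2 * (l * Real.pi * N)) → False) : False := by
  obtain ⟨L, hL, hLe⟩ := log_lift hf (fun x => Complex.exp_ne_zero _)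
  have e1 : L (0, r0) = L (0, R) := by
    apply exp_const (S := {p : ℝ × ℝ | p.1 = 0}) (c := -1) _ hL.continuousOn _ (by simp) (by simp)
    · have : {p : ℝ × ℝ | p.1 = 0} = range fun r : ℝ => ((0:ℝ), r) := by
        ext ⟨a, b⟩; simp [eq_comm]
      rw [this]; exact isPreconnected_range (by fun_prop)
    · intro p hp
      rw [hLe, h1 p hp]; simp
  have e2 : L (0, R) = L (1, R) := by
    apply exp_const (S := {p : ℝ × ℝ | p.2 = R}) (c := -1) _ hL.continuousOn _ (by simp) (by simp)
    · have : {p : ℝ × ℝ | p.2 = R} = range fun r : ℝ => (r, R) := by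
        ext ⟨a, b⟩; simp [eq_comm]
      rw [this]; exact isPreconnected_range (by fun_prop)
    · intro p hp
      rw [hLe, h3 p hp]; simp
  have e3 : L (1, R) = L (1, r0) := by
    apply exp_const (S := {p : ℝ × ℝ | p.1 = 1}) (c := -1) _ hL.continuousOn _ (by simp) (by simp)
    · have : {p : ℝ × ℝ | p.1 = 1} = range fun r : ℝ => ((1:ℝ), r) := by
        ext ⟨a, b⟩; simp [eq_comm]
      rw [this]; exact isPreconnected_range (by fun_prop)
    · intro p hp
      rw [hLe, h2 p hp]; simp
  set Q : ℝ → ℂ := fun l => - (Complex.exp (f (l, r0) * Real.pi * Complex.I) *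
    Complex.exp (2 * (l * Real.pi * N) * Complex.I)) with hQ
  have hQc : Continuous Q := by
    have : Continuous fun l : ℝ => Complex.exp (f (l, r0) * Real.pi * Complex.I) :=
      hf.comp (by fun_prop : Continuous fun l : ℝ => (l, r0))
    fun_prop
  have hQ' : ∀ l, Q l = - Complex.exp (((f (l, r0) * Real.pi + 2 * (l * Real.pi * N) : ℝ) : ℂ) * Complex.I) := by
    intro l
    rw [hQ]
    simp only
    rw [← Complex.exp_add]
    push_cast
    ring_nf
  have hslit : ∀ l ∈ Icc (0:ℝ) 1, Q l ∈ Complex.slitPlane := by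
    intro l hl
    rw [hQ', Complex.mem_slitPlane_iff]
    simp only [Complex.neg_re, Complex.neg_im, Complex.exp_ofReal_mul_I_re, Complex.exp_ofReal_mul_I_im]
    by_contra hcon
    push Not at hcon
    exact hb l hl (by linarith [hcon.2]) (by linarith [hcon.1])
  have hQ0 : ∀ l, Q l ≠ 0 := by
    intro l
    rw [hQ']
    exact neg_ne_zero.2 (Complex.exp_ne_zero _)
  have key := exp_const (S := Icc (0:ℝ) 1) (c := -1)
    (D := fun l => L (l, r0) - Complex.log (Q l) + 2 * (l * Real.pi * N) * Complex.I)
    isPreconnected_Icc (by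
      apply ContinuousOn.add
      · apply ContinuousOn.sub
        · exact (hL.comp (by fun_prop : Continuous fun l : ℝ => (l, r0))).continuousOn
        · exact hQc.continuousOn.clog hslit
      · fun_prop) (fun l hl => by
        rw [Complex.exp_add, Complex.exp_sub, hLe, Complex.exp_log (hQ0 l)]
        simp only [hQ]
        field_simp [Complex.exp_ne_zero]) (x := 0) (y := 1) (by simp) (by simp)
  have hq0 : Q 0 = 1 := by
    rw [hQ', h1 _ rfl]; simp
  have hq1 : Q 1 = 1 := by
    simp only [hQ, h2 (1, r0) rfl]
    have : Complex.exp (2 * (((1:ℝ):ℂ) * Real.pi * N) * Complex.I) = 1 := by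
      rw [Complex.exp_eq_one_iff]
      exact ⟨N, by push_cast; ring⟩
    rw [this]; simp
  simp only [hq0, hq1, Complex.log_one] at key
  rw [e1, e2, e3] at key
  have : (2 * (Real.pi * (N:ℂ)) * Complex.I) = 0 := by
    have := key
    push_cast at this
    linear_combination -this
  have hNc : (N:ℂ) ≠ 0 := by exact_mod_cast hN
  have hpi : (Real.pi:ℂ) ≠ 0 := by exact_mod_cast Real.pi_ne_zero
  simp [hNc, Complex.I_ne_zero] at this
end

section
open Set Filter Topology Metric

theorem delta_exists {W : ℝ → ℂ → ℂ} (hW : Continuous fun p : ℝ × ℂ => W p.1 p.2) {K : Set (ℝ × ℝ)}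
    (hK : IsCompact K) (hne : ∀ p ∈ K, W p.1 p.2 ≠ 0) {b : ℝ} (hb : 0 < b) :
    ∃ δ > 0, δ < b ∧ ∀ p ∈ K, ∀ s ∈ Icc (-δ) δ,
      0 < (W p.1 (p.2 + s * (-Complex.I * (W p.1 p.2 / ‖W p.1 p.2‖))) /
        (-Complex.I * (W p.1 p.2 / ‖W p.1 p.2‖))).im := by
  have hWr : Continuous fun q : ℝ × (ℝ × ℝ) => W q.2.1 (q.2.2 : ℂ) :=
    hW.comp (by fun_prop : Continuous fun q : ℝ × (ℝ × ℝ) => (q.2.1, (q.2.2 : ℂ)))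
  have := hK.eventually_forall_of_forall_eventually (x₀ := (0:ℝ)) (P := fun s p =>
      0 < (W p.1 (p.2 + s * (-Complex.I * (W p.1 p.2 / ‖W p.1 p.2‖))) /
        (-Complex.I * (W p.1 p.2 / ‖W p.1 p.2‖))).im) (fun p hp => by
    have hn := hne p hp
    have hnn : ((‖W p.1 p.2‖ : ℝ) : ℂ) ≠ 0 := by exact_mod_cast norm_ne_zero_iff.2 hn
    have hu : ContinuousAt (fun q : ℝ × (ℝ × ℝ) =>
        (-Complex.I * (W q.2.1 q.2.2 / ‖W q.2.1 q.2.2‖))) (0, p) := by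
      apply ContinuousAt.mul continuousAt_const
      apply hWr.continuousAt.div
      · exact (Complex.continuous_ofReal.comp hWr.norm).continuousAt
      · exact hnn
    have hc : ContinuousAt (fun q : ℝ × (ℝ × ℝ) => (W q.2.1 (q.2.2 + q.1 * (-Complex.I * (W q.2.1 q.2.2 / ‖W q.2.1 q.2.2‖))) /
        (-Complex.I * (W q.2.1 q.2.2 / ‖W q.2.1 q.2.2‖))).im) (0, p) := by
      apply Complex.continuous_im.continuousAt.comp
      apply ContinuousAt.div _ hu
      · exact mul_ne_zero (neg_ne_zero.2 Complex.I_ne_zero) (div_ne_zero hn hnn)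
      · refine ContinuousAt.comp (g := fun p : ℝ × ℂ => W p.1 p.2)
          (f := fun q : ℝ × (ℝ × ℝ) => (q.2.1, (q.2.2:ℂ) + q.1 * (-Complex.I * (W q.2.1 q.2.2 / ‖W q.2.1 q.2.2‖))))
          hW.continuousAt ?_
        apply ContinuousAt.prodMk
        · fun_prop
        · apply ContinuousAt.add (by fun_prop)
          exact ContinuousAt.mul (by fun_prop) hu
    refine hc.eventually_const_lt ?_
    simp only [Complex.ofReal_zero, zero_mul, add_zero]
    have : W p.1 p.2 / (-Complex.I * (W p.1 p.2 / ‖W p.1 p.2‖)) = ‖W p.1 p.2‖ * Complex.I := by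
      field_simp [Complex.I_ne_zero]
      simp
    rw [this]
    simpa using hn)
  obtain ⟨η, hη, h⟩ := Metric.eventually_nhds_iff.1 this
  refine ⟨min (η / 2) (b / 2), by positivity, ?_, ?_⟩
  · exact (min_le_right _ _).trans_lt (by linarith)
  · intro p hp s hs
    refine h ?_ p hp
    rw [Real.dist_eq, sub_zero]
    exact (abs_le.2 hs).trans_lt ((min_le_left _ _).trans_lt (by linarith))

theorem final_abstract {W : ℝ → ℂ → ℂ} {φ : ℝ → ℝ → ℂ → ℂ}
    (hφc : Continuous fun p : ℝ × ℝ × ℂ => φ p.1 p.2.1 p.2.2)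
    (hW : Continuous fun p : ℝ × ℂ => W p.1 p.2)
    (hfl : ∀ l, IsFlow (φ l) (W l))
    (huni : ∀ l, ∀ x : ℝ → ℂ, (∀ t, HasDerivAt x (W l (x t)) t) → ∀ t, x t = φ l t (x 0))
    {ε : ℝ} (hε : 0 < ε) {N : ℤ} (hN : N ≠ 0)
    (hloc : ∀ l ∈ Icc (0:ℝ) 1, ∀ z, ‖z‖ < ε → W l z = z * Complex.exp ((l * Real.pi * N : ℝ) * Complex.I))
    (hne : ∀ l ∈ Icc (0:ℝ) 1, ∀ z, z ≠ 0 → W l z ≠ 0)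
    {G : Set ℂ} (hG : IsOpen G) (hGb : Bornology.IsBounded G) (hGε : closedBall 0 ε ⊆ G)
    (hA : ∀ l ∈ Icc (0:ℝ) 1, ∀ z, z ≠ 0 → ∀ T > 0, φ l T z = z → (∀ t, φ l t z ∈ closure G) →
      ∀ t, φ l t z ∈ G)
    (h01 : ∀ l ∈ ({0, 1} : Set ℝ), ∀ z, z ≠ 0 → ∀ T > 0, φ l T z = z → False) : False := by
  obtain ⟨r0, hr0⟩ : ∃ r0, r0 = ε / 2 := ⟨_, rfl⟩
  have hr0p : 0 < r0 := by rw [hr0]; positivity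
  have hr0ε : r0 < ε := by rw [hr0]; linarith
  obtain ⟨R, hR⟩ : ∃ R : ℝ, closure G ⊆ ball 0 R := by
    obtain ⟨R, hR⟩ := hGb.closure.subset_ball (0:ℂ)
    exact ⟨R, hR⟩
  have hr0R : r0 ≤ R := by
    have : ((r0:ℝ):ℂ) ∈ ball (0:ℂ) R := hR (subset_closure (hGε (by
      simp [abs_of_pos hr0p, hr0ε.le])))
    simp [abs_of_pos hr0p] at this
    exact this.le
  set L : ℝ × ℝ → ℝ := fun p => max 0 (min p.1 1) with hL
  set r : ℝ × ℝ → ℝ := fun p => max r0 (min p.2 R) with hr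
  have hLc : Continuous L := by fun_prop
  have hrc : Continuous r := by fun_prop
  have hLI : ∀ p, L p ∈ Icc (0:ℝ) 1 := fun p => ⟨le_max_left _ _, max_le zero_le_one (min_le_right _ _)⟩
  have hrI : ∀ p, r p ∈ Icc r0 R := fun p => ⟨le_max_left _ _, max_le hr0R (min_le_right _ _)⟩
  have hrz : ∀ p, ((r p : ℝ) : ℂ) ≠ 0 := fun p => by
    have := (hrI p).1
    exact_mod_cast (hr0p.trans_le this).ne'
  have hrn : ∀ p, ‖((r p : ℝ) : ℂ)‖ = r p := fun p => by
    have := (hrI p).1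
    simp [abs_of_pos (hr0p.trans_le this)]
  have hWr : Continuous fun p => W (L p) (r p) := hW.comp (by fun_prop : Continuous fun p => (L p, (r p : ℂ)))
  have hWne : ∀ p, W (L p) (r p) ≠ 0 := fun p => hne _ (hLI p) _ (hrz p)
  have hWn : ∀ p, ((‖W (L p) (r p)‖ : ℝ):ℂ) ≠ 0 := fun p => by
    exact_mod_cast norm_ne_zero_iff.2 (hWne p)
  set u : ℝ × ℝ → ℂ := fun p => -Complex.I * (W (L p) (r p) / ‖W (L p) (r p)‖) with hu
  have huc : Continuous u := by
    apply continuous_const.mul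
    exact hWr.div (Complex.continuous_ofReal.comp hWr.norm) hWn
  have hu0 : ∀ p, u p ≠ 0 := fun p =>
    mul_ne_zero (neg_ne_zero.2 Complex.I_ne_zero) (div_ne_zero (hWne p) (hWn p))
  obtain ⟨δ, hδ, hδr, hδW⟩ := delta_exists hW (K := Icc (0:ℝ) 1 ×ˢ Icc r0 R)
    (isCompact_Icc.prod isCompact_Icc) (fun p hp => hne _ hp.1 _ (by
      exact_mod_cast (hr0p.trans_le hp.2.1).ne')) hr0p
  have hsec : ∀ p, ∀ s ∈ Icc (-δ) δ, 0 < (W (L p) (r p + s * u p) / u p).im := fun p s hs =>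
    hδW (L p, r p) ⟨hLI p, hrI p⟩ s hs
  have hrcc : Continuous fun p => ((r p : ℝ) : ℂ) := by fun_prop
  -- K and A
  set K : Set ℂ := closure G ∩ {z | r0 ≤ ‖z‖} with hKdef
  have hKc : IsCompact K := by
    apply hGb.isCompact_closure.inter_right
    exact isClosed_le continuous_const continuous_norm
  have hKne : ∀ z ∈ K, z ≠ 0 := by
    rintro z ⟨-, hz⟩ rfl
    have : r0 ≤ ‖(0:ℂ)‖ := hz
    simp at this
    linarith
  set A : Set (ℝ × ℝ) := {p | (∃ T > 0, φ (L p) T (r p) = r p) ∧ ∀ t, φ (L p) t (r p) ∈ K} with hAdef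
  have hAcl : IsClosed A := by
    have := (closed_cycles hφc hW hfl hKc (I := Icc (0:ℝ) 1) isClosed_Icc
      (fun l hl z hz => hne l hl z (hKne z hz))).preimage
      (by fun_prop : Continuous fun p => (L p, (r p : ℂ)))
    convert this using 1
    ext p
    simp only [hAdef, mem_ofPred_eq, mem_preimage]
    exact ⟨fun h => ⟨hLI p, h⟩, fun h => h.2⟩
  have hmemK : ∀ p T, 0 < T → φ (L p) T (r p) = r p → (∀ t, φ (L p) t (r p) ∈ closure G) → p ∈ A := by
    intro p T hT hper h
    refine ⟨⟨T, hT, hper⟩, fun t => ⟨h t, ?_⟩⟩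
    exact loc_away (hfl _) (hloc _ (hLI p)) (huni _) hε hr0p hr0ε (by rw [hrn]; exact (hrI p).1) hT hper t
  set E : Set (ℝ × ℝ) := {p | 0 < L p ∧ L p < 1 ∧ r p < R ∧
    (1 / 2 < |Real.sin (L p * Real.pi * N)| ∨ r0 < r p)} with hE
  have hEo : IsOpen E := by
    apply (isOpen_lt continuous_const hLc).inter
    apply (isOpen_lt hLc continuous_const).inter
    apply (isOpen_lt hrc continuous_const).inter
    apply IsOpen.union
    · have hcs : Continuous fun p => |Real.sin (L p * Real.pi * N)| := by fun_prop
      exact isOpen_lt continuous_const hcs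
    · exact isOpen_lt continuous_const hrc
  have hAE : A ⊆ E := by
    rintro p ⟨⟨T, hT, hper⟩, hK⟩
    refine ⟨lt_of_le_of_ne (hLI p).1 ?_, lt_of_le_of_ne (hLI p).2 ?_, ?_, ?_⟩
    · intro h
      exact h01 (L p) (by rw [← h]; simp) _ (hrz p) T hT hper
    · intro h
      exact h01 (L p) (by rw [h]; simp) _ (hrz p) T hT hper
    · have := hR (hK 0).1
      rw [(hfl _).zero] at this
      rw [mem_ball_zero_iff, hrn] at this
      exact this
    · by_cases h : r0 < r p
      · exact Or.inr h
      · left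
        push Not at h
        have := (loc_per (hfl _) (hloc _ (hLI p)) (huni _) (hrz p) (by rw [hrn]; linarith) hT hper).1
        have h2 := Real.sin_sq_add_cos_sq (L p * Real.pi * N)
        rw [this] at h2
        by_contra hcon
        push Not at hcon
        have := sq_abs (Real.sin (L p * Real.pi * N))
        nlinarith [abs_nonneg (Real.sin (L p * Real.pi * N))]
  -- return sets
  set Rp : Set (ℝ × ℝ) := {p | p ∈ E ∧ ∃ t s : ℝ, 0 < t ∧ 0 < s ∧ s < δ ∧ φ (L p) t (r p) = r p + s * u p} with hRp
  set Rm : Set (ℝ × ℝ) := {p | p ∈ E ∧ ∃ t s : ℝ, 0 < t ∧ s < 0 ∧ -δ < s ∧ φ (L p) t (r p) = r p + s * u p} with hRm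
  have hRpo : IsOpen Rp := by
    rw [isOpen_iff_mem_nhds]
    rintro p ⟨hpE, t, s, ht, hs0, hs1, h⟩
    have := cross_persist hφc hfl hLc hrcc hrcc huc hu0 h (hsec p s ⟨by linarith, by linarith⟩)
      (η := min t (min s (δ - s))) (lt_min ht (lt_min hs0 (by linarith)))
    filter_upwards [this, hEo.mem_nhds hpE] with q hq hqE
    obtain ⟨t', s', h1, h2, h3⟩ := hq
    have h1' := h1.trans_le (min_le_left _ _)
    have h2' := h2.trans_le ((min_le_right _ _).trans (min_le_left _ _))
    have h2'' := h2.trans_le ((min_le_right _ _).trans (min_le_right _ _))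
    rw [abs_lt] at h1' h2' h2''
    exact ⟨hqE, t', s', by linarith, by linarith, by linarith, h3⟩
  have hRmo : IsOpen Rm := by
    rw [isOpen_iff_mem_nhds]
    rintro p ⟨hpE, t, s, ht, hs0, hs1, h⟩
    have := cross_persist hφc hfl hLc hrcc hrcc huc hu0 h (hsec p s ⟨by linarith, by linarith⟩)
      (η := min t (min (-s) (δ + s))) (lt_min ht (lt_min (by linarith) (by linarith)))
    filter_upwards [this, hEo.mem_nhds hpE] with q hq hqE
    obtain ⟨t', s', h1, h2, h3⟩ := hq
    have h1' := h1.trans_le (min_le_left _ _)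
    have h2' := h2.trans_le ((min_le_right _ _).trans (min_le_left _ _))
    have h2'' := h2.trans_le ((min_le_right _ _).trans (min_le_right _ _))
    rw [abs_lt] at h1' h2' h2''
    exact ⟨hqE, t', s', by linarith, by linarith, by linarith, h3⟩
  have hz0 : ∀ p, φ (L p) 0 (r p) = r p + ((0:ℝ):ℂ) * u p := fun p => by
    rw [(hfl _).zero]; simp
  have h0I : (0:ℝ) ∈ Icc (-δ) δ := ⟨by linarith, hδ.le⟩
  have hdis : Disjoint Rp Rm := by
    rw [Set.disjoint_left]
    rintro p ⟨-, t, s, ht, hs0, hs1, h⟩ ⟨-, t', s', ht', hs0', hs1', h'⟩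
    rcases lt_trichotomy t t' with htt | htt | htt
    · have := Mstar (hfl _) (hu0 p) (hsec p) ht htt h0I ⟨by linarith, by linarith⟩ ⟨by linarith, by linarith⟩
        (hz0 p) h h' hs0
      linarith
    · subst htt
      rw [h] at h'
      have h2 : (s:ℂ) = s' := mul_right_cancel₀ (hu0 p) (add_left_cancel h')
      have : s = s' := by exact_mod_cast h2
      linarith
    · have := Mstar' (hfl _) (hu0 p) (hsec p) ht' htt h0I ⟨by linarith, by linarith⟩ ⟨by linarith, by linarith⟩
        (hz0 p) h' h hs0'
      linarith
  have hAno : ∀ p ∈ A, ∀ t s : ℝ, s ∈ Icc (-δ) δ → φ (L p) t (r p) = r p + s * u p → s = 0 := by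
    rintro p ⟨⟨T, hT, hper⟩, -⟩ t s hs h
    exact (KL (hfl _) (hu0 p) (hsec p) hT hper h0I hs (hz0 p) h).symm
  have hO : IsOpen (A ∪ Rp ∪ Rm) := by
    rw [isOpen_iff_mem_nhds]
    rintro p ((hp | hp) | hp)
    · obtain ⟨⟨T, hT, hper⟩, hK⟩ := hp
      have hinG := hA _ (hLI p) _ (hrz p) T hT hper (fun t => (hK t).1)
      have c1 := cross_persist hφc hfl hLc hrcc hrcc huc hu0 (x₀ := p) (t₀ := T) (s₀ := 0)
        (by rw [hper]; simp) (hsec p 0 h0I) (η := min (min T 1) δ) (by positivity)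
      have c2 : ∀ᶠ q in 𝓝 p, ∀ t ∈ Icc 0 (T + 1), φ (L q) t (r q) ∈ G := by
        apply isCompact_Icc.eventually_forall_of_forall_eventually
        intro t ht
        have hc : Continuous fun q : (ℝ × ℝ) × ℝ => φ (L q.1) q.2 (r q.1) :=
          hφc.comp (by fun_prop : Continuous fun q : (ℝ × ℝ) × ℝ => (L q.1, q.2, ((r q.1 : ℝ) : ℂ)))
        exact hc.continuousAt.eventually (hG.mem_nhds (hinG t))
      filter_upwards [c1, c2, hEo.mem_nhds (hAE ⟨⟨T, hT, hper⟩, hK⟩)] with q hq1 hq2 hqE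
      obtain ⟨t, s, h1, h2, h3⟩ := hq1
      have h1' := h1.trans_le ((min_le_left _ _).trans (min_le_left _ _))
      have h1'' := h1.trans_le ((min_le_left _ _).trans (min_le_right _ _))
      have h2' := h2.trans_le (min_le_right _ _)
      rw [sub_zero] at h2'
      rw [abs_lt] at h1' h1'' h2'
      have htp : 0 < t := by linarith
      rcases lt_trichotomy s 0 with hs | hs | hs
      · right
        exact ⟨hqE, t, s, htp, hs, h2'.1, h3⟩
      · left; left
        subst hs
        have hper' : φ (L q) t (r q) = r q := by rw [h3]; simp
        refine hmemK q t htp hper' (fun t' => subset_closure ?_)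
        have := (hfl (L q)).per_int hper' (-⌊t' / t⌋) t'
        rw [← this]
        apply hq2
        push_cast
        have f1 := Int.floor_le (t' / t)
        have f2 := Int.lt_floor_add_one (t' / t)
        rw [le_div_iff₀ htp] at f1
        rw [div_lt_iff₀ htp] at f2
        exact ⟨by linarith, by linarith⟩
      · left; right
        exact ⟨hqE, t, s, htp, hs, h2'.2, h3⟩
    · exact mem_of_superset (hRpo.mem_nhds hp) (fun x hx => Or.inl (Or.inr hx))
    · exact mem_of_superset (hRmo.mem_nhds hp) (fun x hx => Or.inr hx)
  obtain ⟨f, hf0, hf1, hfp, hfm, hfc⟩ := phi_exists hAcl hRpo hRmo hO hdis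
  have hOE : A ∪ Rp ∪ Rm ⊆ E := by
    rintro p ((hp | hp) | hp)
    · exact hAE hp
    · exact hp.1
    · exact hp.1
  refine rot_contra (r0 := r0) (R := R) hN hfc ?_ ?_ ?_ ?_
  · intro p hp
    apply hf1
    intro h
    have : L p = 0 := by simp [hL, hp]
    linarith [(hOE h).1]
  · intro p hp
    apply hf1
    intro h
    have : L p = 1 := by simp [hL, hp]
    linarith [(hOE h).2.1]
  · intro p hp
    apply hf1
    intro h
    have : r p = R := by simp [hr, hp, hr0R]
    linarith [(hOE h).2.2.1]
  · intro l hl hsin hcos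
    obtain ⟨p, hp⟩ : ∃ p : ℝ × ℝ, p = (l, r0) := ⟨_, rfl⟩
    rw [← hp] at hsin hcos
    have hLp : L p = l := by simp [hL, hp, hl.1, hl.2]
    have hrp : r p = r0 := by simp [hr, hp, hr0R]
    obtain ⟨θ, hθ⟩ : ∃ θ : ℝ, θ = l * Real.pi * N := ⟨_, rfl⟩
    have hlocp := hloc (L p) (hLI p)
    rw [hLp, ← hθ] at hlocp
    rw [← hθ] at hsin hcos
    have hrnε : ‖((r0:ℝ):ℂ)‖ < ε := by simpa [abs_of_pos hr0p] using hr0ε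
    have hup : u p = -Complex.I * Complex.exp (θ * Complex.I) := by
      simp only [hu]
      rw [hLp, hrp, hlocp _ hrnε, norm_mul, Complex.norm_exp_ofReal_mul_I]
      have : ((r0:ℝ):ℂ) ≠ 0 := by exact_mod_cast hr0p.ne'
      simp [abs_of_pos hr0p]
      field_simp
    -- cos = 1
    have hcos1 : Real.cos (f p * Real.pi + 2 * θ) = 1 := by
      have := Real.sin_sq_add_cos_sq (f p * Real.pi + 2 * θ)
      rw [hsin] at this
      nlinarith
    have hc2 : Real.cos (2 * θ) = Real.cos (f p * Real.pi) := by
      have : 2 * θ = (f p * Real.pi + 2 * θ) - f p * Real.pi := by ring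
      rw [this, Real.cos_sub, hsin, hcos1]; ring
    have hs2 : Real.sin (2 * θ) = - Real.sin (f p * Real.pi) := by
      have : 2 * θ = (f p * Real.pi + 2 * θ) - f p * Real.pi := by ring
      rw [this, Real.sin_sub, hsin, hcos1]; ring
    have hAcos : Real.cos θ = 0 → p ∈ A := by
      intro hc
      have hci := fun t => loc_circ (φ := φ l) hlocp (huni l) hc hrnε t
      apply hmemK p (2 * Real.pi) (by positivity)
      · rw [hLp, hrp, (hci _).1]
        have hs : Real.sin θ = 1 ∨ Real.sin θ = -1 := by
          have := Real.sin_sq_add_cos_sq θ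
          rw [hc] at this
          exact sq_eq_sq_iff_eq_or_eq_neg.1 (by linarith)
        have he : Complex.exp (θ * Complex.I) = Real.sin θ * Complex.I := by
          rw [Complex.exp_mul_I, ← Complex.ofReal_cos, ← Complex.ofReal_sin, hc]; simp
        have : Complex.exp (((2 * Real.pi : ℝ):ℂ) * Complex.exp (θ * Complex.I)) = 1 := by
          rw [he, Complex.exp_eq_one_iff]
          rcases hs with hs | hs
          · exact ⟨1, by rw [hs]; push_cast; ring⟩
          · exact ⟨-1, by rw [hs]; push_cast; ring⟩
        rw [this, mul_one]
      · intro t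
        apply subset_closure (hGε _)
        rw [hLp, hrp, mem_closedBall_zero_iff, (hci _).2]
        exact hrnε.le
    by_cases hpO : p ∈ A ∪ Rp ∪ Rm
    · have hsE : p ∈ E → 1 / 2 < |Real.sin θ| := by
        rintro ⟨-, -, -, h | h⟩
        · rwa [hLp, ← hθ] at h
        · linarith
      rcases hpO with (hp1 | hp1) | hp1
      · obtain ⟨⟨T, hT, hper⟩, hK⟩ := hp1
        have := (loc_per (hfl _) (hloc _ (hLI p)) (huni _) (hrz p) (by rw [hrp]; exact hrnε) hT hper).1
        rw [hLp, ← hθ] at this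
        rw [hf0 p ⟨⟨T, hT, hper⟩, hK⟩, Real.cos_two_mul, this] at hc2
        norm_num at hc2
      · have hsn := hsE (hOE (Or.inl (Or.inr hp1)))
        have hfi := hfp p hp1
        obtain ⟨hpE, t, s, ht, hs0, hs1, h⟩ := hp1
        have hc : Real.cos θ ≠ 0 := fun hc => by
          have := hAno p (hAcos hc) t s ⟨by linarith, by linarith⟩ h
          linarith
        rw [hLp, hrp, hup] at h
        refine bottom_contra (hfl l) hlocp hc hsn hr0p hr0ε ht hs0.ne' (by rw [abs_of_pos hs0]; linarith) ?_ h
        have : 0 ≤ Real.sin (f p * Real.pi) := Real.sin_nonneg_of_nonneg_of_le_pi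
          (mul_nonneg hfi.1 Real.pi_pos.le) (by nlinarith [hfi.2, Real.pi_pos])
        nlinarith
      · have hsn := hsE (hOE (Or.inr hp1))
        have hfi := hfm p hp1
        obtain ⟨hpE, t, s, ht, hs0, hs1, h⟩ := hp1
        have hc : Real.cos θ ≠ 0 := fun hc => by
          have := hAno p (hAcos hc) t s ⟨by linarith, by linarith⟩ h
          linarith
        rw [hLp, hrp, hup] at h
        refine bottom_contra (hfl l) hlocp hc hsn hr0p hr0ε ht hs0.ne (by rw [abs_of_neg hs0]; linarith) ?_ h
        have : Real.sin (f p * Real.pi) ≤ 0 := Real.sin_nonpos_of_nonpos_of_neg_pi_le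
          (by nlinarith [hfi.2, Real.pi_pos]) (by nlinarith [hfi.1, Real.pi_pos])
        nlinarith
    · rw [hf1 p hpO, one_mul, Real.cos_pi, Real.cos_two_mul] at hc2
      have : Real.cos θ = 0 := by nlinarith
      exact hpO (Or.inl (Or.inl (hAcos this)))
end

section
open Set Filter Topology Metric

theorem time_change {E : Type*} [NormedAddCommGroup E] [NormedSpace ℝ E] {V : E → E} {s : E → ℝ}
    (hs : Continuous s) (hs0 : ∀ x, 0 < s x) {x : ℝ → E}
    (hx : ∀ t, HasDerivAt x (s (x t) • V (x t)) t) {T : ℝ} (hT : 0 < T)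
    (hper : Function.Periodic x T) :
    ∃ y : ℝ → E, (∀ t, HasDerivAt y (V (y t)) t) ∧ (∃ T' > 0, Function.Periodic y T') ∧
      range y = range x := by
  have hxc : Continuous x := continuous_iff_continuousAt.2 fun t => (hx t).continuousAt
  have hgc : Continuous fun t => s (x t) := hs.comp hxc
  set τ : ℝ → ℝ := fun t => ∫ u in (0:ℝ)..t, s (x u) with hτ
  have hτd : ∀ t, HasDerivAt τ (s (x t)) t := fun t => hgc.integral_hasStrictDerivAt 0 t |>.hasDerivAt
  have hτc : Continuous τ := continuous_iff_continuousAt.2 fun t => (hτd t).continuousAt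
  have hmono : StrictMono τ := strictMono_of_deriv_pos fun t => by rw [(hτd t).deriv]; exact hs0 _
  have hτ0 : τ 0 = 0 := by simp [hτ]
  set P := τ T with hP
  have hPpos : 0 < P := by rw [hP, ← hτ0]; exact hmono hT
  have hshift : ∀ t, τ (t + T) = τ t + P := by
    intro t
    have h1 : ∀ t, HasDerivAt (fun t => τ (t + T) - τ t) 0 t := by
      intro t
      have := ((hτd (t + T)).comp_add_const t T).sub (hτd t)
      rw [hper t, sub_self] at this
      exact this
    have h2 := is_const_of_deriv_eq_zero (fun t => (h1 t).differentiableAt) (fun t => (h1 t).deriv) t 0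
    simp only [zero_add, hτ0, sub_zero] at h2
    linarith
  have hn : ∀ n : ℕ, τ (n * T) = n * P := by
    intro n
    induction n with
    | zero => simp [hτ0]
    | succ n ih =>
      push_cast
      rw [add_mul, one_mul, hshift, ih]; ring
  have hn' : ∀ n : ℕ, τ (-(n * T)) = -(n * P) := by
    intro n
    induction n with
    | zero => simp [hτ0]
    | succ n ih =>
      have := hshift (-((n + 1 : ℕ) * T))
      have h2 : -(((n + 1 : ℕ):ℝ) * T) + T = -(n * T) := by push_cast; ring
      rw [h2, ih] at this
      push_cast at this ⊢
      linarith
  have hsurj : Function.Surjective τ := by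
    intro c
    apply mem_range_of_exists_le_of_exists_ge hτc
    · obtain ⟨n, h⟩ := exists_nat_gt (-c / P)
      rw [div_lt_iff₀ hPpos] at h
      exact ⟨_, by rw [hn' n]; linarith⟩
    · obtain ⟨n, h⟩ := exists_nat_gt (c / P)
      rw [div_lt_iff₀ hPpos] at h
      exact ⟨_, by rw [hn n]; linarith⟩
  set e := hmono.orderIsoOfSurjective τ hsurj with he
  have hetau : ∀ t, e t = τ t := fun t => rfl
  set σ : ℝ → ℝ := fun t => e.symm t with hσ
  have hσc : Continuous σ := e.symm.toHomeomorph.continuous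
  have hτσ : ∀ t, τ (σ t) = t := fun t => e.apply_symm_apply t
  have hστ : ∀ t, σ (τ t) = t := fun t => e.symm_apply_apply t
  have hσd : ∀ t, HasDerivAt σ (s (x (σ t)))⁻¹ t := fun t =>
    HasDerivAt.of_local_left_inverse hσc.continuousAt (hτd (σ t)) (hs0 _).ne'
      (Eventually.of_forall hτσ)
  refine ⟨fun t => x (σ t), fun t => ?_, ⟨P, hPpos, fun t => ?_⟩, ?_⟩
  · have := (hx (σ t)).scomp t (hσd t)
    rw [smul_smul, inv_mul_cancel₀ (hs0 _).ne', one_smul] at this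
    exact this
  · have : σ (t + P) = σ t + T := by
      apply hmono.injective
      rw [hτσ, hshift, hτσ]
    simp only [this]
    exact hper _
  · ext z
    constructor
    · rintro ⟨t, rfl⟩; exact ⟨_, rfl⟩
    · rintro ⟨t, rfl⟩; exact ⟨τ t, by simp only [hστ]⟩
end

section
open Set Filter Topology Metric

theorem eig_roots (M : Matrix (Fin 2) (Fin 2) ℝ) : ∃ μ₁ μ₂ : ℂ,
    μ₁ ∈ spectrum ℂ (M.map Complex.ofReal) ∧ μ₂ ∈ spectrum ℂ (M.map Complex.ofReal) ∧
    M 0 0 + M 1 1 = μ₁.re + μ₂.re ∧ M.det = μ₁.re * μ₂.re + μ₁.im ^ 2 := by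
  have hsp : ∀ μ : ℂ, μ ^ 2 - (M 0 0 + M 1 1 : ℝ) * μ + (M.det : ℝ) = 0 →
      μ ∈ spectrum ℂ (M.map Complex.ofReal) := by
    intro μ h
    rw [spectrum.mem_iff, Matrix.isUnit_iff_isUnit_det, isUnit_iff_ne_zero, not_not]
    rw [Matrix.det_fin_two] at h ⊢
    simp [Matrix.algebraMap_matrix_apply]
    push_cast at h
    linear_combination h
  obtain ⟨w, hw⟩ := IsAlgClosed.exists_pow_nat_eq (((M 0 0 + M 1 1)^2 - 4 * M.det : ℝ) : ℂ) (n := 2) (by norm_num)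
  have him : 2 * w.re * w.im = 0 := by
    have := congrArg Complex.im hw
    rw [Complex.ofReal_im, pow_two, Complex.mul_im] at this
    linarith
  have hre : w.re ^ 2 - w.im ^ 2 = (M 0 0 + M 1 1)^2 - 4 * M.det := by
    have := congrArg Complex.re hw
    rw [Complex.ofReal_re, pow_two, Complex.mul_re] at this
    linarith
  refine ⟨((M 0 0 + M 1 1 : ℝ) + w) / 2, ((M 0 0 + M 1 1 : ℝ) - w) / 2, hsp _ ?_, hsp _ ?_, ?_, ?_⟩
  · push_cast at hw ⊢
    linear_combination hw / 4
  · push_cast at hw ⊢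
    linear_combination hw / 4
  · simp
    ring
  · simp
    linarith

theorem eig_pos (M : Matrix (Fin 2) (Fin 2) ℝ)
    (h : ∀ μ, μ ∈ spectrum ℂ (M.map Complex.ofReal) → 0 < μ.re) :
    0 < M 0 0 + M 1 1 ∧ 0 < M.det := by
  obtain ⟨a, b, ha, hb, h1, h2⟩ := eig_roots M
  have := h a ha
  have := h b hb
  exact ⟨by linarith, by rw [h2]; positivity⟩

theorem eig_neg (M : Matrix (Fin 2) (Fin 2) ℝ)
    (h : ∀ μ, μ ∈ spectrum ℂ (M.map Complex.ofReal) → μ.re < 0) :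
    M 0 0 + M 1 1 < 0 ∧ 0 < M.det := by
  obtain ⟨a, b, ha, hb, h1, h2⟩ := eig_roots M
  have h3 := h a ha
  have h4 := h b hb
  exact ⟨by linarith, by rw [h2]; nlinarith [mul_pos_of_neg_of_neg h3 h4, sq_nonneg a.im]⟩
end

section
open Set Filter Topology Metric

/-- gradient field -/
noncomputable def hf (α β z : ℂ) : ℂ := ‖α‖ ^ 2 * z - α * β * (starRingEnd ℂ) z

/-- Lyapunov quadratic form -/
noncomputable def Qf (α β z : ℂ) : ℝ := ((starRingEnd ℂ) (hf α β z) * z).re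

theorem Qf_eq (α β z : ℂ) : Qf α β z =
    ‖α‖ ^ 2 * (z.re ^ 2 + z.im ^ 2) - ((α * β).re * (z.re ^ 2 - z.im ^ 2) + 2 * (α * β).im * (z.re * z.im)) := by
  unfold Qf hf
  have : ((‖α‖:ℂ) ^ 2) = ((‖α‖ ^ 2 : ℝ) : ℂ) := by push_cast; rfl
  rw [this]
  generalize ‖α‖ ^ 2 = A
  generalize α * β = b
  simp [Complex.mul_re, Complex.mul_im]
  ring

theorem hf_re (α β z v : ℂ) : ((starRingEnd ℂ) (hf α β z) * v).re =
    ‖α‖ ^ 2 * (z.re * v.re + z.im * v.im) - ((α * β).re * (z.re * v.re - z.im * v.im)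
      + (α * β).im * (z.re * v.im + z.im * v.re)) := by
  unfold hf
  have : ((‖α‖:ℂ) ^ 2) = ((‖α‖ ^ 2 : ℝ) : ℂ) := by push_cast; rfl
  rw [this]
  generalize ‖α‖ ^ 2 = A
  generalize α * β = b
  simp [Complex.mul_re, Complex.mul_im]
  ring

theorem Qf_cont (α β : ℂ) : Continuous (Qf α β) := by
  unfold Qf hf
  fun_prop

theorem hf_cont (α β : ℂ) : Continuous (hf α β) := by
  unfold hf
  fun_prop

theorem Qf_deriv {α β : ℂ} {x : ℝ → ℂ} {v : ℂ} {t : ℝ} (h : HasDerivAt x v t) :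
    HasDerivAt (fun t => Qf α β (x t)) (2 * ((starRingEnd ℂ) (hf α β (x t)) * v).re) t := by
  have h1 : HasDerivAt (fun t => (x t).re) v.re t := by
    simpa [Function.comp_def] using Complex.reCLM.hasFDerivAt.comp_hasDerivAt t h
  have h2 : HasDerivAt (fun t => (x t).im) v.im t := by
    simpa [Function.comp_def] using Complex.imCLM.hasFDerivAt.comp_hasDerivAt t h
  have e : (fun t => Qf α β (x t)) = fun t => ‖α‖ ^ 2 * ((x t).re * (x t).re + (x t).im * (x t).im) -
      ((α * β).re * ((x t).re * (x t).re - (x t).im * (x t).im) + 2 * (α * β).im * ((x t).re * (x t).im)) := by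
    funext t
    rw [Qf_eq]; ring
  rw [e]
  have := (((h1.mul h1).add (h2.mul h2)).const_mul (‖α‖ ^ 2)).sub
    ((((h1.mul h1).sub (h2.mul h2)).const_mul (α * β).re).add ((h1.mul h2).const_mul (2 * (α * β).im)))
  refine HasDerivAt.congr_deriv this ?_
  rw [hf_re]; ring

theorem hf_J (α β z : ℂ) : ((starRingEnd ℂ) (hf α β z) * (α * z + β * (starRingEnd ℂ) z)).re =
    α.re * (‖α‖ ^ 2 - ‖β‖ ^ 2) * ‖z‖ ^ 2 := by
  rw [hf_re, ← Complex.normSq_eq_norm_sq, ← Complex.normSq_eq_norm_sq, ← Complex.normSq_eq_norm_sq,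
    Complex.normSq_apply, Complex.normSq_apply, Complex.normSq_apply]
  simp [Complex.mul_re, Complex.mul_im]
  ring

theorem hf_norm {α β : ℂ} (h : ‖β‖ < ‖α‖) (z : ℂ) : ‖hf α β z‖ ≤ 2 * ‖α‖ ^ 2 * ‖z‖ := by
  unfold hf
  refine (norm_sub_le _ _).trans ?_
  simp only [norm_mul, norm_pow, Complex.norm_real, norm_norm, RCLike.norm_conj]
  have : ‖α‖ * ‖β‖ * ‖z‖ ≤ ‖α‖ * ‖α‖ * ‖z‖ := by gcongr
  nlinarith

theorem Qf_upper {α β : ℂ} (h : ‖β‖ < ‖α‖) (z : ℂ) : Qf α β z ≤ 2 * ‖α‖ ^ 2 * ‖z‖ ^ 2 := by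
  unfold Qf
  refine (Complex.re_le_norm _).trans ?_
  rw [norm_mul, RCLike.norm_conj]
  have := mul_le_mul_of_nonneg_right (hf_norm h z) (norm_nonneg z)
  nlinarith

theorem Qf_lower (α β : ℂ) (z : ℂ) : ‖α‖ * (‖α‖ - ‖β‖) * ‖z‖ ^ 2 ≤ Qf α β z := by
  have h1 : Qf α β z = ‖α‖ ^ 2 * ‖z‖ ^ 2 - ((starRingEnd ℂ) (α * β * (starRingEnd ℂ) z) * z).re := by
    unfold Qf hf
    rw [map_sub, sub_mul, Complex.sub_re]
    congr 1
    rw [← Complex.normSq_eq_norm_sq z, Complex.normSq_apply]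
    have : ((‖α‖:ℂ) ^ 2) = ((‖α‖ ^ 2 : ℝ) : ℂ) := by push_cast; rfl
    rw [this]
    generalize ‖α‖ ^ 2 = A
    simp [Complex.mul_re]
    ring
  have h2 := Complex.re_le_norm ((starRingEnd ℂ) (α * β * (starRingEnd ℂ) z) * z)
  rw [norm_mul, RCLike.norm_conj, norm_mul, norm_mul, RCLike.norm_conj] at h2
  rw [h1]
  nlinarith

theorem level_none {φ : ℝ → ℂ → ℂ} {W : ℂ → ℂ} (hφ : IsFlow φ W) {α β : ℂ} {q σ : ℝ}
    (h : ∀ z, Qf α β z = q → 0 < σ * ((starRingEnd ℂ) (hf α β z) * W z).re)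
    {z : ℂ} (hz : Qf α β z = q) {T : ℝ} (hT : 0 < T) (hper : φ T z = z) : False := by
  have hσ : σ ≠ 0 := by
    rintro rfl
    have := h z hz
    simp at this
  have hc : Continuous fun t => Qf α β (φ t z) := (Qf_cont α β).comp (hφ.ct z)
  rcases lt_or_gt_of_ne hσ with hs | hs
  · have := lyap_core (g := fun t => Qf α β (φ (-t) z)) (q := q) (hc.comp continuous_neg)
      (fun t ht => by
        have hd := (Qf_deriv (α := α) (β := β) (hφ.deriv z (-t))).scomp t (hasDerivAt_neg t)
        refine ⟨_, ?_, hd⟩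
        have := h _ ht
        simp only [smul_eq_mul]
        nlinarith) (a := 0) (by simp only [neg_zero, hφ.zero]; exact hz.ge) T hT
    have h2 := hφ.cancel T z
    rw [hper] at h2
    simp only [h2] at this
    linarith
  · have := lyap_core (g := fun t => Qf α β (φ t z)) (q := q) hc
      (fun t ht => by
        have hd := (Qf_deriv (α := α) (β := β) (hφ.deriv z t))
        refine ⟨_, ?_, hd⟩
        have := h _ ht
        have := (pos_iff_pos_of_mul_pos this).1 hs
        positivity) (a := 0) (by simp only [hφ.zero]; exact hz.ge) T hT
    simp only [hper] at this
    linarith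

theorem level_trap {φ : ℝ → ℂ → ℂ} {W : ℂ → ℂ} (hφ : IsFlow φ W) {α β : ℂ} {q σ : ℝ}
    (h : ∀ z, Qf α β z = q → 0 < σ * ((starRingEnd ℂ) (hf α β z) * W z).re)
    {z : ℂ} (hz : Qf α β z < q) {T : ℝ} (hT : 0 < T) (hper : φ T z = z) (t : ℝ) :
    Qf α β (φ t z) < q := by
  by_contra hcon
  push Not at hcon
  have hc : Continuous fun t => Qf α β (φ t z) := (Qf_cont α β).comp (hφ.ct z)
  obtain ⟨t', ht'⟩ := mem_range_of_exists_le_of_exists_ge (c := q) hc ⟨0, by simp only [hφ.zero]; exact hz.le⟩ ⟨t, hcon⟩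
  refine level_none hφ h ht' hT ?_
  rw [← hφ.add, add_comm, hφ.add, hper]
end

section
open Set Filter Topology Metric Asymptotics

/-- the non-degenerate trace case -/
theorem claimH_tr {V : ℝ → ℂ → ℂ} {l0 : ℝ} {α β : ℂ}
    (hd : (fun z => V l0 z - (α * z + β * (starRingEnd ℂ) z)) =o[𝓝 0] (fun z => z))
    (hdet : ‖β‖ < ‖α‖) (ht : α.re ≠ 0) :
    ∃ η > 0, (∀ z, ‖z‖ < η → z ≠ 0 → 0 < α.re * ((starRingEnd ℂ) (hf α β z) * V l0 z).re) := by
  have hαp : 0 < ‖α‖ := (norm_nonneg β).trans_lt hdet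
  have hdp : 0 < ‖α‖ ^ 2 - ‖β‖ ^ 2 := by nlinarith [norm_nonneg β]
  obtain ⟨c, hc⟩ : ∃ c : ℝ, c = |α.re| * (‖α‖ ^ 2 - ‖β‖ ^ 2) / (4 * ‖α‖ ^ 2) := ⟨_, rfl⟩
  have hcp : 0 < c := by rw [hc]; have := abs_pos.2 ht; positivity
  obtain ⟨η, hη, h⟩ := Metric.eventually_nhds_iff.1 (hd.def hcp)
  refine ⟨η, hη, fun z hz hz0 => ?_⟩
  have hb := h (y := z) (by simpa using hz)
  have hzp : 0 < ‖z‖ := norm_pos_iff.2 hz0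
  have e : ((starRingEnd ℂ) (hf α β z) * V l0 z).re = α.re * (‖α‖ ^ 2 - ‖β‖ ^ 2) * ‖z‖ ^ 2 +
      ((starRingEnd ℂ) (hf α β z) * (V l0 z - (α * z + β * (starRingEnd ℂ) z))).re := by
    rw [← hf_J α β z, ← Complex.add_re]
    congr 1; ring
  have hb2 : |((starRingEnd ℂ) (hf α β z) * (V l0 z - (α * z + β * (starRingEnd ℂ) z))).re| ≤
      |α.re| * (‖α‖ ^ 2 - ‖β‖ ^ 2) * ‖z‖ ^ 2 / 2 := by
    refine (Complex.abs_re_le_norm _).trans ?_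
    rw [norm_mul, RCLike.norm_conj]
    calc _ ≤ (2 * ‖α‖ ^ 2 * ‖z‖) * (c * ‖z‖) := by
          gcongr
          exact hf_norm hdet z
      _ = _ := by rw [hc]; field_simp; ring
  rw [e, mul_add]
  have h3 : -(|α.re| * (|α.re| * (‖α‖ ^ 2 - ‖β‖ ^ 2) * ‖z‖ ^ 2 / 2)) ≤ α.re * ((starRingEnd ℂ) (hf α β z) * (V l0 z - (α * z + β * (starRingEnd ℂ) z))).re := by
    have := neg_abs_le (α.re * ((starRingEnd ℂ) (hf α β z) * (V l0 z - (α * z + β * (starRingEnd ℂ) z))).re)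
    rw [abs_mul] at this
    refine le_trans ?_ this
    gcongr
  have h4 : |α.re| * |α.re| = α.re * α.re := abs_mul_abs_self _
  have h5 : 0 < α.re * α.re := mul_self_pos.2 ht
  have h6 : 0 < α.re * α.re * ((‖α‖ ^ 2 - ‖β‖ ^ 2) * ‖z‖ ^ 2) := by positivity
  have h7 : |α.re| * (|α.re| * (‖α‖ ^ 2 - ‖β‖ ^ 2) * ‖z‖ ^ 2 / 2) = α.re * α.re * ((‖α‖ ^ 2 - ‖β‖ ^ 2) * ‖z‖ ^ 2) / 2 := by
    rw [← h4]; ring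
  rw [h7] at h3
  nlinarith

def ClaimH (V : ℝ → ℂ → ℂ) (l0 δ : ℝ) : Prop :=
  ∃ ε > 0, ∀ᶠ l in 𝓝 l0, ∀ (W : ℂ → ℂ) (φ : ℝ → ℂ → ℂ), IsFlow φ W →
    (∀ z, ε ≤ ‖z‖ → W z = V l z) → ∀ z T, 0 < T → φ T z = z → ‖z‖ < ε → ∀ t, ‖φ t z‖ < δ

theorem claimH_ne {V : ℝ → ℂ → ℂ} (hV : Continuous fun p : ℝ × ℂ => V p.1 p.2) {l0 : ℝ} {α β : ℂ}
    (hd : (fun z => V l0 z - (α * z + β * (starRingEnd ℂ) z)) =o[𝓝 0] (fun z => z))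
    (hdet : ‖β‖ < ‖α‖) (ht : α.re ≠ 0) {δ : ℝ} (hδ : 0 < δ) : ClaimH V l0 δ := by
  have hαp : 0 < ‖α‖ := (norm_nonneg β).trans_lt hdet
  obtain ⟨η, hη, h⟩ := claimH_tr hd hdet ht
  obtain ⟨k, hk⟩ : ∃ k : ℝ, k = ‖α‖ * (‖α‖ - ‖β‖) := ⟨_, rfl⟩
  have hkp : 0 < k := by rw [hk]; exact mul_pos hαp (by linarith)
  have hlow : ∀ z, k * ‖z‖ ^ 2 ≤ Qf α β z := fun z => by rw [hk]; exact Qf_lower α β z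
  obtain ⟨m, hm⟩ : ∃ m : ℝ, m = min δ η / 2 := ⟨_, rfl⟩
  have hmp : 0 < m := by rw [hm]; positivity
  have hmδ : m < δ := by rw [hm]; have := min_le_left δ η; linarith
  have hmη : m < η := by rw [hm]; have := min_le_right δ η; linarith
  obtain ⟨q, hq⟩ : ∃ q : ℝ, q = k * m ^ 2 := ⟨_, rfl⟩
  have hqp : 0 < q := by rw [hq]; positivity
  have hlt : ∀ z, Qf α β z ≤ q → ‖z‖ ≤ m := by
    intro z hz
    have h1 := (hlow z).trans hz
    rw [hq] at h1
    have h2 := le_of_mul_le_mul_left h1 hkp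
    exact (pow_le_pow_iff_left₀ (norm_nonneg z) hmp.le (by norm_num)).1 h2
  have hcpt : IsCompact {z | Qf α β z = q} := by
    apply (isCompact_closedBall (0:ℂ) m).of_isClosed_subset (isClosed_eq (Qf_cont α β) continuous_const)
    intro z hz
    rw [mem_closedBall_zero_iff]
    exact hlt z (le_of_eq hz)
  have hev : ∀ᶠ l in 𝓝 l0, ∀ z ∈ {z | Qf α β z = q}, 0 < α.re * ((starRingEnd ℂ) (hf α β z) * V l z).re := by
    apply hcpt.eventually_forall_of_forall_eventually
    intro z hz
    have hz' : Qf α β z = q := hz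
    have hc : Continuous fun p : ℝ × ℂ => α.re * ((starRingEnd ℂ) (hf α β p.2) * V p.1 p.2).re := by
      have h1 := (hf_cont α β).comp (continuous_snd (X := ℝ) (Y := ℂ))
      have h2 : Continuous fun p : ℝ × ℂ => (starRingEnd ℂ) (hf α β p.2) := Complex.continuous_conj.comp h1
      exact continuous_const.mul (Complex.continuous_re.comp (h2.mul hV))
    refine hc.continuousAt.eventually_const_lt (h z ((hlt z hz'.le).trans_lt hmη) ?_)
    rintro rfl
    simp [Qf] at hz'
    linarith
  obtain ⟨ε, hε⟩ : ∃ ε : ℝ, ε = Real.sqrt (q / (2 * ‖α‖ ^ 2)) := ⟨_, rfl⟩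
  have hεp : 0 < ε := by rw [hε]; exact Real.sqrt_pos.2 (by positivity)
  have hup : ∀ z, ‖z‖ < ε → Qf α β z < q := by
    intro z hz
    refine (Qf_upper hdet z).trans_lt ?_
    have h1 : ‖z‖ ^ 2 < ε ^ 2 := by gcongr
    rw [hε, Real.sq_sqrt (by positivity), lt_div_iff₀ (by positivity)] at h1
    linarith
  refine ⟨ε, hεp, ?_⟩
  filter_upwards [hev] with l hl W φ hφ hW z T hT hper hz t
  have := level_trap hφ (α := α) (β := β) (q := q) (σ := α.re) (fun z hz => by
    rw [hW z (by
      by_contra hcon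
      push Not at hcon
      exact absurd hz (hup z hcon).ne)]
    exact hl z hz) (hup z hz) hT hper t
  exact (hlt _ this.le).trans_lt hmδ
end

section
open Set Filter Topology Metric Asymptotics

theorem turn_pos {Z Z' : ℝ → ℂ} {ω κ ρ t1 : ℝ} (hω : 0 < ω) (hρ : 0 < ρ)
    (hZ : ∀ t, HasDerivAt Z (Z' t) t)
    (herr : ∀ t, ρ / 2 ≤ ‖Z t‖ → ‖Z t‖ ≤ 2 * ρ → ‖Z' t - Complex.I * ω * Z t‖ ≤ κ * ρ)
    (hκ : κ < ω / (16 * Real.pi)) (h1 : ‖Z t1‖ = ρ) :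
    ∃ t s : ℝ, Z t = s ∧ 3 / 4 * ρ ≤ s ∧ s ≤ 5 / 4 * ρ := by
  have hpi := Real.pi_pos
  obtain ⟨k, hk⟩ : ∃ k : ℝ, k = ω / (16 * Real.pi) := ⟨_, rfl⟩
  rw [← hk] at hκ
  have hkp : 0 < k := by rw [hk]; positivity
  obtain ⟨t2, ht2⟩ : ∃ t2 : ℝ, t2 = t1 + 4 * Real.pi / ω := ⟨_, rfl⟩
  have h12 : t1 ≤ t2 := by rw [ht2]; have : 0 < 4 * Real.pi / ω := by positivity
                           linarith
  have hk2 : k * (t2 - t1) = 1 / 4 := by rw [hk, ht2]; field_simp; ring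
  set g : ℝ → ℂ := fun t => Complex.exp (((-(ω * (t - t1)) : ℝ) : ℂ) * Complex.I) * Z t with hg
  have hgn : ∀ t, ‖g t‖ = ‖Z t‖ := fun t => by
    simp only [hg]
    rw [norm_mul, Complex.norm_exp_ofReal_mul_I, one_mul]
  have hg1 : g t1 = Z t1 := by simp [hg]
  have hgd : ∀ t, HasDerivAt g (Complex.exp (((-(ω * (t - t1)) : ℝ) : ℂ) * Complex.I) *
      (Z' t - Complex.I * ω * Z t)) t := by
    intro t
    have a1 : HasDerivAt (fun t : ℝ => -(ω * (t - t1))) (-(ω * 1)) t :=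
      (((hasDerivAt_id t).sub_const t1).const_mul ω).neg
    have a2 := (a1.ofReal_comp.mul_const Complex.I).cexp.mul (hZ t)
    refine (show HasDerivAt g _ t from a2).congr_deriv ?_
    push_cast
    ring
  have hgc : Continuous g := continuous_iff_continuousAt.2 fun t => (hgd t).continuousAt
  have hclose : ∀ t ∈ Icc t1 t2, ‖g t - g t1‖ ≤ k * ρ * (t - t1) := by
    intro t ht
    refine image_norm_le_of_norm_deriv_right_lt_deriv_boundary (f := fun t => g t - g t1)
      (B := fun t => k * ρ * (t - t1)) (B' := fun _ => k * ρ) (a := t1) (b := t2)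
      (f' := fun t => (Complex.exp (((-(ω * (t - t1)) : ℝ) : ℂ) * Complex.I) *
        (Z' t - Complex.I * ω * Z t)))
      (by fun_prop) (fun t _ => ((hgd t).sub_const _).hasDerivWithinAt) (by simp)
      (fun t => by simpa using ((hasDerivAt_id t).sub_const t1).const_mul (k * ρ)) ?_ ht
    intro t ht hB
    have hle : k * ρ * (t - t1) ≤ ρ / 4 := by
      have : k * (t - t1) ≤ k * (t2 - t1) := by gcongr; exact ht.2.le
      rw [hk2] at this
      nlinarith
    rw [hg1] at hB
    have b1 : ‖g t‖ ≤ ‖Z t1‖ + ‖g t - Z t1‖ := by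
      have := norm_add_le (Z t1) (g t - Z t1)
      rwa [add_sub_cancel] at this
    have b2 : ‖Z t1‖ - ‖g t - Z t1‖ ≤ ‖g t‖ := by
      have := norm_sub_norm_le (Z t1) (Z t1 - g t)
      rw [sub_sub_cancel, norm_sub_rev] at this
      exact this
    rw [hgn] at b1 b2
    have := herr t (by linarith) (by linarith)
    rw [norm_mul, Complex.norm_exp_ofReal_mul_I, one_mul]
    exact this.trans_lt (by gcongr)
  have hZ1 : Z t1 ≠ 0 := by rw [← norm_pos_iff, h1]; exact hρ
  set w : ℝ → ℂ := fun t => g t / Z t1 with hw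
  have hwc : Continuous w := hgc.div_const _
  have hw1 : w t1 = 1 := by simp only [hw, hg1]; exact div_self hZ1
  have hwb : ∀ t ∈ Icc t1 t2, ‖w t - 1‖ ≤ 1 / 4 := by
    intro t ht
    have e : w t - 1 = (g t - g t1) / Z t1 := by simp only [hw, hg1]; field_simp
    rw [e, norm_div, h1, div_le_iff₀ hρ]
    refine (hclose t ht).trans ?_
    have : k * (t - t1) ≤ k * (t2 - t1) := by gcongr; exact ht.2
    rw [hk2] at this
    nlinarith
  have hre : ∀ t ∈ Icc t1 t2, 0 < (w t).re := by
    intro t ht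
    have := (Complex.abs_re_le_norm _).trans (hwb t ht)
    rw [abs_le] at this
    simp at this
    linarith [this.1]
  have harg : ∀ t ∈ Icc t1 t2, |(w t).arg| < Real.pi / 2 := fun t ht =>
    Complex.abs_arg_lt_pi_div_two_iff.2 (Or.inl (hre t ht))
  have hAc : ContinuousOn (fun t => (Z t1).arg + ω * (t - t1) + (w t).arg) (Icc t1 t2) := by
    apply ContinuousOn.add (by fun_prop)
    intro t ht
    have := Complex.continuousAt_arg (x := w t) (Or.inl (hre t ht))
    exact (ContinuousAt.comp (g := Complex.arg) this hwc.continuousAt).continuousWithinAt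
  have hivt := intermediate_value_Icc h12 hAc
  have hmem : 2 * Real.pi ∈ Icc ((Z t1).arg + ω * (t1 - t1) + (w t1).arg)
      ((Z t1).arg + ω * (t2 - t1) + (w t2).arg) := by
    have a1 := Complex.arg_le_pi (Z t1)
    have a2 := Complex.neg_pi_lt_arg (Z t1)
    have a3 := (abs_lt.1 (harg t2 ⟨h12, le_rfl⟩)).1
    have a4 : ω * (t2 - t1) = 4 * Real.pi := by rw [ht2]; field_simp; ring
    rw [hw1, a4]
    simp
    constructor <;> linarith
  obtain ⟨t, ht, htA⟩ := hivt hmem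
  refine ⟨t, ‖Z t‖, ?_, ?_, ?_⟩
  · have e1 : Z t = Complex.exp (((ω * (t - t1) : ℝ) : ℂ) * Complex.I) * g t := by
      simp only [hg]
      rw [← mul_assoc, ← Complex.exp_add]
      push_cast
      rw [← add_mul, add_neg_cancel]; simp
    have e2 : g t = Z t1 * w t := by simp only [hw]; field_simp
    have e3 : Z t = (‖Z t1‖ * ‖w t‖ : ℝ) * Complex.exp (((2 * Real.pi : ℝ) : ℂ) * Complex.I) := by
      rw [e1, e2, ← htA]
      conv_lhs => rw [← Complex.norm_mul_exp_arg_mul_I (Z t1), ← Complex.norm_mul_exp_arg_mul_I (w t)]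
      push_cast
      rw [add_mul, add_mul, Complex.exp_add, Complex.exp_add]
      ring
    have e4 : Complex.exp (((2 * Real.pi : ℝ) : ℂ) * Complex.I) = 1 := by
      push_cast; exact Complex.exp_two_pi_mul_I
    rw [e4, mul_one] at e3
    have e5 : ‖Z t‖ = ‖Z t1‖ * ‖w t‖ := by
      rw [e3, Complex.norm_real, Real.norm_of_nonneg (by positivity)]
    rw [e5]; exact e3
  · have := hclose t ht
    have hle : k * ρ * (t - t1) ≤ ρ / 4 := by
      have : k * (t - t1) ≤ k * (t2 - t1) := by gcongr; exact ht.2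
      rw [hk2] at this
      nlinarith
    have b2 := norm_sub_norm_le (g t1) (g t1 - g t)
    rw [sub_sub_cancel, norm_sub_rev, hg1, hgn, h1, ← hg1] at b2
    linarith
  · have := hclose t ht
    have hle : k * ρ * (t - t1) ≤ ρ / 4 := by
      have : k * (t - t1) ≤ k * (t2 - t1) := by gcongr; exact ht.2
      rw [hk2] at this
      nlinarith
    have b1 := norm_add_le (g t1) (g t - g t1)
    rw [add_sub_cancel, hg1, hgn, h1, ← hg1] at b1
    linarith

theorem turn {Z Z' : ℝ → ℂ} {ω κ ρ t1 : ℝ} (hω : ω ≠ 0) (hρ : 0 < ρ)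
    (hZ : ∀ t, HasDerivAt Z (Z' t) t)
    (herr : ∀ t, ρ / 2 ≤ ‖Z t‖ → ‖Z t‖ ≤ 2 * ρ → ‖Z' t - Complex.I * ω * Z t‖ ≤ κ * ρ)
    (hκ : κ < |ω| / (16 * Real.pi)) (h1 : ‖Z t1‖ = ρ) :
    ∃ t s : ℝ, Z t = s ∧ 3 / 4 * ρ ≤ s ∧ s ≤ 5 / 4 * ρ := by
  rcases lt_or_gt_of_ne hω with h | h
  · rw [abs_of_neg h] at hκ
    obtain ⟨t, s, a, b, c⟩ := turn_pos (Z := fun t => (starRingEnd ℂ) (Z t))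
      (Z' := fun t => (starRingEnd ℂ) (Z' t)) (ω := -ω) (κ := κ) (ρ := ρ) (t1 := t1) (by linarith) hρ
      (fun t => by
        have := Complex.conjCLE.toContinuousLinearMap.hasFDerivAt.comp_hasDerivAt t (hZ t)
        exact this)
      (fun t ha hb => by
        simp only [RCLike.norm_conj] at ha hb
        have := herr t ha hb
        rw [← RCLike.norm_conj] at this
        simpa using this) hκ (by simpa using h1)
    refine ⟨t, s, ?_, b, c⟩
    have := congrArg (starRingEnd ℂ) a
    simpa using this
  · rw [abs_of_pos h] at hκ
    exact turn_pos h hρ hZ herr hκ h1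

theorem KL_neg {φ V} (hφ : IsFlow φ V) {a b : ℝ} {c u : ℂ} (hu : u ≠ 0)
    (hV : ∀ s ∈ Icc a b, (V (c + s * u) / u).im < 0) {z : ℂ} {P p q sp sq : ℝ} (hP : 0 < P)
    (hper : φ P z = z) (hsp : sp ∈ Icc a b) (hsq : sq ∈ Icc a b)
    (hp : φ p z = c + sp * u) (hq : φ q z = c + sq * u) : sp = sq := by
  have := KL hφ (a := -b) (b := -a) (c := c) (u := -u) (neg_ne_zero.2 hu) (fun s hs => by
    have := hV (-s) ⟨by linarith [hs.2], by linarith [hs.1]⟩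
    rw [div_neg, Complex.neg_im]
    push_cast at this
    have e : c + (s:ℂ) * -u = c + -(s:ℂ) * u := by ring
    rw [e]; linarith) hP hper (p := p) (q := q) (sp := -sp) (sq := -sq)
    ⟨by linarith [hsp.2], by linarith [hsp.1]⟩ ⟨by linarith [hsq.2], by linarith [hsq.1]⟩
    (by rw [hp]; push_cast; ring) (by rw [hq]; push_cast; ring)
  linarith
end

section
open Set Filter Topology Metric Asymptotics

/-- normalising coordinate in the trace zero case -/
noncomputable def Sf (c : ℝ) (β z : ℂ) : ℂ := c * z - Complex.I * β * (starRingEnd ℂ) z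

theorem Sf_cont (c : ℝ) (β : ℂ) : Continuous (Sf c β) := by unfold Sf; fun_prop

theorem Sf_sub (c : ℝ) (β z w : ℂ) : Sf c β (z - w) = Sf c β z - Sf c β w := by
  unfold Sf; rw [map_sub]; ring

theorem Sf_deriv {c : ℝ} {β : ℂ} {x : ℝ → ℂ} {v : ℂ} {t : ℝ} (h : HasDerivAt x v t) :
    HasDerivAt (fun t => Sf c β (x t)) (Sf c β v) t := by
  have h2 : HasDerivAt (fun t => (starRingEnd ℂ) (x t)) ((starRingEnd ℂ) v) t :=
    Complex.conjCLE.toContinuousLinearMap.hasFDerivAt.comp_hasDerivAt t h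
  exact (h.const_mul (c:ℂ)).sub (h2.const_mul (Complex.I * β))

theorem Sf_upper (c : ℝ) (β z : ℂ) : ‖Sf c β z‖ ≤ (|c| + ‖β‖) * ‖z‖ := by
  unfold Sf
  refine (norm_sub_le _ _).trans ?_
  simp
  linarith

theorem Sf_lower (c : ℝ) (β z : ℂ) : (|c| - ‖β‖) * ‖z‖ ≤ ‖Sf c β z‖ := by
  unfold Sf
  refine le_trans ?_ (norm_sub_norm_le _ _)
  simp
  linarith

theorem Sf_inv (c : ℝ) (β z : ℂ) :
    z * ((c ^ 2 - ‖β‖ ^ 2 : ℝ) : ℂ) = c * Sf c β z + Complex.I * β * (starRingEnd ℂ) (Sf c β z) := by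
  have : ((‖β‖ ^ 2 : ℝ) : ℂ) = β * (starRingEnd ℂ) β := by
    rw [Complex.mul_conj, Complex.normSq_eq_norm_sq]
  rw [Complex.ofReal_sub, this]
  unfold Sf
  simp
  linear_combination (-(starRingEnd ℂ) β * β * z) * Complex.I_mul_I

set_option maxHeartbeats 1600000 in
theorem claimH_zero {V : ℝ → ℂ → ℂ} (hV : Continuous fun p : ℝ × ℂ => V p.1 p.2) {l0 : ℝ} {α β : ℂ}
    (hd : (fun z => V l0 z - (α * z + β * (starRingEnd ℂ) z)) =o[𝓝 0] (fun z => z))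
    (hdet : ‖β‖ < ‖α‖) (ht : α.re = 0) {δ : ℝ} (hδ : 0 < δ) : ClaimH V l0 δ := by
  obtain ⟨a, ha⟩ : ∃ a : ℝ, a = α.im := ⟨_, rfl⟩
  have hα : α = a * Complex.I := by
    apply Complex.ext <;> simp [ht, ha]
  have hαn : ‖α‖ = |a| := by rw [hα]; simp
  rw [hαn] at hdet
  have hβ0 := norm_nonneg β
  have ha0 : a ≠ 0 := abs_pos.1 (hβ0.trans_lt hdet)
  obtain ⟨ω, hω2, hωa⟩ : ∃ ω : ℝ, ω ^ 2 = a ^ 2 - ‖β‖ ^ 2 ∧ 0 < ω * a := by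
    have hpos : 0 < a ^ 2 - ‖β‖ ^ 2 := by rw [← sq_abs a]; nlinarith
    have hs := Real.sqrt_pos.2 hpos
    have hsq := Real.sq_sqrt hpos.le
    rcases lt_or_gt_of_ne ha0 with h | h
    · exact ⟨-Real.sqrt (a ^ 2 - ‖β‖ ^ 2), by rw [neg_sq, hsq], by nlinarith⟩
    · exact ⟨Real.sqrt (a ^ 2 - ‖β‖ ^ 2), hsq, by positivity⟩
  have hω0 : ω ≠ 0 := by rintro rfl; simp at hωa
  have hωp : 0 < |ω| := abs_pos.2 hω0
  obtain ⟨c, hc⟩ : ∃ c : ℝ, c = ω + a := ⟨_, rfl⟩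
  obtain ⟨D, hD⟩ : ∃ D : ℝ, D = c ^ 2 - ‖β‖ ^ 2 := ⟨_, rfl⟩
  have hDp : 0 < D := by rw [hD, hc]; nlinarith [sq_nonneg ω]
  have hcβ : ‖β‖ < |c| := by
    rw [hD] at hDp
    rw [← sq_abs c] at hDp
    nlinarith [abs_nonneg c]
  obtain ⟨m, hm⟩ : ∃ m : ℝ, m = |c| - ‖β‖ := ⟨_, rfl⟩
  obtain ⟨M, hM⟩ : ∃ M : ℝ, M = |c| + ‖β‖ := ⟨_, rfl⟩
  have hmp : 0 < m := by rw [hm]; linarith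
  have hMp : 0 < M := by rw [hM]; linarith
  have hlow : ∀ z, m * ‖z‖ ≤ ‖Sf c β z‖ := fun z => by rw [hm]; exact Sf_lower c β z
  have hup : ∀ z, ‖Sf c β z‖ ≤ M * ‖z‖ := fun z => by rw [hM]; exact Sf_upper c β z
  have hDc : (D:ℂ) ≠ 0 := by exact_mod_cast hDp.ne'
  obtain ⟨u, hu⟩ : ∃ u : ℂ, u = (c + Complex.I * β) / D := ⟨_, rfl⟩
  have hββ : β * (starRingEnd ℂ) β = ((‖β‖ ^ 2 : ℝ) : ℂ) := by
    rw [Complex.mul_conj, Complex.normSq_eq_norm_sq]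
  have hreal : ∀ z : ℂ, ∀ s : ℝ, Sf c β z = s → z = 0 + s * u := by
    intro z s h
    have := Sf_inv c β z
    rw [h, Complex.conj_ofReal, ← hD] at this
    rw [hu, zero_add, ← mul_div_assoc, eq_div_iff hDc]
    linear_combination this
  have hSJ : ∀ z, Sf c β (α * z + β * (starRingEnd ℂ) z) = Complex.I * ω * Sf c β z := by
    intro z
    have e1 : (c:ℂ) = ω + a := by rw [hc]; push_cast; rfl
    have e2 : ((ω:ℂ)) ^ 2 = a ^ 2 - β * (starRingEnd ℂ) β := by
      rw [hββ]; exact_mod_cast hω2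
    unfold Sf
    rw [hα, e1]
    simp only [map_add, map_mul, Complex.conj_ofReal, Complex.conj_I, RingHomCompTriple.comp_apply, RingHom.id_apply]
    linear_combination (-Complex.I * z) * e2 + ((starRingEnd ℂ) z * β * (a + ω)) * Complex.I_mul_I
  have hu0 : u ≠ 0 := by
    intro h
    have h1 : (c:ℂ) + Complex.I * β = 0 := by
      rw [h, eq_comm, div_eq_zero_iff] at hu
      exact hu.resolve_right hDc
    have h2 : (c:ℂ) = -(Complex.I * β) := by linear_combination h1
    have h3 := congrArg norm h2
    simp at h3
    linarith
  have hup0 : 0 < ‖u‖ := norm_pos_iff.2 hu0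
  obtain ⟨c0, hc0⟩ : ∃ c0 : ℝ, c0 = ω * ((α * u + β * (starRingEnd ℂ) u) / u).im := ⟨_, rfl⟩
  have hc0p : 0 < c0 := by
    have e1 : ((α * u + β * (starRingEnd ℂ) u) / u).im * ‖u‖ ^ 2 =
        (α * (u * (starRingEnd ℂ) u) + β * (starRingEnd ℂ) u * (starRingEnd ℂ) u).im := by
      have : (α * u + β * (starRingEnd ℂ) u) / u * (u * (starRingEnd ℂ) u) =
          α * (u * (starRingEnd ℂ) u) + β * (starRingEnd ℂ) u * (starRingEnd ℂ) u := by
        field_simp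
      rw [← this, Complex.mul_conj, Complex.normSq_eq_norm_sq, Complex.im_mul_ofReal]
    have e2 : |(β * (starRingEnd ℂ) u * (starRingEnd ℂ) u).im| ≤ ‖β‖ * ‖u‖ ^ 2 := by
      refine (Complex.abs_im_le_norm _).trans ?_
      rw [norm_mul, norm_mul, RCLike.norm_conj]
      apply le_of_eq; ring
    rw [Complex.mul_conj, Complex.normSq_eq_norm_sq, Complex.add_im, Complex.im_mul_ofReal, ← ha] at e1
    have e3 : 0 < c0 * ‖u‖ ^ 2 := by
      rw [hc0, mul_assoc, e1, mul_add]
      have e4 : |ω * (β * (starRingEnd ℂ) u * (starRingEnd ℂ) u).im| ≤ |ω| * (‖β‖ * ‖u‖ ^ 2) := by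
        rw [abs_mul]; gcongr
      have e5 := neg_abs_le (ω * (β * (starRingEnd ℂ) u * (starRingEnd ℂ) u).im)
      have e6 : ω * a = |ω| * |a| := by rw [← abs_mul, abs_of_pos hωa]
      have e7 : |ω| * (‖β‖ * ‖u‖ ^ 2) < |ω| * (|a| * ‖u‖ ^ 2) := by gcongr
      have e8 : ω * (a * ‖u‖ ^ 2) = |ω| * (|a| * ‖u‖ ^ 2) := by rw [← mul_assoc, e6, mul_assoc]
      linarith
    exact pos_of_mul_pos_left e3 (by positivity)
  have hpi := Real.pi_pos
  obtain ⟨κ, hκ⟩ : ∃ κ : ℝ, κ = |ω| / (32 * Real.pi) := ⟨_, rfl⟩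
  have hκp : 0 < κ := by rw [hκ]; positivity
  have hκ2 : κ < |ω| / (16 * Real.pi) := by rw [hκ]; gcongr; norm_num
  obtain ⟨c1, hc1p, hc1a, hc1b⟩ : ∃ c1 : ℝ, 0 < c1 ∧ c1 ≤ κ * m / (8 * M) ∧ c1 ≤ c0 / (2 * |ω|) :=
    ⟨min (κ * m / (8 * M)) (c0 / (2 * |ω|)), by positivity, min_le_left _ _, min_le_right _ _⟩
  obtain ⟨η, hη, hsmall⟩ := Metric.eventually_nhds_iff.1 (hd.def hc1p)
  obtain ⟨ρ, hρ⟩ : ∃ ρ : ℝ, ρ = m * min δ η / 8 := ⟨_, rfl⟩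
  have hρp : 0 < ρ := by rw [hρ]; positivity
  have hbd : ∀ z, ‖Sf c β z‖ ≤ 4 * ρ → ‖z‖ < δ ∧ ‖z‖ < η ∧ ‖z‖ ≤ 4 * ρ / m := by
    intro z hz
    have h1 := (hlow z).trans hz
    have h2 : ‖z‖ ≤ 4 * ρ / m := by rw [le_div_iff₀ hmp]; linarith
    have h3 : 4 * ρ / m = min δ η / 2 := by rw [hρ]; field_simp; ring
    have h4 : 0 < min δ η := lt_min hδ hη
    rw [h3] at h2
    exact ⟨by linarith [min_le_left δ η], by linarith [min_le_right δ η], by rw [h3]; exact h2⟩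
  -- error at l0 on the shell
  have herr0 : ∀ z, ‖Sf c β z‖ ≤ 4 * ρ → ‖Sf c β (V l0 z) - Complex.I * ω * Sf c β z‖ < κ * ρ := by
    intro z hz
    obtain ⟨-, h1, h2⟩ := hbd z hz
    rw [← hSJ, ← Sf_sub]
    refine (hup _).trans_lt ?_
    have h3 := hsmall (y := z) (by simpa using h1)
    calc _ ≤ M * (c1 * ‖z‖) := by gcongr
      _ ≤ M * ((κ * m / (8 * M)) * (4 * ρ / m)) := by gcongr
      _ = κ * ρ / 2 := by field_simp; ring
      _ < κ * ρ := by linarith [mul_pos hκp hρp]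
  have hSu : ∀ s : ℝ, Sf c β (s * u) = s := by
    intro s
    have h1 : Sf c β (s * u) * D = s * D := by
      have hDD : (D:ℂ) = c ^ 2 - β * (starRingEnd ℂ) β := by rw [hD, hββ]; push_cast; rfl
      have h2 : u * D = c + Complex.I * β := by rw [hu]; field_simp
      have h3 : (starRingEnd ℂ) u * D = c - Complex.I * (starRingEnd ℂ) β := by
        have := congrArg (starRingEnd ℂ) h2
        simp at this
        linear_combination this
      unfold Sf
      rw [map_mul, Complex.conj_ofReal]
      linear_combination (c * s) * h2 - (Complex.I * β * s) * h3 + s * (β * (starRingEnd ℂ) β) * Complex.I_mul_I - s * hDD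
    exact mul_right_cancel₀ hDc h1
  have hsec0 : ∀ s ∈ Icc (3 / 4 * ρ) (5 / 2 * ρ), 0 < ω * (V l0 (0 + s * u) / u).im := by
    intro s hs
    have hs0 : 0 < s := lt_of_lt_of_le (by positivity) hs.1
    rw [zero_add]
    have h1 := (hbd (s * u) (by rw [hSu]; simp [abs_of_pos hs0]; linarith [hs.2])).2.1
    have h3 := hsmall (y := s * u) (by simpa using h1)
    have e1 : V l0 (s * u) / u = (s:ℂ) * ((α * u + β * (starRingEnd ℂ) u) / u) +
        (V l0 (s * u) - (α * (s * u) + β * (starRingEnd ℂ) (s * u))) / u := by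
      rw [map_mul, Complex.conj_ofReal]
      field_simp
      ring
    rw [e1, Complex.add_im, Complex.im_ofReal_mul, mul_add]
    have e2 : |ω * ((V l0 (s * u) - (α * (s * u) + β * (starRingEnd ℂ) (s * u))) / u).im| ≤ s * c0 / 2 := by
      rw [abs_mul]
      have e3 := Complex.abs_im_le_norm ((V l0 (s * u) - (α * (s * u) + β * (starRingEnd ℂ) (s * u))) / u)
      rw [norm_div] at e3
      rw [norm_mul, Complex.norm_real, Real.norm_of_nonneg hs0.le] at h3
      have e4 : ‖V l0 (s * u) - (α * (s * u) + β * (starRingEnd ℂ) (s * u))‖ / ‖u‖ ≤ c0 / (2 * |ω|) * s := by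
        rw [div_le_iff₀ hup0, mul_assoc]
        refine h3.trans ?_
        gcongr
      calc _ ≤ |ω| * (c0 / (2 * |ω|) * s) := by
            gcongr
            exact e3.trans e4
        _ = _ := by field_simp
    have e5 := neg_abs_le (ω * ((V l0 (s * u) - (α * (s * u) + β * (starRingEnd ℂ) (s * u))) / u).im)
    have e6 : ω * (s * ((α * u + β * (starRingEnd ℂ) u) / u).im) = s * c0 := by rw [hc0]; ring
    rw [e6]
    linarith [mul_pos hs0 hc0p]
  have hev1 : ∀ᶠ l in 𝓝 l0, ∀ z ∈ {z | ‖Sf c β z‖ ≤ 4 * ρ},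
      ‖Sf c β (V l z) - Complex.I * ω * Sf c β z‖ < κ * ρ := by
    have hcp : IsCompact {z | ‖Sf c β z‖ ≤ 4 * ρ} := by
      apply (isCompact_closedBall (0:ℂ) δ).of_isClosed_subset
        (isClosed_le (Sf_cont c β).norm continuous_const)
      intro z hz
      rw [mem_closedBall_zero_iff]
      exact (hbd z hz).1.le
    apply hcp.eventually_forall_of_forall_eventually
    intro z hz
    have hc : Continuous fun p : ℝ × ℂ => ‖Sf c β (V p.1 p.2) - Complex.I * ω * Sf c β p.2‖ := by
      have h1 := (Sf_cont c β).comp hV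
      have h2 := (Sf_cont c β).comp (continuous_snd (X := ℝ) (Y := ℂ))
      exact (h1.sub (continuous_const.mul h2)).norm
    exact hc.continuousAt.eventually_lt_const (herr0 z hz)
  have hev2 : ∀ᶠ l in 𝓝 l0, ∀ s ∈ Icc (3 / 4 * ρ) (5 / 2 * ρ), 0 < ω * (V l (0 + s * u) / u).im := by
    apply isCompact_Icc.eventually_forall_of_forall_eventually
    intro s hs
    have hc : Continuous fun p : ℝ × ℝ => ω * (V p.1 (0 + p.2 * u) / u).im := by
      have h1 : Continuous fun p : ℝ × ℝ => V p.1 (0 + p.2 * u) :=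
        hV.comp (by fun_prop : Continuous fun p : ℝ × ℝ => (p.1, 0 + (p.2:ℂ) * u))
      exact continuous_const.mul (Complex.continuous_im.comp (h1.div_const u))
    exact hc.continuousAt.eventually_const_lt (hsec0 s hs)
  refine ⟨ρ / (2 * M), by positivity, ?_⟩
  filter_upwards [hev1, hev2] with l hl1 hl2 W φ hφ hW z T hT hper hz t
  have hWV : ∀ z, ρ / 2 ≤ ‖Sf c β z‖ → W z = V l z := by
    intro z hz
    apply hW
    rw [div_le_iff₀ (by positivity)]
    linarith [hup z]
  by_contra hcon
  push Not at hcon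
  have hcS : Continuous fun t => ‖Sf c β (φ t z)‖ := ((Sf_cont c β).comp (hφ.ct z)).norm
  have hstart : ‖Sf c β (φ 0 z)‖ ≤ ρ := by
    rw [hφ.zero]
    rw [lt_div_iff₀ (by positivity)] at hz
    linarith [hup z]
  have hend : 2 * ρ ≤ ‖Sf c β (φ t z)‖ := by
    by_contra h
    push Not at h
    linarith [(hbd (φ t z) (by linarith)).1]
  obtain ⟨t1, ht1⟩ := mem_range_of_exists_le_of_exists_ge (c := ρ) hcS ⟨0, hstart⟩ ⟨t, by linarith⟩
  obtain ⟨t2, ht2⟩ := mem_range_of_exists_le_of_exists_ge (c := 2 * ρ) hcS ⟨0, by linarith⟩ ⟨t, hend⟩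
  have hZd : ∀ t, HasDerivAt (fun t => Sf c β (φ t z)) (Sf c β (W (φ t z))) t := fun t =>
    Sf_deriv (hφ.deriv z t)
  have herr : ∀ t, ρ / 2 ≤ ‖Sf c β (φ t z)‖ → ‖Sf c β (φ t z)‖ ≤ 4 * ρ →
      ‖Sf c β (W (φ t z)) - Complex.I * ω * Sf c β (φ t z)‖ ≤ κ * ρ := by
    intro t h1 h2
    rw [hWV _ h1]
    exact (hl1 _ h2).le
  obtain ⟨p, sp, hp, hp1, hp2⟩ := turn (κ := κ) hω0 hρp hZd (fun t h1 h2 => herr t h1 (by linarith)) hκ2 ht1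
  obtain ⟨q, sq, hq, hq1, hq2⟩ := turn (κ := κ) hω0 (ρ := 2 * ρ) (by positivity) hZd (fun t h1 h2 => by
    have := herr t (by linarith) (by linarith)
    nlinarith [mul_pos hκp hρp]) hκ2 ht2
  have hseg : ∀ s ∈ Icc (3 / 4 * ρ) (5 / 2 * ρ), 0 < ω * (W (0 + s * u) / u).im := by
    intro s hs
    have hs0 : 0 < s := lt_of_lt_of_le (by positivity) hs.1
    rw [hWV _ (by rw [zero_add, hSu]; simp [abs_of_pos hs0]; linarith [hs.1])]
    exact hl2 s hs
  have hpq : sp = sq := by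
    rcases lt_or_gt_of_ne hω0 with h | h
    · exact KL_neg hφ hu0 (a := 3 / 4 * ρ) (b := 5 / 2 * ρ) (fun s hs => by
        have := hseg s hs
        by_contra h2
        push Not at h2
        nlinarith) hT hper ⟨by linarith, by linarith⟩ ⟨by linarith, by linarith⟩ (hreal _ _ hp) (hreal _ _ hq)
    · exact KL hφ hu0 (a := 3 / 4 * ρ) (b := 5 / 2 * ρ) (fun s hs => by
        have := hseg s hs
        exact (pos_iff_pos_of_mul_pos this).1 h) hT hper ⟨by linarith, by linarith⟩ ⟨by linarith, by linarith⟩ (hreal _ _ hp) (hreal _ _ hq)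
  linarith
end

section
open Set Filter Topology Metric Asymptotics

theorem claimH_any {V : ℝ → ℂ → ℂ} (hV : Continuous fun p : ℝ × ℂ => V p.1 p.2) {l0 : ℝ} {α β : ℂ}
    (hd : (fun z => V l0 z - (α * z + β * (starRingEnd ℂ) z)) =o[𝓝 0] (fun z => z))
    (hdet : ‖β‖ < ‖α‖) {δ : ℝ} (hδ : 0 < δ) : ClaimH V l0 δ := by
  by_cases ht : α.re = 0
  · exact claimH_zero hV hd hdet ht hδ
  · exact claimH_ne hV hd hdet ht hδ

theorem claimH_unif {V : ℝ → ℂ → ℂ} {δ : ℝ} (h : ∀ l, ClaimH V l δ) :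
    ∃ ε > 0, ∀ l ∈ Icc (0:ℝ) 1, ∀ (W : ℂ → ℂ) (φ : ℝ → ℂ → ℂ), IsFlow φ W →
    (∀ z, ε ≤ ‖z‖ → W z = V l z) → ∀ z T, 0 < T → φ T z = z → ‖z‖ < ε → ∀ t, ‖φ t z‖ < δ := by
  refine (isCompact_Icc (a := (0:ℝ)) (b := 1)).induction_on
    (p := fun s => ∃ ε > 0, ∀ l ∈ s, ∀ (W : ℂ → ℂ) (φ : ℝ → ℂ → ℂ), IsFlow φ W →
    (∀ z, ε ≤ ‖z‖ → W z = V l z) → ∀ z T, 0 < T → φ T z = z → ‖z‖ < ε → ∀ t, ‖φ t z‖ < δ) ?_ ?_ ?_ ?_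
  · exact ⟨1, one_pos, fun l hl => hl.elim⟩
  · rintro s t hst ⟨ε, hε, h⟩
    exact ⟨ε, hε, fun l hl => h l (hst hl)⟩
  · rintro s t ⟨ε, hε, h⟩ ⟨ε', hε', h'⟩
    refine ⟨min ε ε', lt_min hε hε', fun l hl W φ hφ hW z T hT hz hzε => ?_⟩
    rcases hl with hl | hl
    · exact h l hl W φ hφ (fun z hz => hW z ((min_le_left _ _).trans hz)) z T hT hz
        (hzε.trans_le (min_le_left _ _))
    · exact h' l hl W φ hφ (fun z hz => hW z ((min_le_right _ _).trans hz)) z T hT hz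
        (hzε.trans_le (min_le_right _ _))
  · intro l _
    obtain ⟨ε, hε, h⟩ := h l
    exact ⟨_, mem_nhdsWithin_of_mem_nhds h, ε, hε, fun l hl => hl⟩
end

section
open Set Filter Topology Metric Asymptotics

/-- logarithm lift of the vector field quotient -/
theorem lift_exists {V : ℝ → ℂ → ℂ} (hV : Continuous fun p : ℝ × ℂ => V p.1 p.2)
    (hne : ∀ l z, z ≠ 0 → V l z ≠ 0) :
    ∃ L : ℝ × ℂ → ℂ, Continuous L ∧
      ∀ l ζ, Complex.exp (L (l, ζ)) = V l (Complex.exp ζ) / Complex.exp ζ := by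
  obtain ⟨L, hL, h⟩ := log_lift (E := ℝ × ℂ)
    (F := fun p => V p.1 (Complex.exp p.2) / Complex.exp p.2) (by
      refine Continuous.div ?_ (Complex.continuous_exp.comp continuous_snd) (fun x => Complex.exp_ne_zero _)
      exact hV.comp (continuous_fst.prodMk (Complex.continuous_exp.comp continuous_snd)))
    (fun x => div_ne_zero (hne _ _ (Complex.exp_ne_zero _)) (Complex.exp_ne_zero _))
  exact ⟨L, hL, fun l ζ => h (l, ζ)⟩

theorem slit_of_near {w : ℂ} (h : ‖w - 1‖ < 1) : w ∈ Complex.slitPlane := by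
  left
  have := (Complex.abs_re_le_norm (w - 1)).trans_lt h
  rw [abs_lt] at this
  simp at this
  linarith [this.1]

/-- index computation, generic: if `F θ * exp(i n θ) / γ` stays near 1 then increment of lift is `- 2 π i n`. -/
theorem incr_of_near {ℓ : ℝ → ℂ} (hℓ : Continuous ℓ) {γ : ℂ} (hγ : γ ≠ 0) (n : ℤ)
    (h : ∀ θ : ℝ, ‖Complex.exp (ℓ θ) * Complex.exp (n * θ * Complex.I) / γ - 1‖ < 1)  
    (hper : Complex.exp (ℓ (2 * Real.pi)) = Complex.exp (ℓ 0)) :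
    ℓ (2 * Real.pi) - ℓ 0 = - (n * (2 * Real.pi * Complex.I)) := by
  have hw : Continuous fun θ : ℝ => Complex.exp (ℓ θ) * Complex.exp (n * θ * Complex.I) / γ := by
    fun_prop
  have hD : Continuous fun θ : ℝ => ℓ θ + n * θ * Complex.I -
      Complex.log (Complex.exp (ℓ θ) * Complex.exp (n * θ * Complex.I) / γ) := by
    have h2 := hw.clog (fun θ => slit_of_near (h θ))
    fun_prop
  have := exp_const (S := univ) (c := γ) isPreconnected_univ hD.continuousOn (fun θ _ => by
    have hne : Complex.exp (ℓ θ) * Complex.exp (n * θ * Complex.I) / γ ≠ 0 :=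
      div_ne_zero (mul_ne_zero (Complex.exp_ne_zero _) (Complex.exp_ne_zero _)) hγ
    rw [Complex.exp_sub, Complex.exp_log hne, Complex.exp_add]
    have := Complex.exp_ne_zero (ℓ θ)
    have := Complex.exp_ne_zero (n * θ * Complex.I)
    field_simp) (mem_univ (2 * Real.pi)) (mem_univ 0)
  have e : Complex.exp (n * ((2 * Real.pi : ℝ):ℂ) * Complex.I) = 1 := by
    rw [Complex.exp_eq_one_iff]; exact ⟨n, by push_cast; ring⟩
  simp only [e, hper, Complex.ofReal_zero, mul_zero, zero_mul, Complex.exp_zero, add_zero] at this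
  push_cast at this
  linear_combination this
end

section
open Set Filter Topology Metric Asymptotics

theorem lift_circle {V : ℂ → ℂ} {α β : ℂ}
    (hd : (fun z => V z - (α * z + β * (starRingEnd ℂ) z)) =o[𝓝 0] (fun z => z)) {c : ℝ} (hc : 0 < c) :
    ∃ r : ℝ, ∀ θ : ℝ, ‖V (Complex.exp (r + θ * Complex.I)) / Complex.exp (r + θ * Complex.I)
      - (α + β * Complex.exp (-2 * θ * Complex.I))‖ ≤ c := by
  obtain ⟨η, hη, h⟩ := Metric.eventually_nhds_iff.1 (hd.def hc)
  refine ⟨Real.log (η / 2), fun θ => ?_⟩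
  set z := Complex.exp ((Real.log (η / 2) : ℝ) + θ * Complex.I) with hz
  have hz0 : z ≠ 0 := Complex.exp_ne_zero _
  have hzn : ‖z‖ = η / 2 := by
    rw [hz, Complex.norm_exp]; simp [Real.exp_log (half_pos hη)]
  have hb := h (y := z) (by rw [dist_zero_right, hzn]; linarith)
  have hcj : (starRingEnd ℂ) z = z * Complex.exp (-2 * θ * Complex.I) := by
    rw [hz, ← Complex.exp_conj, ← Complex.exp_add]
    congr 1
    rw [map_add, map_mul, Complex.conj_I, Complex.conj_ofReal, Complex.conj_ofReal]; ring
  rw [hcj] at hb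
  have e : V z / z - (α + β * Complex.exp (-2 * θ * Complex.I)) =
      (V z - (α * z + β * (z * Complex.exp (-2 * θ * Complex.I)))) / z := by
    field_simp
  rw [e, norm_div, div_le_iff₀ (norm_pos_iff.2 hz0)]
  exact hb

theorem lift_index_pos {V : ℝ → ℂ → ℂ} {L : ℝ × ℂ → ℂ} (hL : Continuous L)
    (h : ∀ l ζ, Complex.exp (L (l, ζ)) = V l (Complex.exp ζ) / Complex.exp ζ) {l : ℝ} {α β : ℂ}
    (hd : (fun z => V l z - (α * z + β * (starRingEnd ℂ) z)) =o[𝓝 0] (fun z => z))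
    (hdet : ‖β‖ < ‖α‖) : ∃ ζ, L (l, ζ + 2 * Real.pi * Complex.I) = L (l, ζ) := by
  have hαp : 0 < ‖α‖ := (norm_nonneg β).trans_lt hdet
  obtain ⟨r, hr⟩ := lift_circle hd (c := (‖α‖ - ‖β‖) / 2) (by linarith)
  have := incr_of_near (ℓ := fun θ : ℝ => L (l, r + θ * Complex.I)) (γ := α) (by fun_prop)
    (norm_pos_iff.1 hαp) 0 (fun θ => by
      simp only [h]
      have e : V l (Complex.exp (r + θ * Complex.I)) / Complex.exp (r + θ * Complex.I) *
          Complex.exp ((0:ℤ) * θ * Complex.I) / α - 1 =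
        ((V l (Complex.exp (r + θ * Complex.I)) / Complex.exp (r + θ * Complex.I)
          - (α + β * Complex.exp (-2 * θ * Complex.I))) + β * Complex.exp (-2 * θ * Complex.I)) / α := by
        have := norm_pos_iff.1 hαp
        simp; field_simp; ring
      rw [e, norm_div, div_lt_one hαp]
      refine (norm_add_le _ _).trans_lt ?_
      have e2 : ‖β * Complex.exp (-2 * θ * Complex.I)‖ = ‖β‖ := by
        rw [norm_mul, Complex.norm_exp]; simp
      rw [e2]
      linarith [hr θ]) (by
      simp only [h]
      have e : Complex.exp (r + ((2 * Real.pi : ℝ):ℂ) * Complex.I) = Complex.exp (r + ((0:ℝ):ℂ) * Complex.I) := by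
        rw [Complex.exp_eq_exp_iff_exists_int]; exact ⟨1, by push_cast; ring⟩
      rw [e])
  refine ⟨r, ?_⟩
  simp at this
  exact sub_eq_zero.1 this

theorem lift_index_neg {V : ℝ → ℂ → ℂ} {L : ℝ × ℂ → ℂ} (hL : Continuous L)
    (h : ∀ l ζ, Complex.exp (L (l, ζ)) = V l (Complex.exp ζ) / Complex.exp ζ) {l : ℝ} {α β : ℂ}
    (hd : (fun z => V l z - (α * z + β * (starRingEnd ℂ) z)) =o[𝓝 0] (fun z => z))
    (hdet : ‖α‖ < ‖β‖) : ∃ ζ, L (l, ζ + 2 * Real.pi * Complex.I) ≠ L (l, ζ) := by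
  have hβp : 0 < ‖β‖ := (norm_nonneg α).trans_lt hdet
  obtain ⟨r, hr⟩ := lift_circle hd (c := (‖β‖ - ‖α‖) / 2) (by linarith)
  have := incr_of_near (ℓ := fun θ : ℝ => L (l, r + θ * Complex.I)) (γ := β) (by fun_prop)
    (norm_pos_iff.1 hβp) 2 (fun θ => by
      simp only [h]
      have e : V l (Complex.exp (r + θ * Complex.I)) / Complex.exp (r + θ * Complex.I) *
          Complex.exp ((2:ℤ) * θ * Complex.I) / β - 1 =
        ((V l (Complex.exp (r + θ * Complex.I)) / Complex.exp (r + θ * Complex.I)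
          - (α + β * Complex.exp (-2 * θ * Complex.I))) + α) * Complex.exp ((2:ℤ) * θ * Complex.I) / β := by
        have h1 := norm_pos_iff.1 hβp
        have h2 : Complex.exp ((2:ℤ) * θ * Complex.I) * Complex.exp (-2 * θ * Complex.I) = 1 := by
          rw [← Complex.exp_add, Complex.exp_eq_one_iff]; exact ⟨0, by push_cast; ring⟩
        rw [eq_div_iff h1, sub_mul, div_mul_cancel₀ _ h1]
        linear_combination β * h2
      rw [e, norm_div, div_lt_one hβp, norm_mul]
      have e2 : ‖Complex.exp ((2:ℤ) * θ * Complex.I)‖ = 1 := by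
        rw [Complex.norm_exp]; simp
      rw [e2, mul_one]
      refine (norm_add_le _ _).trans_lt ?_
      linarith [hr θ]) (by
      simp only [h]
      have e : Complex.exp (r + ((2 * Real.pi : ℝ):ℂ) * Complex.I) = Complex.exp (r + ((0:ℝ):ℂ) * Complex.I) := by
        rw [Complex.exp_eq_exp_iff_exists_int]; exact ⟨1, by push_cast; ring⟩
      rw [e])
  refine ⟨r, fun h2 => ?_⟩
  simp at this
  rw [h2, sub_self] at this
  have := Real.pi_ne_zero
  simp_all

/-- the polar representation -/
theorem polar_exists {V : ℝ → ℂ → ℂ} (hV : Continuous fun p : ℝ × ℂ => V p.1 p.2)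
    (hs : ∀ l, ContDiff ℝ 1 (V l))
    (hne : ∀ l z, z ≠ 0 → V l z ≠ 0) {α β : ℝ → ℂ}
    (hd : ∀ l, (fun z => V l z - (α l * z + β l * (starRingEnd ℂ) z)) =o[𝓝 0] (fun z => z))
    (hdet : ∀ l, ‖α l‖ ≠ ‖β l‖) (hdet0 : ‖β 0‖ < ‖α 0‖) :
    (∀ l, ‖β l‖ < ‖α l‖) ∧ ∃ Ψ : ℝ → ℂ → ℂ, (∀ l z, z ≠ 0 → V l z = z * Complex.exp (Ψ l z)) ∧
      (∀ l z, z ≠ 0 → ContinuousAt (fun p : ℝ × ℂ => Ψ p.1 p.2) (l, z)) ∧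
      (∀ l z, z ≠ 0 → ContDiffAt ℝ 1 (Ψ l) z) := by
  obtain ⟨L, hL, h⟩ := lift_exists hV hne
  have hper : ∀ l ζ, L (l, ζ + 2 * Real.pi * Complex.I) = L (l, ζ) := by
    obtain ⟨ζ0, hζ0⟩ := lift_index_pos hL h (hd 0) hdet0
    have hc := fun p : ℝ × ℂ => exp_const (S := (univ : Set (ℝ × ℂ)))
      (D := fun p : ℝ × ℂ => L (p.1, p.2 + 2 * Real.pi * Complex.I) - L (p.1, p.2)) (c := 1)
      isPreconnected_univ (by apply Continuous.continuousOn; fun_prop) (fun p _ => by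
        rw [Complex.exp_sub, h, h, Complex.exp_periodic]
        exact div_self (div_ne_zero (hne _ _ (Complex.exp_ne_zero _)) (Complex.exp_ne_zero _)))
      (mem_univ p) (mem_univ (0, ζ0))
    intro l ζ
    have := hc (l, ζ)
    simp only [hζ0, sub_self] at this
    exact sub_eq_zero.1 this
  have hper' : ∀ l ζ ζ', Complex.exp ζ = Complex.exp ζ' → L (l, ζ) = L (l, ζ') := by
    intro l ζ ζ' he
    obtain ⟨n, hn⟩ := Complex.exp_eq_exp_iff_exists_int.1 he
    have hp : Function.Periodic (fun ζ => L (l, ζ)) (2 * Real.pi * Complex.I) := hper l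
    rw [hn]
    exact hp.int_mul n ζ'
  refine ⟨fun l => ?_, fun l z => L (l, Complex.log z), ?_, ?_, ?_⟩
  · rcases lt_or_gt_of_ne (hdet l) with h1 | h1
    · obtain ⟨ζ, hζ⟩ := lift_index_neg hL h (hd l) h1
      exact absurd (hper l ζ) hζ
    · exact h1
  · intro l z hz
    rw [h, Complex.exp_log hz]; field_simp
  all_goals
    have hca : ∀ l z, z ≠ 0 → ContinuousAt (fun p : ℝ × ℂ => L (p.1, Complex.log p.2)) (l, z) := by
      intro l z0 hz0
      have e : (fun p : ℝ × ℂ => L (p.1, Complex.log p.2)) =ᶠ[𝓝 (l, z0)]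
          fun p : ℝ × ℂ => L (p.1, Complex.log (p.2 / z0) + Complex.log z0) := by
        have : ∀ᶠ p : ℝ × ℂ in 𝓝 (l, z0), p.2 ≠ 0 := continuous_snd.continuousAt.eventually_ne hz0
        filter_upwards [this] with p hp
        apply hper'
        rw [Complex.exp_log hp, Complex.exp_add, Complex.exp_log hz0, Complex.exp_log (div_ne_zero hp hz0)]
        field_simp
      refine ContinuousAt.congr ?_ e.symm
      refine hL.continuousAt.comp (ContinuousAt.prodMk continuousAt_fst ?_)
      refine ContinuousAt.add (ContinuousAt.clog ?_ ?_) continuousAt_const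
      · exact continuousAt_snd.div_const _
      · simp [hz0]
  · exact hca
  · intro l z0 hz0
    have hz : ContinuousAt (fun z => L (l, Complex.log z)) z0 :=
      (hca l z0 hz0).comp (f := fun z => (l, z)) (by fun_prop)
    have hw0 : V l z0 / z0 ≠ 0 := div_ne_zero (hne l z0 hz0) hz0
    have e : (fun z => L (l, Complex.log z)) =ᶠ[𝓝 z0]
        fun z => L (l, Complex.log z0) + Complex.log ((V l z / z) / (V l z0 / z0)) := by
      have h1 : ∀ᶠ z in 𝓝 z0, ‖L (l, Complex.log z) - L (l, Complex.log z0)‖ < Real.pi := by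
        have : ContinuousAt (fun z => ‖L (l, Complex.log z) - L (l, Complex.log z0)‖) z0 :=
          (hz.sub continuousAt_const).norm
        exact this.eventually_lt_const (by simpa using Real.pi_pos)
      filter_upwards [h1, eventually_ne_nhds hz0] with z hz1 hz2
      have e1 : (V l z / z) / (V l z0 / z0) = Complex.exp (L (l, Complex.log z) - L (l, Complex.log z0)) := by
        rw [Complex.exp_sub, h, h, Complex.exp_log hz2, Complex.exp_log hz0]
      have := (Complex.abs_im_le_norm _).trans_lt hz1
      rw [abs_lt] at this
      rw [e1, Complex.log_exp this.1 this.2.le]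
      ring
    refine ContDiffAt.congr_of_eventuallyEq ?_ e
    have hq : ContDiffAt ℝ 1 (fun z => (V l z / z) / (V l z0 / z0)) z0 :=
      by
      simp only [div_eq_mul_inv]
      exact ((hs l).contDiffAt.mul (contDiffAt_id.inv hz0)).mul contDiffAt_const
    refine contDiffAt_const.add ?_
    have hl : ContDiffAt ℝ 1 Complex.log ((fun z => (V l z / z) / (V l z0 / z0)) z0) := by
      have : ContDiffAt ℂ 1 Complex.log ((fun z => (V l z / z) / (V l z0 / z0)) z0) :=
        Complex.contDiffAt_log (by simp [div_self hw0])
      exact this.restrict_scalars ℝ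
    exact hl.comp z0 hq
end

section
open Set Filter Topology Metric Asymptotics

theorem angle_lemma {g w : ℂ} (hg : 0 < g.re) (hgw : 0 < (g * w).re) :
    w ∈ Complex.slitPlane ∧ ∀ c ∈ Icc (0:ℝ) 1, 0 < (g * Complex.exp (c * Complex.log w)).re := by
  have hw : w ∈ Complex.slitPlane := by
    by_contra h
    rw [Complex.mem_slitPlane_iff] at h
    push Not at h
    rw [Complex.mul_re, h.2] at hgw
    nlinarith [h.1]
  refine ⟨hw, fun c hc => ?_⟩
  have hg0 : g ≠ 0 := by rintro rfl; simp at hg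
  have hw0 : w ≠ 0 := Complex.slitPlane_ne_zero hw
  have ha := Complex.abs_arg_lt_pi_div_two_iff.2 (Or.inl hg)
  rw [abs_lt] at ha
  have hb1 := Complex.neg_pi_lt_arg w
  have hb2 := Complex.arg_le_pi w
  have key : ∀ c : ℝ, (g * Complex.exp (c * Complex.log w)).re =
      Real.exp (Real.log ‖g‖ + c * Real.log ‖w‖) * Real.cos (g.arg + c * w.arg) := by
    intro c
    conv_lhs => rw [← Complex.exp_log hg0]
    rw [← Complex.exp_add, Complex.exp_re]
    simp [Complex.log_re, Complex.log_im]
  have h1 := key 1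
  rw [Complex.ofReal_one, one_mul, Complex.exp_log hw0, one_mul, one_mul] at h1
  rw [h1] at hgw
  have hcos : 0 < Real.cos (g.arg + w.arg) := pos_of_mul_pos_right hgw (Real.exp_pos _).le
  have hlt : g.arg + w.arg < Real.pi / 2 := by
    by_contra h
    push Not at h
    have := Real.cos_nonpos_of_pi_div_two_le_of_le h (by linarith)
    linarith
  have hgt : -(Real.pi / 2) < g.arg + w.arg := by
    by_contra h
    push Not at h
    have := Real.cos_nonpos_of_pi_div_two_le_of_le (x := -(g.arg + w.arg)) (by linarith) (by linarith)
    rw [Real.cos_neg] at this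
    linarith
  rw [key c]
  refine mul_pos (Real.exp_pos _) (Real.cos_pos_of_mem_Ioo ⟨?_, ?_⟩)
  · nlinarith [hc.1, hc.2, mul_nonneg hc.1 (by linarith : 0 ≤ g.arg + w.arg + Real.pi / 2),
      mul_nonneg (sub_nonneg.2 hc.2) (by linarith : 0 ≤ g.arg + Real.pi / 2),
      mul_pos_of_neg_of_neg (by linarith : -(g.arg + w.arg + Real.pi/2) < 0) (by linarith : -(g.arg + Real.pi/2) < 0)]
  · nlinarith [hc.1, hc.2, mul_nonneg hc.1 (by linarith : 0 ≤ Real.pi / 2 - (g.arg + w.arg)),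
      mul_nonneg (sub_nonneg.2 hc.2) (by linarith : 0 ≤ Real.pi / 2 - g.arg)]

theorem norm_log {ψ : ℂ → ℂ} {η : ℝ} (hη : 0 < η) (hψ : ∀ z, z ≠ 0 → ContinuousAt ψ z) {s : ℂ}
    (h : ∀ z, z ≠ 0 → ‖z‖ < η → s * Complex.exp (ψ z) ∈ Complex.slitPlane) :
    ∃ c, s * Complex.exp c = 1 ∧
      ∀ z, z ≠ 0 → ‖z‖ < η → ψ z = Complex.log (s * Complex.exp (ψ z)) + c := by
  have hS : IsPreconnected (Complex.exp '' {ζ | ζ.re < Real.log η}) := by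
    apply IsPreconnected.image _ _ Complex.continuous_exp.continuousOn
    exact (convex_halfSpace_re_lt _).isPreconnected
  have hmem : ∀ z, z ≠ 0 → ‖z‖ < η → z ∈ Complex.exp '' {ζ | ζ.re < Real.log η} := by
    intro z hz hzη
    refine ⟨Complex.log z, ?_, Complex.exp_log hz⟩
    show (Complex.log z).re < _
    rw [Complex.log_re]
    exact Real.log_lt_log (norm_pos_iff.2 hz) hzη
  have hmem' : ∀ z ∈ Complex.exp '' {ζ | ζ.re < Real.log η}, z ≠ 0 ∧ ‖z‖ < η := by
    rintro _ ⟨ζ, hζ, rfl⟩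
    refine ⟨Complex.exp_ne_zero _, ?_⟩
    rw [Complex.norm_exp, ← Real.lt_log_iff_exp_lt hη]
    exact hζ
  have hη2 : ‖((η / 2 : ℝ) : ℂ)‖ < η := by
    rw [Complex.norm_real, Real.norm_of_nonneg (by linarith)]; linarith
  have hη0 : ((η / 2 : ℝ) : ℂ) ≠ 0 := by
    rw [Complex.ofReal_ne_zero]; linarith
  have hs0 : s ≠ 0 := by
    rintro rfl
    have := Complex.slitPlane_ne_zero (h _ hη0 hη2)
    simp at this
  have hex : ∀ z, z ≠ 0 → ‖z‖ < η → Complex.exp (ψ z - Complex.log (s * Complex.exp (ψ z))) = s⁻¹ := by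
    intro z hz hzη
    rw [Complex.exp_sub, Complex.exp_log (Complex.slitPlane_ne_zero (h z hz hzη))]
    have := Complex.exp_ne_zero (ψ z)
    field_simp
  refine ⟨ψ (η / 2 : ℝ) - Complex.log (s * Complex.exp (ψ (η / 2 : ℝ))), ?_, fun z hz hzη => ?_⟩
  · rw [hex _ hη0 hη2, mul_inv_cancel₀ hs0]
  · have := exp_const (D := fun z => ψ z - Complex.log (s * Complex.exp (ψ z))) (c := s⁻¹) hS (by
      intro z hz
      obtain ⟨h1, h2⟩ := hmem' z hz
      apply ContinuousAt.continuousWithinAt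
      have hc := hψ z h1
      exact hc.sub ((continuousAt_const.mul hc.cexp).clog (h z h1 h2))) (fun z hz => hex z (hmem' z hz).1 (hmem' z hz).2)
      (hmem z hz hzη) (hmem _ hη0 hη2)
    rw [← this]; ring

theorem Qf_pos {α β : ℂ} (h : ‖β‖ < ‖α‖) {z : ℂ} (hz : z ≠ 0) : 0 < Qf α β z := by
  refine lt_of_lt_of_le ?_ (Qf_lower α β z)
  have h1 : 0 < ‖α‖ := (norm_nonneg β).trans_lt h
  have h2 : 0 < ‖z‖ := norm_pos_iff.2 hz
  have h3 : 0 < ‖α‖ - ‖β‖ := by linarith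
  positivity

theorem polar_norm {V : ℝ → ℂ → ℂ} (hV : Continuous fun p : ℝ × ℂ => V p.1 p.2)
    (hs : ∀ l, ContDiff ℝ 1 (V l))
    (hne : ∀ l z, z ≠ 0 → V l z ≠ 0) {α β : ℝ → ℂ}
    (hd : ∀ l, (fun z => V l z - (α l * z + β l * (starRingEnd ℂ) z)) =o[𝓝 0] (fun z => z))
    (hdet : ∀ l, ‖α l‖ ≠ ‖β l‖) (hdet0 : ‖β 0‖ < ‖α 0‖)
    (h0 : 0 < (α 0).re) (h1 : (α 1).re < 0) :
    (∀ l, ‖β l‖ < ‖α l‖) ∧ ∃ Ψ : ℝ → ℂ → ℂ, (∀ l z, z ≠ 0 → V l z = z * Complex.exp (Ψ l z)) ∧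
      (∀ l z, z ≠ 0 → ContinuousAt (fun p : ℝ × ℂ => Ψ p.1 p.2) (l, z)) ∧
      (∀ l z, z ≠ 0 → ContDiffAt ℝ 1 (Ψ l) z) ∧ ∃ N : ℤ, N ≠ 0 ∧ ∃ η > 0,
      (∀ z, z ≠ 0 → ‖z‖ < η → ∀ c ∈ Icc (0:ℝ) 1,
        0 < ((starRingEnd ℂ) (hf (α 0) (β 0) z) * (z * Complex.exp (c * Ψ 0 z))).re) ∧
      (∀ z, z ≠ 0 → ‖z‖ < η → ∀ c ∈ Icc (0:ℝ) 1,
        0 < -((starRingEnd ℂ) (hf (α 1) (β 1) z) *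
          (z * Complex.exp (c * Ψ 1 z + (1 - c) * (Real.pi * N * Complex.I)))).re) := by
  obtain ⟨hdp, Ψ, hΨ, hΨc, hΨs⟩ := polar_exists hV hs hne hd hdet hdet0
  refine ⟨hdp, ?_⟩
  have hΨl : ∀ l z, z ≠ 0 → ContinuousAt (Ψ l) z := fun l z hz => (hΨs l z hz).continuousAt
  obtain ⟨η0, hη0, hk0⟩ := claimH_tr (hd 0) (hdp 0) h0.ne'
  obtain ⟨η1, hη1, hk1⟩ := claimH_tr (hd 1) (hdp 1) h1.ne
  have A0 : ∀ z, z ≠ 0 → ‖z‖ < η0 → 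
      0 < ((starRingEnd ℂ) (hf (α 0) (β 0) z) * z * (1 * Complex.exp (Ψ 0 z))).re := by
    intro z hz hzη
    have := pos_of_mul_pos_right (hk0 z hzη hz) h0.le
    rwa [hΨ 0 z hz, ← mul_assoc, ← one_mul (Complex.exp _)] at this
  have A1 : ∀ z, z ≠ 0 → ‖z‖ < η1 → 
      0 < ((starRingEnd ℂ) (hf (α 1) (β 1) z) * z * (-1 * Complex.exp (Ψ 1 z))).re := by
    intro z hz hzη
    have := hk1 z hzη hz
    rw [hΨ 1 z hz, ← mul_assoc] at this
    rw [neg_one_mul, mul_neg, Complex.neg_re]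
    nlinarith
  obtain ⟨c0, hc0, hL0⟩ := norm_log hη0 (hΨl 0) (fun z hz hzη => (angle_lemma (Qf_pos (hdp 0) hz) (A0 z hz hzη)).1)
  obtain ⟨c1, hc1, hL1⟩ := norm_log hη1 (hΨl 1) (fun z hz hzη => (angle_lemma (Qf_pos (hdp 1) hz) (A1 z hz hzη)).1)
  rw [one_mul] at hc0
  have hN : ∃ N : ℤ, N ≠ 0 ∧ c1 - c0 = Real.pi * N * Complex.I := by
    have : Complex.exp (c1 - c0) = Complex.exp (Real.pi * Complex.I) := by
      rw [Complex.exp_sub, hc0, Complex.exp_pi_mul_I, div_one]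
      linear_combination -hc1
    obtain ⟨n, hn⟩ := Complex.exp_eq_exp_iff_exists_int.1 this
    exact ⟨2 * n + 1, by omega, by rw [hn]; push_cast; ring⟩
  obtain ⟨N, hN0, hN⟩ := hN
  refine ⟨fun l z => Ψ l z - c0, fun l z hz => ?_, fun l z hz => ?_, fun l z hz => ?_, N, hN0,
    min η0 η1, lt_min hη0 hη1, fun z hz hzη c hc => ?_, fun z hz hzη c hc => ?_⟩
  · rw [Complex.exp_sub, hc0, div_one]; exact hΨ l z hz
  · exact (hΨc l z hz).sub continuousAt_const
  · exact (hΨs l z hz).sub contDiffAt_const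
  · have hz' := hzη.trans_le (min_le_left _ _)
    have := (angle_lemma (Qf_pos (hdp 0) hz) (A0 z hz hz')).2 c hc
    rw [← mul_assoc]
    convert this using 5
    rw [sub_eq_iff_eq_add]
    exact hL0 z hz hz'
  · have hz' := hzη.trans_le (min_le_right _ _)
    have := (angle_lemma (Qf_pos (hdp 1) hz) (A1 z hz hz')).2 c hc
    rw [← mul_assoc, ← Complex.neg_re, ← mul_neg]
    convert this using 3
    have e1 : Complex.exp (Real.pi * N * Complex.I) = -1 := by
      rw [← hN, Complex.exp_sub, hc0]; linear_combination -hc1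
    have e2 : (c:ℂ) * (Ψ 1 z - c0) + (1 - c) * (Real.pi * N * Complex.I) =
        c * Complex.log (-1 * Complex.exp (Ψ 1 z)) + Real.pi * N * Complex.I := by
      have := hL1 z hz hz'
      linear_combination (c:ℂ) * this + (c:ℂ) * hN
    rw [e2, Complex.exp_add, e1]; ring
end

section
open Set Filter Topology Metric Asymptotics

theorem vhat_exists {V : ℝ → ℂ → ℂ} (hb : ∀ l z, ‖V l z‖ ≤ 1) {Ψ : ℝ → ℂ → ℂ}
    (hΨ : ∀ l z, z ≠ 0 → V l z = z * Complex.exp (Ψ l z))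
    (hΨc : ∀ l z, z ≠ 0 → ContinuousAt (fun p : ℝ × ℂ => Ψ p.1 p.2) (l, z))
    (hΨs : ∀ l z, z ≠ 0 → ContDiffAt ℝ 1 (Ψ l) z) (N : ℤ) {ε : ℝ} (hε : 0 < ε) :
    ∃ W : ℝ → ℂ → ℂ, (Continuous fun p : ℝ × ℂ => W p.1 p.2) ∧ (∀ l, ContDiff ℝ 1 (W l)) ∧
      (∃ C, ∀ l z, ‖W l z‖ ≤ C) ∧ (∀ l z, 2 * ε ≤ ‖z‖ → W l z = V l z) ∧
      (∀ l z, ‖z‖ < ε → W l z = z * Complex.exp ((l * Real.pi * N : ℝ) * Complex.I)) ∧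
      (∀ l z, z ≠ 0 → ∃ c ∈ Icc (0:ℝ) 1,
        W l z = z * Complex.exp (c * Ψ l z + (1 - c) * ((l * Real.pi * N : ℝ) * Complex.I))) := by
  obtain ⟨χ, hχ1, hχ0, hχs, hχI⟩ : ∃ χ : ℂ → ℝ, (∀ z, ‖z‖ ≤ ε → χ z = 1) ∧ (∀ z, 2 * ε ≤ ‖z‖ → χ z = 0) ∧
      ContDiff ℝ 1 χ ∧ ∀ z, χ z ∈ Icc (0:ℝ) 1 := by
    let f : ContDiffBump (0:ℂ) := ⟨ε, 2 * ε, hε, by linarith⟩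
    refine ⟨f, fun z hz => ?_, fun z hz => ?_, f.contDiff, fun z => ⟨f.nonneg, f.le_one⟩⟩
    · exact f.one_of_mem_closedBall (by simpa using hz)
    · exact f.zero_of_le_dist (by simpa using hz)
  let W : ℝ → ℂ → ℂ := fun l z => if z = 0 then 0 else
    z * Complex.exp ((1 - χ z) * Ψ l z + χ z * ((l * Real.pi * N : ℝ) * Complex.I))
  have hWne : ∀ l z, z ≠ 0 → W l z = z * Complex.exp ((1 - χ z) * Ψ l z + χ z * ((l * Real.pi * N : ℝ) * Complex.I)) :=
    fun l z hz => if_neg hz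
  have hloc : ∀ l z, ‖z‖ < ε → W l z = z * Complex.exp ((l * Real.pi * N : ℝ) * Complex.I) := by
    intro l z hz
    by_cases h : z = 0
    · simp [W, h]
    · rw [hWne l z h, hχ1 z hz.le]; simp
  have hnear : ∀ z : ℂ, z = 0 → ∀ᶠ w : ℂ in 𝓝 z, ‖w‖ < ε := by
    intro z hz
    exact continuous_norm.continuousAt.eventually_lt_const (by simpa [hz] using hε)
  refine ⟨W, ?_, ?_, ⟨2 * ε + 1, ?_⟩, ?_, hloc, ?_⟩
  · rw [continuous_iff_continuousAt]
    rintro ⟨l, z⟩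
    by_cases h : z = 0
    · have e : (fun p : ℝ × ℂ => W p.1 p.2) =ᶠ[𝓝 (l, z)]
          fun p : ℝ × ℂ => p.2 * Complex.exp ((p.1 * Real.pi * N : ℝ) * Complex.I) := by
        have : ∀ᶠ p : ℝ × ℂ in 𝓝 (l, z), ‖p.2‖ < ε :=
          (continuous_snd.tendsto (l, z)).eventually (hnear z h)
        filter_upwards [this] with p hp
        exact hloc _ _ hp
      refine ContinuousAt.congr ?_ e.symm
      apply Continuous.continuousAt
      fun_prop
    · have e : (fun p : ℝ × ℂ => W p.1 p.2) =ᶠ[𝓝 (l, z)]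
          fun p : ℝ × ℂ => p.2 * Complex.exp ((1 - χ p.2) * Ψ p.1 p.2 + χ p.2 * ((p.1 * Real.pi * N : ℝ) * Complex.I)) := by
        have : ∀ᶠ p : ℝ × ℂ in 𝓝 (l, z), p.2 ≠ 0 := continuous_snd.continuousAt.eventually_ne h
        filter_upwards [this] with p hp
        exact hWne _ _ hp
      refine ContinuousAt.congr ?_ e.symm
      have h1 := hΨc l z h
      have h2 : ContinuousAt (fun p : ℝ × ℂ => (χ p.2 : ℂ)) (l, z) := by
        have := hχs.continuous
        apply Continuous.continuousAt
        fun_prop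
      have h3 : ContinuousAt (fun p : ℝ × ℂ => ((p.1 * Real.pi * N : ℝ) * Complex.I)) (l, z) := by
        apply Continuous.continuousAt
        fun_prop
      exact continuousAt_snd.mul (((continuousAt_const.sub h2).mul h1).add (h2.mul h3)).cexp
  · intro l
    rw [contDiff_iff_contDiffAt]
    intro z
    by_cases h : z = 0
    · have e : W l =ᶠ[𝓝 z] fun z => z * Complex.exp ((l * Real.pi * N : ℝ) * Complex.I) := by
        filter_upwards [hnear z h] with p hp
        exact hloc _ _ hp
      refine ContDiffAt.congr_of_eventuallyEq ?_ e
      exact contDiffAt_id.mul contDiffAt_const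
    · have e : W l =ᶠ[𝓝 z] fun z => z * Complex.exp ((1 - χ z) * Ψ l z + χ z * ((l * Real.pi * N : ℝ) * Complex.I)) := by
        filter_upwards [eventually_ne_nhds h] with p hp
        exact hWne _ _ hp
      refine ContDiffAt.congr_of_eventuallyEq ?_ e
      have h2 : ContDiffAt ℝ 1 (fun z : ℂ => (χ z : ℂ)) z :=
        (Complex.ofRealCLM.contDiff.comp hχs).contDiffAt
      exact contDiffAt_id.mul (((contDiffAt_const.sub h2).mul (hΨs l z h)).add (h2.mul contDiffAt_const)).cexp
  · intro l z
    by_cases h : z = 0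
    · simp only [W, if_pos h, norm_zero]; positivity
    by_cases h2 : 2 * ε ≤ ‖z‖
    · rw [hWne l z h, hχ0 z h2]
      have := hb l z
      rw [hΨ l z h] at this
      simp at this ⊢
      linarith
    · rw [hWne l z h]
      push Not at h2
      have h3 := hb l z
      rw [hΨ l z h, norm_mul, Complex.norm_exp] at h3
      rw [norm_mul, Complex.norm_exp]
      have e : ((1 - (χ z : ℂ)) * Ψ l z + χ z * ((l * Real.pi * N : ℝ) * Complex.I)).re = (1 - χ z) * (Ψ l z).re := by
        simp
      rw [e]
      have h4 : Real.exp ((1 - χ z) * (Ψ l z).re) ≤ 1 + Real.exp (Ψ l z).re := by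
        rcases le_total 0 (Ψ l z).re with h5 | h5
        · have : Real.exp ((1 - χ z) * (Ψ l z).re) ≤ Real.exp (Ψ l z).re :=
            Real.exp_le_exp.2 (by nlinarith [(hχI z).1])
          linarith
        · have : Real.exp ((1 - χ z) * (Ψ l z).re) ≤ 1 :=
            Real.exp_le_one_iff.2 (mul_nonpos_of_nonneg_of_nonpos (by linarith [(hχI z).2]) h5)
          linarith [Real.exp_pos (Ψ l z).re]
      have h6 := mul_le_mul_of_nonneg_left h4 (norm_nonneg z)
      linarith
  · intro l z hz
    have h : z ≠ 0 := by
      rintro rfl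
      simp at hz; linarith
    rw [hWne l z h, hχ0 z hz, hΨ l z h]; simp
  · intro l z hz
    refine ⟨1 - χ z, ⟨by linarith [(hχI z).2], by linarith [(hχI z).1]⟩, ?_⟩
    rw [hWne l z hz]
    congr 2
    push_cast
    ring

theorem nocyc_near {α β : ℂ} (hdet : ‖β‖ < ‖α‖) {η : ℝ} (hη : 0 < η) :
    ∃ ρ > 0, ∀ (W : ℂ → ℂ) (φ : ℝ → ℂ → ℂ) (σ : ℝ), IsFlow φ W →
      (∀ z, z ≠ 0 → ‖z‖ < η → 0 < σ * ((starRingEnd ℂ) (hf α β z) * W z).re) →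
      ∀ z, z ≠ 0 → ‖z‖ < ρ → ∀ T > 0, φ T z = z → False := by
  have hαp : 0 < ‖α‖ := (norm_nonneg β).trans_lt hdet
  obtain ⟨k, hk⟩ : ∃ k : ℝ, k = ‖α‖ * (‖α‖ - ‖β‖) := ⟨_, rfl⟩
  have hkp : 0 < k := by rw [hk]; exact mul_pos hαp (by linarith)
  have hlow : ∀ z, k * ‖z‖ ^ 2 ≤ Qf α β z := fun z => by rw [hk]; exact Qf_lower α β z
  have hev : ∀ᶠ z in 𝓝 (0:ℂ), Qf α β z < k * η ^ 2 := by
    refine (Qf_cont α β).continuousAt.eventually_lt_const ?_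
    have : Qf α β 0 = 0 := by simp [Qf]
    rw [this]; positivity
  obtain ⟨ρ, hρ, h⟩ := Metric.eventually_nhds_iff.1 hev
  refine ⟨ρ, hρ, fun W φ σ hφ hW z hz hzρ T hT hper => ?_⟩
  have hq := h (y := z) (by simpa using hzρ)
  refine level_none hφ (q := Qf α β z) (σ := σ) (fun u hu => ?_) rfl hT hper
  refine hW u ?_ ?_
  · rintro rfl
    have := Qf_pos hdet hz
    rw [← hu] at this
    simp [Qf] at this
  · have := (hlow u).trans_lt (hu ▸ hq)
    exact (pow_lt_pow_iff_left₀ (norm_nonneg u) hη.le (by norm_num)).1 (lt_of_mul_lt_mul_left this hkp.le)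
end

section
open Set Filter Topology Metric Asymptotics

theorem main_complex {V : ℝ → ℂ → ℂ} (hV : Continuous fun p : ℝ × ℂ => V p.1 p.2)
    (hs : ∀ l, ContDiff ℝ 1 (V l)) (hb : ∀ l z, ‖V l z‖ ≤ 1)
    (hne : ∀ l z, z ≠ 0 → V l z ≠ 0) {α β : ℝ → ℂ}
    (hd : ∀ l, (fun z => V l z - (α l * z + β l * (starRingEnd ℂ) z)) =o[𝓝 0] (fun z => z))
    (hdet : ∀ l, ‖α l‖ ≠ ‖β l‖) (hdet0 : ‖β 0‖ < ‖α 0‖)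
    (h0 : 0 < (α 0).re) (h1 : (α 1).re < 0)
    (hnc : ∀ l ∈ ({0, 1} : Set ℝ), ∀ x : ℝ → ℂ, (∀ t, HasDerivAt x (V l (x t)) t) →
      (∃ T > 0, Function.Periodic x T) → ∀ t, x t = x 0)
    {G : Set ℂ} (hG : IsOpen G) (hGb : Bornology.IsBounded G) (hG0 : (0:ℂ) ∈ G) :
    ∃ l ∈ Icc (0:ℝ) 1, ∃ x : ℝ → ℂ, (∀ t, HasDerivAt x (V l (x t)) t) ∧
      (∃ T > 0, Function.Periodic x T) ∧ (¬ ∀ t, x t = x 0) ∧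
      range x ⊆ closure G ∧ (range x ∩ frontier G).Nonempty := by
  by_contra hcon
  obtain ⟨hdp, Ψ, hΨ, hΨc, hΨs, N, hN, η, hη, hp0, hp1⟩ := polar_norm hV hs hne hd hdet hdet0 h0 h1
  obtain ⟨δ, hδ, hδG⟩ := Metric.isOpen_iff.1 hG 0 hG0
  obtain ⟨ε1, hε1, hH⟩ := claimH_unif (δ := δ) (fun l => claimH_any hV (hd l) (hdp l) hδ)
  obtain ⟨ρ0, hρ0, hn0⟩ := nocyc_near (hdp 0) hη
  obtain ⟨ρ1, hρ1, hn1⟩ := nocyc_near (hdp 1) hη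
  obtain ⟨ε, hε, hεδ, hεε, hε0, hε1'⟩ : ∃ ε > 0, ε < δ ∧ 2 * ε ≤ ε1 ∧ 2 * ε ≤ ρ0 ∧ 2 * ε ≤ ρ1 := by
    refine ⟨min (min δ ε1) (min ρ0 ρ1) / 2, by positivity, ?_, ?_, ?_, ?_⟩
    · have := (min_le_left (min δ ε1) (min ρ0 ρ1)).trans (min_le_left _ _); linarith
    · have := (min_le_left (min δ ε1) (min ρ0 ρ1)).trans (min_le_right _ _); linarith
    · have := (min_le_right (min δ ε1) (min ρ0 ρ1)).trans (min_le_left _ _); linarith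
    · have := (min_le_right (min δ ε1) (min ρ0 ρ1)).trans (min_le_right _ _); linarith
  obtain ⟨W, hW, hWs, ⟨C, hC⟩, hWV, hloc, hform⟩ := vhat_exists hb hΨ hΨc hΨs N hε
  obtain ⟨φ, hφc, hφ0, hφa, hφd, huni⟩ := flow_exists hW hWs hC
  have hfl : ∀ l, IsFlow (φ l) (W l) := fun l =>
    ⟨hφc.comp (continuous_const.prodMk continuous_id), hφ0 l, hφa l, hφd l, (hWs l).continuous⟩
  have hWne : ∀ l z, z ≠ 0 → W l z ≠ 0 := by
    intro l z hz
    obtain ⟨c, _, e⟩ := hform l z hz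
    rw [e]
    exact mul_ne_zero hz (Complex.exp_ne_zero _)
  have hW0 : ∀ l, W l 0 = 0 := fun l => by rw [hloc l 0 (by simpa using hε), zero_mul]
  have hφz : ∀ l t, φ l t 0 = 0 := fun l t =>
    (huni l (fun _ => 0) (fun t => by rw [hW0]; exact hasDerivAt_const _ _) t).symm
  have hnz : ∀ l t z, z ≠ 0 → φ l t z ≠ 0 := by
    intro l t z hz h
    have := (hfl l).cancel t z
    rw [h, hφz] at this
    exact hz this.symm
  have hshift : ∀ l T z, φ l T z = z → ∀ t, φ l T (φ l t z) = φ l t z := by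
    intro l T z hz t
    rw [← hφa, add_comm, hφa, hz]
  have hVcyc : ∀ l z, z ≠ 0 → ∀ T > 0, φ l T z = z → (∀ t, 2 * ε ≤ ‖φ l t z‖) →
      (∀ t, HasDerivAt (fun t => φ l t z) (V l (φ l t z)) t) ∧
      (∃ T > 0, Function.Periodic (fun t => φ l t z) T) ∧ ¬ ∀ t, φ l t z = φ l 0 z := by
    intro l z hz T hT hper hfar
    have hder : ∀ t, HasDerivAt (fun t => φ l t z) (V l (φ l t z)) t := by
      intro t
      rw [← hWV l _ (hfar t)]
      exact hφd l z t
    refine ⟨hder, ⟨T, hT, fun t => ?_⟩, fun h => ?_⟩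
    · show φ l (t + T) z = φ l t z
      rw [hφa, hper]
    · have h2 := hder 0
      have h3 : HasDerivAt (fun t => φ l t z) 0 0 :=
        (hasDerivAt_const (0:ℝ) (φ l 0 z)).congr_of_eventuallyEq (Eventually.of_forall h)
      exact hne l _ (hnz l 0 z hz) (h2.unique h3)
  refine final_abstract hφc hW hfl huni hε hN (fun l _ => hloc l) (fun l _ => hWne l) hG hGb
    ((closedBall_subset_ball hεδ).trans hδG) ?_ ?_
  · intro l hl z hz T hT hper hcl t
    by_cases hfar : ∀ t, 2 * ε ≤ ‖φ l t z‖
    · obtain ⟨k1, k2, k3⟩ := hVcyc l z hz T hT hper hfar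
      by_contra ht
      refine hcon ⟨l, hl, fun t => φ l t z, k1, k2, k3, ?_, φ l t z, ⟨t, rfl⟩, ?_⟩
      · rintro _ ⟨t, rfl⟩
        exact hcl t
      · rw [hG.frontier_eq]
        exact ⟨hcl t, ht⟩
    · push Not at hfar
      obtain ⟨t0, ht0⟩ := hfar
      have := hH l hl (W l) (φ l) (hfl l) (fun z hz => hWV l z (hεε.trans hz)) (φ l t0 z) T hT
        (hshift l T z hper t0) (ht0.trans_le hεε) (t - t0)
      rw [← hφa, sub_add_cancel] at this
      exact hδG (by simpa using this)
  · intro l hl z hz T hT hper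
    by_cases hfar : ∀ t, 2 * ε ≤ ‖φ l t z‖
    · obtain ⟨k1, k2, k3⟩ := hVcyc l z hz T hT hper hfar
      exact k3 (hnc l hl _ k1 k2)
    · push Not at hfar
      obtain ⟨t0, ht0⟩ := hfar
      rcases hl with rfl | rfl
      · refine hn0 (W 0) (φ 0) 1 (hfl 0) (fun z hz hzη => ?_) _ (hnz 0 t0 z hz) (ht0.trans_le hε0) T hT
          (hshift 0 T z hper t0)
        obtain ⟨c, hc, e⟩ := hform 0 z hz
        rw [e, one_mul]
        convert hp0 z hz hzη c hc using 5
        simp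
      · refine hn1 (W 1) (φ 1) (-1) (hfl 1) (fun z hz hzη => ?_) _ (hnz 1 t0 z hz) (ht0.trans_le hε1') T hT
          (hshift 1 T z hper t0)
        obtain ⟨c, hc, e⟩ := hform 1 z hz
        have e2 : ((1 * Real.pi * N : ℝ) : ℂ) = Real.pi * N := by push_cast; ring
        rw [e, neg_one_mul, e2]
        exact hp1 z hz hzη c hc
end

section
open Set Filter Topology Metric Asymptotics

/-- the damped vector field in the complex coordinate -/
noncomputable def dampU (V : ℝ × ℝ → ℝ × ℝ) (z : ℂ) : ℂ :=
  Complex.equivRealProdCLM.symm (V (Complex.equivRealProdCLM z))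

noncomputable def dampV (V : ℝ × ℝ → ℝ × ℝ) (z : ℂ) : ℂ :=
  (1 + ‖dampU V z‖ ^ 2)⁻¹ • dampU V z

noncomputable def alphaM (M : Matrix (Fin 2) (Fin 2) ℝ) : ℂ :=
  ⟨(M 0 0 + M 1 1) / 2, (M 1 0 - M 0 1) / 2⟩
noncomputable def betaM (M : Matrix (Fin 2) (Fin 2) ℝ) : ℂ :=
  ⟨(M 0 0 - M 1 1) / 2, (M 1 0 + M 0 1) / 2⟩

theorem alpha_beta_det (M : Matrix (Fin 2) (Fin 2) ℝ) : ‖alphaM M‖ ^ 2 - ‖betaM M‖ ^ 2 = M.det := by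
  rw [Complex.sq_norm, Complex.sq_norm, Complex.normSq_apply, Complex.normSq_apply, Matrix.det_fin_two]
  simp only [alphaM, betaM]; ring

theorem dampU_contDiff {V : ℝ × ℝ → ℝ × ℝ} (hV : ContDiff ℝ 1 V) : ContDiff ℝ 1 (dampU V) :=
  Complex.equivRealProdCLM.symm.contDiff.comp (hV.comp Complex.equivRealProdCLM.contDiff)

theorem damp_pos (V : ℝ × ℝ → ℝ × ℝ) (z : ℂ) : 0 < (1 + ‖dampU V z‖ ^ 2)⁻¹ := by positivity

theorem damp_s_contDiff {V : ℝ × ℝ → ℝ × ℝ} (hV : ContDiff ℝ 1 V) :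
    ContDiff ℝ 1 (fun z => (1 + ‖dampU V z‖ ^ 2)⁻¹) := by
  refine ContDiff.inv (contDiff_const.add ((dampU_contDiff hV).norm_sq ℝ)) (fun z => ?_)
  positivity

theorem dampV_contDiff {V : ℝ × ℝ → ℝ × ℝ} (hV : ContDiff ℝ 1 V) : ContDiff ℝ 1 (dampV V) :=
  (damp_s_contDiff hV).smul (dampU_contDiff hV)

theorem dampV_bdd (V : ℝ × ℝ → ℝ × ℝ) (z : ℂ) : ‖dampV V z‖ ≤ 1 := by
  rw [dampV, norm_smul, Real.norm_of_nonneg (damp_pos V z).le, inv_mul_le_iff₀ (by positivity)]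
  nlinarith [sq_nonneg (‖dampU V z‖ - 1)]

theorem dampV_ne {V : ℝ × ℝ → ℝ × ℝ} (h : ∀ p : ℝ × ℝ, V p = (0, 0) → p = (0, 0)) (z : ℂ) (hz : z ≠ 0) :
    dampV V z ≠ 0 := by
  refine smul_ne_zero (damp_pos V z).ne' fun h2 => hz ?_
  have h3 : V (Complex.equivRealProdCLM z) = 0 := by
    simpa [dampU] using h2
  have := h _ h3
  exact (map_eq_zero_iff _ Complex.equivRealProdCLM.injective).1 this

theorem damp_littleO {V : ℝ × ℝ → ℝ × ℝ} (hV : ContDiff ℝ 1 V) (h0 : V (0, 0) = (0, 0)) :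
    (fun z => dampV V z - (alphaM (jacobianAt V (0, 0)) * z + betaM (jacobianAt V (0, 0)) * (starRingEnd ℂ) z))
      =o[𝓝 0] (fun z => z) := by
  have hd : HasFDerivAt V (fderiv ℝ V (0, 0)) (0, 0) := (hV.differentiable (by norm_num) _).hasFDerivAt
  obtain ⟨D, hD⟩ : ∃ D, D = fderiv ℝ V (0, 0) := ⟨_, rfl⟩
  rw [← hD] at hd
  have hU0 : dampU V 0 = 0 := by
    have : Complex.equivRealProdCLM (0:ℂ) = (0, 0) := by simp
    rw [dampU, this, h0]; exact map_zero _
  have hU : HasFDerivAt (dampU V) ((Complex.equivRealProdCLM.symm : ℝ × ℝ →L[ℝ] ℂ).comp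
      (D.comp (Complex.equivRealProdCLM : ℂ →L[ℝ] ℝ × ℝ))) 0 := by
    have h1 : HasFDerivAt V D (Complex.equivRealProdCLM (0:ℂ)) := by
      have : Complex.equivRealProdCLM (0:ℂ) = (0, 0) := by simp
      rwa [this]
    exact Complex.equivRealProdCLM.symm.hasFDerivAt.comp 0 (h1.comp 0 Complex.equivRealProdCLM.hasFDerivAt)
  have hs := ((damp_s_contDiff hV).differentiable (by norm_num) 0).hasFDerivAt
  have hm := hs.smul hU
  have ho := hm.isLittleO
  have hj : ∀ i : ℝ × ℝ, fderiv ℝ (fun q => (V q).1) (0, 0) i = (D i).1 ∧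
      fderiv ℝ (fun q => (V q).2) (0, 0) i = (D i).2 := by
    intro i
    rw [hd.fst.fderiv, hd.snd.fderiv]; exact ⟨rfl, rfl⟩
  refine ho.congr (fun z => ?_) (fun z => sub_zero z)
  have hDz : D (z.re, z.im) = z.re • D (1, 0) + z.im • D (0, 1) := by
    rw [← map_smul, ← map_smul, ← map_add]; simp
  have e : dampV V z = (1 + ‖dampU V z‖ ^ 2)⁻¹ • dampU V z := rfl
  rw [e]
  simp only [hU0, sub_zero, norm_zero]
  have hlin : ((Complex.equivRealProdCLM.symm : ℝ × ℝ →L[ℝ] ℂ).comp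
      (D.comp (Complex.equivRealProdCLM : ℂ →L[ℝ] ℝ × ℝ))) z =
      alphaM (jacobianAt V (0, 0)) * z + betaM (jacobianAt V (0, 0)) * (starRingEnd ℂ) z := by
    have e1 : ((Complex.equivRealProdCLM.symm : ℝ × ℝ →L[ℝ] ℂ).comp
      (D.comp (Complex.equivRealProdCLM : ℂ →L[ℝ] ℝ × ℝ))) z = Complex.equivRealProdCLM.symm (D (z.re, z.im)) := rfl
    rw [e1, hDz]
    apply Complex.ext
    · simp [alphaM, betaM, jacobianAt, hj]; ring
    · simp [alphaM, betaM, jacobianAt, hj]; ring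
  rw [← hlin]
  simp [hU0]

theorem damp_transfer {V : ℝ × ℝ → ℝ × ℝ} (hV : ContDiff ℝ 1 V) {x : ℝ → ℂ}
    (hx : ∀ t, HasDerivAt x (dampV V (x t)) t) (hper : ∃ T > 0, Function.Periodic x T) :
    ∃ y : ℝ → ℝ × ℝ, (∀ t, HasDerivAt y (V (y t)) t) ∧ (∃ T > 0, Function.Periodic y T) ∧
      range y = Complex.equivRealProdCLM '' range x := by
  obtain ⟨T, hT, hp⟩ := hper
  obtain ⟨y, hy, ⟨T', hT', hp'⟩, hr⟩ := time_change (V := dampU V) (damp_s_contDiff hV).continuous (damp_pos V) hx hT hp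
  refine ⟨fun t => Complex.equivRealProdCLM (y t), fun t => ?_, ⟨T', hT', fun t => ?_⟩, ?_⟩
  · have := (Complex.equivRealProdCLM : ℂ →L[ℝ] ℝ × ℝ).hasFDerivAt.comp_hasDerivAt t (hy t)
    refine (show HasDerivAt (fun t => Complex.equivRealProdCLM (y t)) _ t from this).congr_deriv ?_
    simp [dampU]
  · simp only [hp' t]
  · rw [← hr, ← range_comp]; rfl

theorem const_of_range {E : Type*} {y : ℝ → E} {F : Type*} {x : ℝ → F} {e : F → E} (he : Function.Injective e)
    (hr : range y = e '' range x) (hy : ∀ t, y t = y 0) : ∀ t, x t = x 0 := by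
  intro t
  have h : ∀ t, e (x t) = y 0 := by
    intro t
    have : e (x t) ∈ range y := by rw [hr]; exact ⟨_, ⟨t, rfl⟩, rfl⟩
    obtain ⟨s, hs⟩ := this
    rw [← hs, hy]
  exact he ((h t).trans (h 0).symm)
end

/-- **Blow up of a cycle for planar systems.**
Consider `x' = f(x,y;λ)`, `y' = g(x,y;λ)`, packaged as the vector field
`V lam p = (f p.1 p.2 lam, g p.1 p.2 lam)`, with parameter `lam ∈ [0,1]`, `V`
continuously differentiable in the phase variables and continuous in all arguments.
Assume: (i) the origin is the only equilibrium for every `lam ∈ [0,1]`;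
(ii) the Jacobian matrix at the origin is invertible for every `lam ∈ [0,1]`;
(iii) all complex eigenvalues of the Jacobian at the origin have positive real part for
`lam = 0` and negative real part for `lam = 1`;
(iv) there is no nonconstant periodic solution for `lam = 0` and `lam = 1`.
Then the system has a branch of cycles connecting the origin and infinity: for every
bounded open set `G` containing the origin there are `lam ∈ [0,1]` and a nonconstant
periodic solution whose orbit lies in the closure of `G` and touches the boundary of `G`. -/
theorem planar_blow_up_branch_of_cycles
    (V : ℝ → ℝ × ℝ → ℝ × ℝ)
    (hsmooth : ∀ lam ∈ Icc (0:ℝ) 1, ContDiff ℝ 1 (V lam))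
    (hcont : Continuous fun q : (ℝ × ℝ) × ℝ => V q.2 q.1)
    (hzero : ∀ lam ∈ Icc (0:ℝ) 1, V lam (0, 0) = (0, 0))
    (huniq : ∀ lam ∈ Icc (0:ℝ) 1, ∀ p : ℝ × ℝ, V lam p = (0, 0) → p = (0, 0))
    (hinv : ∀ lam ∈ Icc (0:ℝ) 1, (jacobianAt (V lam) (0, 0)).det ≠ 0)
    (heig0 : ∀ μ : ℂ, IsEigenvalue (jacobianAt (V 0) (0, 0)) μ → 0 < μ.re)
    (heig1 : ∀ μ : ℂ, IsEigenvalue (jacobianAt (V 1) (0, 0)) μ → μ.re < 0)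
    (hnocycle : ∀ lam ∈ ({0, 1} : Set ℝ), ∀ x : ℝ → ℝ × ℝ,
      (∀ t, HasDerivAt x (V lam (x t)) t) → (∃ T > 0, Function.Periodic x T) →
      ∀ t, x t = x 0) :
    ∀ G : Set (ℝ × ℝ), IsOpen G → Bornology.IsBounded G → (0, 0) ∈ G →
      ∃ lam ∈ Icc (0:ℝ) 1, ∃ x : ℝ → ℝ × ℝ,
        (∀ t, HasDerivAt x (V lam (x t)) t) ∧
        (∃ T > 0, Function.Periodic x T) ∧
        (¬ ∀ t, x t = x 0) ∧
        range x ⊆ closure G ∧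
        (range x ∩ frontier G).Nonempty := by
  intro G hG hGb hG0
  obtain ⟨cl, hclc, hclm, hcli⟩ : ∃ cl : ℝ → ℝ, Continuous cl ∧ (∀ l, cl l ∈ Icc (0:ℝ) 1) ∧
      ∀ l ∈ Icc (0:ℝ) 1, cl l = l := by
    refine ⟨fun l => max 0 (min l 1), by fun_prop, fun l => ⟨le_max_left _ _, ?_⟩, fun l hl => ?_⟩
    · exact max_le zero_le_one (min_le_right _ _)
    · simp [hl.1, hl.2]
  have hU : Continuous fun p : ℝ × ℂ => dampU (V (cl p.1)) p.2 := by
    unfold dampU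
    refine Complex.equivRealProdCLM.symm.continuous.comp ?_
    have : Continuous fun p : ℝ × ℂ => ((Complex.equivRealProdCLM p.2, cl p.1) : (ℝ × ℝ) × ℝ) := by
      fun_prop
    exact hcont.comp this
  have hVc : Continuous fun p : ℝ × ℂ => dampV (V (cl p.1)) p.2 := by
    unfold dampV
    have h1 : Continuous fun p : ℝ × ℂ => 1 + ‖dampU (V (cl p.1)) p.2‖ ^ 2 :=
      continuous_const.add (hU.norm.pow 2)
    refine Continuous.smul (h1.inv₀ (fun p => ?_)) hU
    positivity
  have c0 : cl 0 = 0 := hcli 0 (by simp)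
  have c1 : cl 1 = 1 := hcli 1 (by simp)
  obtain ⟨t0, d0⟩ := eig_pos (jacobianAt (V 0) (0, 0)) heig0
  obtain ⟨t1, d1⟩ := eig_neg (jacobianAt (V 1) (0, 0)) heig1
  obtain ⟨l, hl, x, hx, hper, hnc, hsub, u, ⟨hu1, hu2⟩⟩ := main_complex
    (V := fun l => dampV (V (cl l)))
    (α := fun l => alphaM (jacobianAt (V (cl l)) (0, 0)))
    (β := fun l => betaM (jacobianAt (V (cl l)) (0, 0))) hVc
    (fun l => dampV_contDiff (hsmooth _ (hclm l))) (fun l => dampV_bdd _)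
    (fun l => dampV_ne (huniq _ (hclm l)))
    (fun l => damp_littleO (hsmooth _ (hclm l)) (hzero _ (hclm l)))
    (fun l h => by
      have := alpha_beta_det (jacobianAt (V (cl l)) (0, 0))
      rw [h, sub_self] at this
      exact hinv _ (hclm l) this.symm)
    (by
      have := alpha_beta_det (jacobianAt (V 0) (0, 0))
      simp only [c0]
      refine lt_of_pow_lt_pow_left₀ 2 (norm_nonneg _) ?_
      linarith)
    (by simp only [c0, alphaM]; linarith) (by simp only [c1, alphaM]; linarith)
    (by
      intro l hl x hx hper
      have hcl : cl l = l := by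
        rcases hl with rfl | rfl
        · exact c0
        · exact c1
      simp only [hcl] at hx
      have hl' : l ∈ Icc (0:ℝ) 1 := hcl ▸ hclm l
      obtain ⟨y, hy, hyp, hr⟩ := damp_transfer (hsmooth l hl') hx hper
      exact const_of_range Complex.equivRealProdCLM.injective hr (hnocycle l hl y hy hyp))
    (G := Complex.equivRealProdCLM ⁻¹' G) (hG.preimage Complex.equivRealProdCLM.continuous)
    (by
      have := Complex.equivRealProdCLM.symm.lipschitz.isBounded_image hGb
      refine this.subset ?_
      intro z hz
      exact ⟨_, hz, Complex.equivRealProdCLM.symm_apply_apply z⟩)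
    (by simpa using hG0)
  simp only [hcli l hl] at hx
  obtain ⟨y, hy, hyp, hr⟩ := damp_transfer (hsmooth l hl) hx hper
  have hclo : (Complex.equivRealProdCLM : ℂ → ℝ × ℝ) ⁻¹' closure G = closure (Complex.equivRealProdCLM ⁻¹' G) :=
    Complex.equivRealProdCLM.toHomeomorph.preimage_closure G
  have hfro : (Complex.equivRealProdCLM : ℂ → ℝ × ℝ) ⁻¹' frontier G = frontier (Complex.equivRealProdCLM ⁻¹' G) :=
    Complex.equivRealProdCLM.toHomeomorph.preimage_frontier G
  refine ⟨l, hl, y, hy, hyp, fun h => hnc (const_of_range Complex.equivRealProdCLM.injective hr h), ?_, 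
    Complex.equivRealProdCLM u, ?_, ?_⟩
  · rw [hr]
    rintro _ ⟨z, hz, rfl⟩
    have := hsub hz
    rw [← hclo] at this
    exact this
  · rw [hr]; exact ⟨u, hu1, rfl⟩
  · rw [← hfro] at hu2
    exact hu2
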